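/- arXiv:2505.11105 — 7 statements merged into one kernel-verified Lean document; each statement's English description precedes it below -/
import Mathlib

section
/- Let F be a graph and H a 3-uniform hypergraph. Suppose H contains a partial 3-expansion of F such that every edge e of the underlying copy of F that was not enlarged by a new vertex is contained in at least |E(F)| + |V(F)| − 2 hyperedges of H. Then H contains a copy of the 3-expansion F^3. -/
/-- The number of hyperedges of `H` containing both vertices `u` and `v`. -/
def pairDeg {V : Type*} [DecidableEq V] (H : Finset (Finset V)) (u v : V) : ℕ :=
  (H.filter fun e => u ∈ e ∧ v ∈ e).card

/-- `H` contains a copy of the 3-expansion `F^3` of the graph `F`: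
an injective embedding `φ` of the vertices of `F`, together with a choice `ψ` of a new
vertex for each edge of `F`, the new vertices being pairwise distinct and distinct
from the embedded vertices, such that each edge together with its new vertex is a
hyperedge of `H`. -/
def ContainsExpansion3 {α V : Type*} [DecidableEq V]
    (F : SimpleGraph α) (H : Finset (Finset V)) : Prop :=
  ∃ (φ : α → V) (ψ : Sym2 α → V),
    Function.Injective φ ∧
    Set.InjOn ψ F.edgeSet ∧
    (∀ e ∈ F.edgeSet, ψ e ∉ Set.range φ) ∧
    ∀ a b, F.Adj a b → ({φ a, φ b, ψ s(a, b)} : Finset V) ∈ H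

/-- If fewer vertices than the codegree of `u` and `v` are forbidden, some hyperedge through `u` and
`v` has a third vertex that is not forbidden. -/
theorem exists_third_vertex_notMem_of_card_lt_pairDeg {V : Type*} [DecidableEq V]
    {H : Finset (Finset V)} (hH3 : ∀ e ∈ H, e.card = 3) {u v : V} (huv : u ≠ v)
    {X : Finset V} (hX : X.card < pairDeg H u v) :
    ∃ w, w ∉ X ∧ w ≠ u ∧ w ≠ v ∧ ({u, v, w} : Finset V) ∈ H := by
  by_contra! hcon
  refine absurd hX (not_lt.mpr ?_)
  have hsub : (H.filter fun e => u ∈ e ∧ v ∈ e) ⊆ X.image fun w => ({u, v, w} : Finset V) := by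
    intro e he
    obtain ⟨heH, hu, hv⟩ := Finset.mem_filter.mp he
    have hsubset : ({u, v} : Finset V) ⊆ e := by
      simp [Finset.insert_subset_iff, hu, hv]
    have hcard : (e \ {u, v}).card = 1 := by
      rw [Finset.card_sdiff_of_subset hsubset, hH3 e heH, Finset.card_pair huv]
    obtain ⟨w, hw⟩ := Finset.card_eq_one.mp hcard
    have hmem : w ∈ e \ {u, v} := by simp [hw]
    have heq : ({u, v, w} : Finset V) = e := by
      have h := Finset.union_sdiff_of_subset hsubset
      rw [hw] at h
      rw [← h]
      ext x
      simp
    simp only [Finset.mem_sdiff, Finset.mem_insert, Finset.mem_singleton, not_or] at hmem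
    refine Finset.mem_image.mpr ⟨w, ?_, heq⟩
    by_contra hwX
    exact hcon w hwX hmem.2.1 hmem.2.2 (heq ▸ heH)
  exact (Finset.card_le_card hsub).trans Finset.card_image_le

theorem greedy_partial_expansion {α V : Type*} [Fintype α] [DecidableEq α] [DecidableEq V]
    (F : SimpleGraph α) [DecidableRel F.Adj]
    (H : Finset (Finset V)) (hH3 : ∀ e ∈ H, e.card = 3)
    -- a partial 3-expansion of `F` in `H`:
    (φ : α → V) (hφ : Function.Injective φ)
    (S : Finset (Sym2 α)) (hS : ∀ e ∈ S, e ∈ F.edgeSet)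
    (ψ : Sym2 α → V)
    (hψinj : Set.InjOn ψ ↑S)
    (hψout : ∀ e ∈ S, ψ e ∉ Set.range φ)
    (henlarged : ∀ a b, F.Adj a b → s(a, b) ∈ S →
      ({φ a, φ b, ψ s(a, b)} : Finset V) ∈ H)
    -- every non-enlarged edge of the copy of `F` lies in at least |E(F)|+|V(F)|-2 hyperedges:
    (hheavy : ∀ a b, F.Adj a b → s(a, b) ∉ S →
      F.edgeFinset.card + Fintype.card α - 2 ≤ pairDeg H (φ a) (φ b)) :
    ContainsExpansion3 F H := by
  induction hn : (F.edgeFinset \ S).card generalizing S ψ with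
  | zero =>
    have hsub : ∀ e ∈ F.edgeSet, e ∈ S := by
      intro e he
      have h := Finset.sdiff_eq_empty_iff_subset.mp (Finset.card_eq_zero.mp hn)
      exact h (SimpleGraph.mem_edgeFinset.mpr he)
    exact ⟨φ, ψ, hφ, hψinj.mono fun e he => hsub e he, fun e he => hψout e (hsub e he),
      fun a b hab => henlarged a b hab (hsub _ hab)⟩
  | succ n ih =>
    obtain ⟨e, he⟩ : (F.edgeFinset \ S).Nonempty := Finset.card_pos.mp (by omega)
    induction e using Sym2.ind with
    | h a b =>
    obtain ⟨heF, heS⟩ := Finset.mem_sdiff.mp he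
    have hab : F.Adj a b := by simpa using heF
    have hφab : φ a ≠ φ b := hφ.ne hab.ne
    have hSE : S.card < F.edgeFinset.card :=
      Finset.card_lt_card <| (Finset.ssubset_iff_of_subset fun x hx =>
        SimpleGraph.mem_edgeFinset.mpr (hS x hx)).mpr ⟨_, heF, heS⟩
    have hV : 2 ≤ Fintype.card α := Fintype.one_lt_card_iff.mpr ⟨a, b, hab.ne⟩
    have hcard : ((Finset.univ \ {a, b}).image φ ∪ S.image ψ).card
        < pairDeg H (φ a) (φ b) := by
      have h1 : ((Finset.univ \ {a, b}).image φ).card ≤ Fintype.card α - 2 := by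
        refine Finset.card_image_le.trans ?_
        rw [Finset.card_sdiff_of_subset (Finset.subset_univ _), Finset.card_pair hab.ne,
          Finset.card_univ]
      have h2 : (S.image ψ).card ≤ S.card := Finset.card_image_le
      have h3 := Finset.card_union_le ((Finset.univ \ {a, b}).image φ) (S.image ψ)
      have h4 := hheavy a b hab heS
      omega
    obtain ⟨w, hwX, hwa, hwb, hwH⟩ :=
      exists_third_vertex_notMem_of_card_lt_pairDeg hH3 hφab hcard
    rw [Finset.mem_union, not_or] at hwX
    obtain ⟨hwφ, hwψ⟩ := hwX
    have hwrange : w ∉ Set.range φ := by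
      rintro ⟨c, rfl⟩
      refine hwφ (Finset.mem_image_of_mem φ ?_)
      have hca : c ≠ a := fun h => hwa (h ▸ rfl)
      have hcb : c ≠ b := fun h => hwb (h ▸ rfl)
      simp [hca, hcb]
    have hupd : ∀ x ∈ S, Function.update ψ s(a, b) w x = ψ x := fun x hx =>
      Function.update_of_ne (ne_of_mem_of_not_mem hx heS) _ _
    refine ih (insert s(a, b) S) ?_ (Function.update ψ s(a, b) w) ?_ ?_ ?_ ?_ ?_
    · intro x hx
      rcases Finset.mem_insert.mp hx with rfl | hx
      · exact hab
      · exact hS x hx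
    · rw [Finset.coe_insert, Set.injOn_insert (by simpa using heS)]
      refine ⟨hψinj.congr fun x hx => (hupd x hx).symm, ?_⟩
      rintro ⟨x, hx, hxw⟩
      rw [hupd x hx, Function.update_self] at hxw
      exact hwψ (Finset.mem_image.mpr ⟨x, hx, hxw⟩)
    · intro x hx
      rcases Finset.mem_insert.mp hx with rfl | hx
      · rwa [Function.update_self]
      · rw [hupd x hx]
        exact hψout x hx
    · intro c d hcd hx
      rcases Finset.mem_insert.mp hx with h | hx
      · rw [h, Function.update_self]
        rcases Sym2.eq_iff.mp h with ⟨rfl, rfl⟩ | ⟨rfl, rfl⟩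
        · exact hwH
        · rwa [Finset.insert_comm]
      · rw [hupd _ hx]
        exact henlarged c d hcd hx
    · exact fun c d hcd hx => hheavy c d hcd fun h => hx (Finset.mem_insert_of_mem h)
    · rw [Finset.sdiff_insert, Finset.card_erase_of_mem he, hn, Nat.add_sub_cancel]
end

section
/- For all positive integers k and r there exists q_0 such that for every q ≥ q_0 the following holds: if a 3-graph H contains a copy S of S_q^3 and an integer weight w(e) with 0 ≤ w(e) ≤ k is assigned to each vertex pair e inside the hyperedges of S, such that each such pair e is contained in at least w(e)+1 hyperedges of H, then some r of the q hyperedges of S form a copy of S_r^3 that is nice with respect to the weights w. -/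
open Finset in
theorem exists_card_eq_pairwise_notMem {α : Type*} [DecidableEq α] (f : α → Finset α) (d : ℕ)
    (hf : ∀ x, #(f x) ≤ d) (r : ℕ) (U : Finset α) (hU : (2 * d + 1) * r ≤ #U) :
    ∃ T ⊆ U, #T = r ∧ ∀ x ∈ T, ∀ y ∈ T, x ≠ y → y ∉ f x := by
  induction r generalizing U with
  | zero => exact ⟨∅, by simp⟩
  | succ r ih =>
    have hne : U.Nonempty := by
      rw [← card_pos]
      exact lt_of_lt_of_le (by positivity) hU
    obtain ⟨v, hv, hvd⟩ : ∃ v ∈ U, #{u ∈ U | v ∈ f u} ≤ d := by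
      refine exists_le_of_sum_le hne ?_
      have h := sum_card_bipartiteAbove_eq_sum_card_bipartiteBelow (s := U) (t := U)
        (fun u v => v ∈ f u)
      simp only [bipartiteAbove, bipartiteBelow] at h
      rw [← h]
      exact sum_le_sum fun u _ =>
        (card_le_card fun x hx => (mem_filter.1 hx).2).trans (hf u)
    set R : Finset α := insert v ({u ∈ U | v ∈ f u} ∪ f v) with hR
    have hRcard : #R ≤ 2 * d + 1 := by
      have h₁ := card_insert_le v ({u ∈ U | v ∈ f u} ∪ f v)
      have h₂ := card_union_le {u ∈ U | v ∈ f u} (f v)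
      have h₃ := hf v
      rw [hR]
      omega
    obtain ⟨T, hTU, hTr, hT⟩ := ih (U \ R) (by
      have := le_card_sdiff R U
      rw [mul_add] at hU
      omega)
    have hout : ∀ x ∈ T, x ∈ U ∧ x ≠ v ∧ v ∉ f x ∧ x ∉ f v := by
      intro x hx
      have := hTU hx
      simp only [hR, mem_sdiff, mem_insert, mem_union, mem_filter, not_or, not_and] at this
      exact ⟨this.1, this.2.1, this.2.2.1 this.1, this.2.2.2⟩
    refine ⟨insert v T, ?_, ?_, ?_⟩
    · exact insert_subset hv fun x hx => (hout x hx).1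
    · rw [card_insert_of_notMem fun h => (hout v h).2.1 rfl, hTr]
    · intro x hx y hy hxy
      rcases mem_insert.1 hx with rfl | hxT <;> rcases mem_insert.1 hy with rfl | hyT
      · exact absurd rfl hxy
      · exact (hout y hyT).2.2.2
      · exact (hout x hxT).2.2.1
      · exact hT x hxT y hyT hxy

open Finset in
theorem card_filter_superset_le {V : Type*} [Fintype V] [DecidableEq V] {H : Finset (Finset V)}
    {e h₀ : Finset V} {n : ℕ} (hH : ∀ h ∈ H, #h = n + 1) (hh₀ : h₀ ∈ H) (he : e ⊆ h₀)
    (hen : #e = n) :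
    #{h ∈ H | e ⊆ h} ≤ #{z : V | z ∉ h₀ ∧ insert z e ∈ H} + 1 := by
  refine le_trans (card_le_card (t := insert h₀
    (image (fun z => insert z e) {z : V | z ∉ h₀ ∧ insert z e ∈ H})) ?_)
    ((card_insert_le _ _).trans (Nat.add_le_add_right card_image_le 1))
  intro h hh
  obtain ⟨hhH, heh⟩ := mem_filter.1 hh
  by_cases hhh : h = h₀
  · exact hhh ▸ mem_insert_self _ _
  obtain ⟨z, hz, rfl⟩ : ∃ z ∉ e, insert z e = h :=
    exists_eq_insert_iff.2 ⟨heh, by rw [hen, hH h hhH]⟩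
  refine mem_insert_of_mem (mem_image.2 ⟨z, ?_, rfl⟩)
  refine mem_filter.2 ⟨mem_univ _, fun hzh => hhh ?_, hhH⟩
  exact eq_of_subset_of_card_le (insert_subset hzh he) (by rw [hH _ hhH, hH _ hh₀])


theorem nice_substar (k r : ℕ) (hk : 0 < k) (hr : 0 < r) :
    ∃ q0 : ℕ, ∀ q ≥ q0, ∀ (V : Type*) [Fintype V] [DecidableEq V],
      ∀ (H : Finset (Finset V)) (c : V) (a b : Fin q → V) (w : Finset V → ℕ),
      -- `H` is a 3-graph:
      (∀ e ∈ H, e.card = 3) →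
      -- the `2q+1` vertices of the copy `S` of `S_q^3` are pairwise distinct:
      Function.Injective (fun x : Option (Fin q × Bool) =>
        match x with
        | none => c
        | some (i, false) => a i
        | some (i, true) => b i) →
      -- the hyperedges of `S`:
      (∀ i : Fin q, ({c, a i, b i} : Finset V) ∈ H) →
      -- each pair `e` inside the hyperedges of `S` has weight `w e ≤ k` and lies in
      -- at least `w e + 1` hyperedges of `H`:
      (∀ i : Fin q, ∀ e ∈ ({({c, a i} : Finset V), {c, b i}, {a i, b i}} : Finset (Finset V)),
        w e ≤ k ∧ w e + 1 ≤ (H.filter fun h => e ⊆ h).card) →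
      -- then some `r` of the `q` hyperedges form a nice copy of `S_r^3`:
      ∃ T : Finset (Fin q), T.card = r ∧
        ∀ i ∈ T, ∀ e ∈ ({({c, a i} : Finset V), {c, b i}, {a i, b i}} : Finset (Finset V)),
          w e ≤ (Finset.univ.filter fun z : V =>
            z ∉ insert c (T.image a ∪ T.image b) ∧ insert z e ∈ H).card := by
  refine ⟨(2 * (6 * k) + 1) * r, ?_⟩
  intro q hq V _ _ H c a b w hH hinj hS hw
  have ha : Function.Injective a := fun i j h => by
    simpa using @hinj (some (i, false)) (some (j, false)) h
  have hb : Function.Injective b := fun i j h => by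
    simpa using @hinj (some (i, true)) (some (j, true)) h
  have hca (i) : c ≠ a i := fun h => by simpa using @hinj none (some (i, false)) h
  have hcb (i) : c ≠ b i := fun h => by simpa using @hinj none (some (i, true)) h
  have hab (i) : a i ≠ b i := fun h => by
    simpa using @hinj (some (i, false)) (some (i, true)) h
  let P (i : Fin q) : Finset (Finset V) := {{c, a i}, {c, b i}, {a i, b i}}
  have hlink : ∀ i, ∀ e ∈ P i, ∃ Z ⊆ Finset.univ.filter
      (fun z : V => z ∉ ({c, a i, b i} : Finset V) ∧ insert z e ∈ H), Z.card = w e := by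
    intro i e he
    refine Finset.exists_subset_card_eq ?_
    have hsub : e ⊆ {c, a i, b i} ∧ e.card = 2 := by
      simp only [P, Finset.mem_insert, Finset.mem_singleton] at he
      rcases he with rfl | rfl | rfl
      · exact ⟨by grind, Finset.card_pair (hca i)⟩
      · exact ⟨by grind, Finset.card_pair (hcb i)⟩
      · exact ⟨by grind, Finset.card_pair (hab i)⟩
    have h₁ := card_filter_superset_le hH (hS i) hsub.1 hsub.2
    have h₂ := (hw i e he).2
    omega
  choose! Z hZ hZcard using hlink
  let W (i : Fin q) : Finset V := (P i).biUnion (Z i)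
  have hW (i) : (W i).card ≤ 3 * k :=
    (Finset.card_biUnion_le_card_mul _ _ k fun e he =>
      (hZcard i e he).trans_le (hw i e he).1).trans
      (Nat.mul_le_mul_right k Finset.card_le_three)
  have hpre (g : Fin q → V) (hg : g.Injective) (i) :
      (Finset.univ.filter fun j => g j ∈ W i).card ≤ 3 * k :=
    (Finset.card_le_card_of_injOn g (fun j hj => by simpa using hj) hg.injOn).trans (hW i)
  obtain ⟨T, -, hTr, hT⟩ := exists_card_eq_pairwise_notMem
    (fun i => (Finset.univ.filter fun j => a j ∈ W i) ∪ Finset.univ.filter fun j => b j ∈ W i)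
    (6 * k)
    (fun i => (Finset.card_union_le _ _).trans (by
      have h₁ := hpre a ha i
      have h₂ := hpre b hb i
      omega))
    r Finset.univ (by simpa using hq)
  refine ⟨T, hTr, fun i hi e he => ?_⟩
  rw [← hZcard i e he]
  refine Finset.card_le_card fun z hz => ?_
  have hzW : z ∈ W i := Finset.mem_biUnion.2 ⟨e, he, hz⟩
  obtain ⟨hzS, hzH⟩ := (Finset.mem_filter.1 (hZ i e he hz)).2
  simp only [Finset.mem_insert, Finset.mem_singleton, not_or] at hzS
  refine Finset.mem_filter.2 ⟨Finset.mem_univ _, fun hmem => ?_, hzH⟩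
  simp only [Finset.mem_insert, Finset.mem_union, Finset.mem_image] at hmem
  rcases hmem with rfl | ⟨j, hj, rfl⟩ | ⟨j, hj, rfl⟩
  · exact hzS.1 rfl
  · exact hT i hi j hj (by rintro rfl; exact hzS.2.1 rfl) (by simp [hzW])
  · exact hT i hi j hj (by rintro rfl; exact hzS.2.2 rfl) (by simp [hzW])
end

section
/- Let G be a bipartite graph with parts A and B that has no matching of size k. If |A| ≥ k and each vertex of A has degree at least k−1, then there is a set B' ⊆ B with |B'| = k−1 such that the neighborhood of every vertex of A is exactly B'. -/
/-- A bipartite graph `G` satisfying Hall's condition on the subsets of `S` has a matching of size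
`S.card`. -/
theorem exists_matching_of_hall {α β : Type*} [DecidableEq α] [DecidableEq β]
    (G : Finset (α × β)) (S : Finset α)
    (h : ∀ T ⊆ S, T.card ≤ (T.biUnion fun a => (G.filter fun p => p.1 = a).image Prod.snd).card) :
    ∃ M ⊆ G, M.card = S.card ∧
      Set.InjOn (Prod.fst : α × β → α) ↑M ∧ Set.InjOn (Prod.snd : α × β → β) ↑M := by
  obtain ⟨f, hf, hfN⟩ := (Finset.all_card_le_biUnion_card_iff_exists_injective
    fun a : S => (G.filter fun p => p.1 = a.1).image Prod.snd).mp fun T => by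
      have hT := h (T.map (Function.Embedding.subtype _)) fun a ha => by
        obtain ⟨b, -, rfl⟩ := Finset.mem_map.mp ha
        exact b.2
      rwa [Finset.card_map, Finset.map_eq_image, Finset.image_biUnion] at hT
  refine ⟨Finset.univ.image fun a : S => (a.1, f a), ?_, ?_, ?_, ?_⟩
  · intro p hp
    obtain ⟨a, -, rfl⟩ := Finset.mem_image.mp hp
    obtain ⟨⟨x, y⟩, hq, hqf⟩ := Finset.mem_image.mp (hfN a)
    obtain ⟨hqG, rfl⟩ := Finset.mem_filter.mp hq
    simpa [← hqf] using hqG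
  · rw [Finset.card_image_of_injective _ fun a b hab => Subtype.ext (Prod.ext_iff.mp hab).1]
    simp
  · intro p hp q hq hpq
    obtain ⟨a, -, rfl⟩ := Finset.mem_image.mp hp
    obtain ⟨b, -, rfl⟩ := Finset.mem_image.mp hq
    rw [Subtype.ext hpq]
  · intro p hp q hq hpq
    obtain ⟨a, -, rfl⟩ := Finset.mem_image.mp hp
    obtain ⟨b, -, rfl⟩ := Finset.mem_image.mp hq
    rw [hf hpq]

theorem bipartite_no_matching_common_neighborhood
    {α β : Type*} [DecidableEq α] [DecidableEq β]
    (A : Finset α) (B : Finset β) (G : Finset (α × β)) (k : ℕ)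
    -- `G` is a bipartite graph with parts `A` and `B` (edges are pairs in `A × B`):
    (hG : ∀ p ∈ G, p.1 ∈ A ∧ p.2 ∈ B)
    -- `G` has no matching of size `k`:
    (hnomatch : ¬ ∃ M ⊆ G, M.card = k ∧
      Set.InjOn (Prod.fst : α × β → α) ↑M ∧ Set.InjOn (Prod.snd : α × β → β) ↑M)
    (hA : k ≤ A.card)
    -- each vertex of `A` has degree at least `k - 1`:
    (hdeg : ∀ a ∈ A, k - 1 ≤ ((G.filter fun p => p.1 = a).image Prod.snd).card) :
    ∃ B' ⊆ B, B'.card = k - 1 ∧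
      ∀ a ∈ A, (G.filter fun p => p.1 = a).image Prod.snd = B' := by
  set N : α → Finset β := fun a => (G.filter fun p => p.1 = a).image Prod.snd
  have hNS : ∀ S ⊆ A, S.card = k → ∀ a ∈ S, (N a).card = k - 1 ∧ N a = S.biUnion N := by
    intro S hSA hS a ha
    obtain ⟨T, hTS, hT⟩ : ∃ T ⊆ S, (T.biUnion N).card < T.card := by
      by_contra! h
      exact hnomatch (hS ▸ exists_matching_of_hall G S h)
    obtain ⟨t, ht⟩ : T.Nonempty := Finset.card_pos.mp (by omega)
    have h₁ : k - 1 ≤ (N t).card := hdeg t (hSA (hTS ht))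
    have h₂ := Finset.card_le_card (Finset.subset_biUnion_of_mem N ht)
    obtain rfl : T = S := Finset.eq_of_subset_of_card_le hTS (by omega)
    have h₃ : k - 1 ≤ (N a).card := hdeg a (hSA ha)
    have h₄ := Finset.subset_biUnion_of_mem N ha
    have h₅ := Finset.card_le_card h₄
    exact ⟨by omega, Finset.eq_of_subset_of_card_le h₄ (by omega)⟩
  have hk : 0 < k := by
    by_contra! h
    exact hnomatch ⟨∅, by simp, by simp; omega, by simp, by simp⟩
  obtain ⟨a₀, ha₀⟩ : A.Nonempty := Finset.card_pos.mp (by omega)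
  have hsup : ∀ T ⊆ A, T.card ≤ k → ∃ S, T ⊆ S ∧ S ⊆ A ∧ S.card = k := fun T hT hTk =>
    Finset.exists_subsuperset_card_eq hT hTk hA
  have hcard : ∀ a ∈ A, (N a).card = k - 1 := by
    intro a ha
    obtain ⟨S, hTS, hSA, hS⟩ := hsup {a} (by simpa) (by simpa)
    exact (hNS S hSA hS a (by simpa using hTS)).1
  refine ⟨N a₀, ?_, hcard a₀ ha₀, fun a ha => ?_⟩
  · intro b hb
    obtain ⟨p, hp, rfl⟩ := Finset.mem_image.mp hb
    exact (hG p (Finset.mem_filter.mp hp).1).2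
  · change N a = N a₀
    obtain rfl | hk1 : k = 1 ∨ 2 ≤ k := by omega
    · rw [Finset.card_eq_zero.mp (hcard a ha), Finset.card_eq_zero.mp (hcard a₀ ha₀)]
    · obtain ⟨S, hTS, hSA, hS⟩ := hsup {a, a₀} (by simp [Finset.insert_subset_iff, ha, ha₀])
        (Finset.card_le_two.trans hk1)
      rw [(hNS S hSA hS a (hTS (by simp))).2, (hNS S hSA hS a₀ (hTS (by simp))).2]
end

section
/- Let t be a positive integer and H any 3-uniform hypergraph. Let E_1 be the set of vertex pairs contained in at least one and at most t hyperedges of H, E_2 the set of pairs contained in at least t+1 and at most 2t hyperedges, and E_3 the set of pairs contained in at least 2t+1 and at most 3t hyperedges. For i = 1, 2, 3 let H_i be the set of hyperedges of H containing at least i pairs from E_i, and let H_4 be the set of hyperedges containing one pair from E_2 and two pairs from E_3. Then |H_1| + |H_2| + |H_3| + |H_4| ≤ t(|E_1| + |E_2| + |E_3|). -/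
/-- The number of hyperedges of `H` containing the pair `p`. -/
def pairDegP {V : Type*} [DecidableEq V] (H : Finset (Finset V)) (p : Finset V) : ℕ :=
  (H.filter fun h => p ⊆ h).card

/-- Double counting of the incidences between a family `E` of pairs and the members of `H`. -/
theorem sum_pairDegP_eq {V : Type*} [DecidableEq V] (H E : Finset (Finset V))
    (hE : ∀ p ∈ E, p.card = 2) :
    ∑ p ∈ E, pairDegP H p = ∑ h ∈ H, ((h.powersetCard 2).filter (· ∈ E)).card := by
  have key := Finset.sum_card_bipartiteAbove_eq_sum_card_bipartiteBelow
    (s := E) (t := H) (fun p h => p ⊆ h)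
  unfold pairDegP
  refine key.trans (Finset.sum_congr rfl fun h _ => congrArg Finset.card ?_)
  ext p
  simp only [Finset.mem_bipartiteBelow, Finset.mem_filter, Finset.mem_powersetCard]
  exact ⟨fun ⟨hp, hs⟩ => ⟨⟨hs, hE p hp⟩, hp⟩, fun ⟨⟨hs, _⟩, hp⟩ => ⟨hp, hs⟩⟩

theorem sum_card_filter_mem_le {V : Type*} [DecidableEq V] (H E : Finset (Finset V)) (m : ℕ)
    (hE : ∀ p ∈ E, p.card = 2 ∧ pairDegP H p ≤ m) :
    ∑ h ∈ H, ((h.powersetCard 2).filter (· ∈ E)).card ≤ E.card * m := by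
  rw [← sum_pairDegP_eq H E fun p hp => (hE p hp).1]
  exact Finset.sum_le_card_nsmul E _ m fun p hp => (hE p hp).2

theorem card_filter_mem_add_le {α : Type*} [DecidableEq α] (s A B C : Finset α)
    (hAB : Disjoint A B) (hAC : Disjoint A C) (hBC : Disjoint B C) :
    (s.filter (· ∈ A)).card + (s.filter (· ∈ B)).card + (s.filter (· ∈ C)).card ≤ s.card := by
  simp only [Finset.filter_mem_eq_inter]
  rw [← Finset.card_union_of_disjoint
      (hAB.mono Finset.inter_subset_right Finset.inter_subset_right),
    ← Finset.card_union_of_disjoint (Finset.disjoint_union_left.2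
      ⟨hAC.mono Finset.inter_subset_right Finset.inter_subset_right,
        hBC.mono Finset.inter_subset_right Finset.inter_subset_right⟩)]
  exact Finset.card_le_card (Finset.union_subset (Finset.union_subset
    Finset.inter_subset_left Finset.inter_subset_left) Finset.inter_subset_left)

theorem light_pair_counting {V : Type*} [Fintype V] [DecidableEq V]
    (t : ℕ) (ht : 1 ≤ t) (H : Finset (Finset V)) (hH : ∀ e ∈ H, e.card = 3)
    (E1 E2 E3 : Finset (Finset V))
    (hE1 : E1 = (Finset.univ.powersetCard 2).filter fun p =>
      1 ≤ pairDegP H p ∧ pairDegP H p ≤ t)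
    (hE2 : E2 = (Finset.univ.powersetCard 2).filter fun p =>
      t + 1 ≤ pairDegP H p ∧ pairDegP H p ≤ 2 * t)
    (hE3 : E3 = (Finset.univ.powersetCard 2).filter fun p =>
      2 * t + 1 ≤ pairDegP H p ∧ pairDegP H p ≤ 3 * t)
    (H1 H2 H3 H4 : Finset (Finset V))
    (hH1 : H1 = H.filter fun h => 1 ≤ ((h.powersetCard 2).filter (· ∈ E1)).card)
    (hH2 : H2 = H.filter fun h => 2 ≤ ((h.powersetCard 2).filter (· ∈ E2)).card)
    (hH3 : H3 = H.filter fun h => 3 ≤ ((h.powersetCard 2).filter (· ∈ E3)).card)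
    (hH4 : H4 = H.filter fun h => 1 ≤ ((h.powersetCard 2).filter (· ∈ E2)).card ∧
      2 ≤ ((h.powersetCard 2).filter (· ∈ E3)).card) :
    H1.card + H2.card + H3.card + H4.card ≤ t * (E1.card + E2.card + E3.card) := by
  have b1 := sum_card_filter_mem_le H E1 t fun p hp => by
    simp only [hE1, Finset.mem_filter, Finset.mem_powersetCard] at hp
    exact ⟨hp.1.2, hp.2.2⟩
  have b2 := sum_card_filter_mem_le H E2 (2 * t) fun p hp => by
    simp only [hE2, Finset.mem_filter, Finset.mem_powersetCard] at hp
    exact ⟨hp.1.2, hp.2.2⟩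
  have b3 := sum_card_filter_mem_le H E3 (3 * t) fun p hp => by
    simp only [hE3, Finset.mem_filter, Finset.mem_powersetCard] at hp
    exact ⟨hp.1.2, hp.2.2⟩
  have d12 : Disjoint E1 E2 := by
    rw [hE1, hE2]
    exact Finset.disjoint_filter.2 fun p _ h h' => by omega
  have d13 : Disjoint E1 E3 := by
    rw [hE1, hE3]
    exact Finset.disjoint_filter.2 fun p _ h h' => by omega
  have d23 : Disjoint E2 E3 := by
    rw [hE2, hE3]
    exact Finset.disjoint_filter.2 fun p _ h h' => by omega
  have weight : 6 * (H1.card + H2.card + H3.card + H4.card) ≤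
      6 * ∑ h ∈ H, ((h.powersetCard 2).filter (· ∈ E1)).card +
      3 * ∑ h ∈ H, ((h.powersetCard 2).filter (· ∈ E2)).card +
      2 * ∑ h ∈ H, ((h.powersetCard 2).filter (· ∈ E3)).card := by
    rw [hH1, hH2, hH3, hH4]
    simp only [Finset.card_filter _ H, ← Finset.sum_add_distrib, Finset.mul_sum]
    refine Finset.sum_le_sum fun h hh => ?_
    have three := card_filter_mem_add_le (h.powersetCard 2) E1 E2 E3 d12 d13 d23
    rw [Finset.card_powersetCard, hH h hh, show Nat.choose 3 2 = 3 from rfl] at three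
    split_ifs <;> omega
  nlinarith
end

section
/- For every integer t > 1 there exists a constant C such that for every n the following holds: if H is an n-vertex F_t^3-free 3-graph, then the number of hyperedges {x,y,z} of H such that, letting a ≤ b ≤ c be the numbers of hyperedges of H containing the pairs {x,y}, {x,z}, {y,z} in nondecreasing order, one has a ≥ t+1, b ≥ 2t+1 and c ≥ 3t+1, is at most Cn. -/
/-- `H` contains a copy of `F_t^3`, the 3-expansion of the `t`-fan. -/
def ContainsFanExp {V : Type*} [DecidableEq V] (t : ℕ) (H : Finset (Finset V)) : Prop :=
  ∃ f : Unit ⊕ Fin 5 × Fin t → V, Function.Injective f ∧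
    ∀ i : Fin t,
      ({f (Sum.inl ()), f (Sum.inr (0, i)), f (Sum.inr (2, i))} : Finset V) ∈ H ∧
      ({f (Sum.inl ()), f (Sum.inr (1, i)), f (Sum.inr (3, i))} : Finset V) ∈ H ∧
      ({f (Sum.inr (0, i)), f (Sum.inr (1, i)), f (Sum.inr (4, i))} : Finset V) ∈ H

/-- If every out-degree of `R` on `F` is at most `D` and `F` has at least `k * (2 * D + 1)` elements,
then `F` contains an `R`-independent set of size `k`. -/
theorem exists_independent_of_outdegree_le {α : Type*} [DecidableEq α] (R : α → α → Prop)
    [∀ a b, Decidable (R a b)] (D k : ℕ) (F : Finset α)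
    (hD : ∀ a ∈ F, (F.filter fun b => R a b).card ≤ D) (hF : k * (2 * D + 1) ≤ F.card) :
    ∃ S ⊆ F, S.card = k ∧ ∀ a ∈ S, ∀ b ∈ S, a ≠ b → ¬ R a b := by
  induction k generalizing F with
  | zero => exact ⟨∅, by simp, by simp, by simp⟩
  | succ k ih =>
    have hne : F.Nonempty := by
      rw [← Finset.card_pos]
      nlinarith
    obtain ⟨b, hb, hbD⟩ : ∃ b ∈ F, (F.filter fun a => R a b).card ≤ D := by
      by_contra! hcon
      have hcount : ∑ a ∈ F, (F.filter fun b => R a b).card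
          = ∑ b ∈ F, (F.filter fun a => R a b).card :=
        Finset.sum_card_bipartiteAbove_eq_sum_card_bipartiteBelow (s := F) (t := F) R
      have hle := Finset.sum_le_sum hD
      have hlt := Finset.sum_lt_sum_of_nonempty hne hcon
      omega
    set N := insert b ((F.filter fun a => R a b) ∪ F.filter fun c => R b c) with hN
    have hNcard : N.card ≤ 2 * D + 1 := by
      have h1 := Finset.card_insert_le b ((F.filter fun a => R a b) ∪ F.filter fun c => R b c)
      have h2 := Finset.card_union_le (F.filter fun a => R a b) (F.filter fun c => R b c)
      have h3 := hD b hb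
      rw [hN]
      omega
    have hsub : F \ N ⊆ F := Finset.sdiff_subset
    obtain ⟨S, hS, hcard, hind⟩ := ih (F \ N)
      (fun a ha => (Finset.card_le_card (Finset.filter_subset_filter _ hsub)).trans
        (hD a (hsub ha)))
      (by
        have h1 := Finset.le_card_sdiff N F
        have h2 : (k + 1) * (2 * D + 1) = k * (2 * D + 1) + (2 * D + 1) := by ring
        omega)
    have hbS : ∀ a ∈ S, a ≠ b ∧ ¬ R a b ∧ ¬ R b a := by
      intro a ha
      have := hS ha
      simp only [hN, Finset.mem_sdiff, Finset.mem_insert, Finset.mem_union,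
        Finset.mem_filter] at this
      tauto
    refine ⟨insert b S, ?_, ?_, ?_⟩
    · exact Finset.insert_subset hb (hS.trans hsub)
    · rw [Finset.card_insert_of_notMem (fun h => (hbS b h).1 rfl), hcard]
    · intro a ha c hc hac
      rw [Finset.mem_insert] at ha hc
      rcases ha with rfl | ha <;> rcases hc with rfl | hc
      · exact absurd rfl hac
      · exact (hbS c hc).2.2
      · exact (hbS a ha).2.1
      · exact hind a ha c hc hac

/-- A family of nonempty sets of size at most `r` contains `k` pairwise disjoint members or has a
transversal of size at most `r * k`. -/
theorem exists_disjoint_subfamily_or_transversal {ι V : Type*} [DecidableEq ι] [DecidableEq V]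
    (G : Finset ι) (g : ι → Finset V) (r : ℕ) (hne : ∀ e ∈ G, (g e).Nonempty)
    (hr : ∀ e ∈ G, (g e).card ≤ r) (k : ℕ) :
    (∃ F ⊆ G, F.card = k ∧ ∀ e ∈ F, ∀ e' ∈ F, e ≠ e' → Disjoint (g e) (g e')) ∨
      ∃ S : Finset V, S.card ≤ r * k ∧ ∀ e ∈ G, ∃ w ∈ S, w ∈ g e := by
  induction k with
  | zero => exact Or.inl ⟨∅, by simp, by simp, by simp⟩
  | succ k ih =>
    rcases ih with ⟨F, hFG, hcard, hdis⟩ | ⟨S, hS, hcov⟩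
    · by_cases hall : ∀ e ∈ G, ∃ w ∈ F.biUnion g, w ∈ g e
      · refine Or.inr ⟨F.biUnion g, ?_, hall⟩
        have := Finset.card_biUnion_le_card_mul F g r fun e he => hr e (hFG he)
        rw [hcard] at this
        nlinarith
      · push Not at hall
        obtain ⟨e, he, hmiss⟩ := hall
        have hdise : ∀ e' ∈ F, Disjoint (g e') (g e) := fun e' he' =>
          Finset.disjoint_left.2 fun w hw => hmiss w (Finset.mem_biUnion.2 ⟨e', he', hw⟩)
        have heF : e ∉ F := fun h => by
          obtain ⟨w, hw⟩ := hne e he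
          exact hmiss w (Finset.mem_biUnion.2 ⟨e, h, hw⟩) hw
        refine Or.inl ⟨insert e F, Finset.insert_subset he hFG, ?_, ?_⟩
        · rw [Finset.card_insert_of_notMem heF, hcard]
        · intro a ha c hc hac
          rw [Finset.mem_insert] at ha hc
          rcases ha with rfl | ha <;> rcases hc with rfl | hc
          · exact absurd rfl hac
          · exact (hdise c hc).symm
          · exact hdise a ha
          · exact hdis a ha c hc hac
    · exact Or.inr ⟨S, hS.trans (Nat.mul_le_mul_left r k.le_succ), hcov⟩

/-- A 3-graph in which every vertex link has a transversal of size at most `K` has at most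
`K * K * n` hyperedges. -/
theorem card_le_of_link_transversals {V : Type*} [Fintype V] [DecidableEq V]
    (G : Finset (Finset V)) (h3 : ∀ e ∈ G, e.card = 3) (S : V → Finset V) (K : ℕ)
    (hK : ∀ v, (S v).card ≤ K) (hS : ∀ v, ∀ e ∈ G, v ∈ e → ∃ w ∈ S v, w ∈ e.erase v) :
    G.card ≤ K * K * Fintype.card V := by
  have hsub : G ⊆ Finset.univ.biUnion fun z => (S z).biUnion fun x =>
      (S x).image fun y => ({z, x, y} : Finset V) := by
    intro e he
    simp only [Finset.mem_biUnion, Finset.mem_univ, true_and, Finset.mem_image]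
    have key : ∀ z x y, e = {z, x, y} → x ∈ S z → y ∈ S x →
        ∃ z, ∃ x ∈ S z, ∃ y ∈ S x, ({z, x, y} : Finset V) = e :=
      fun z x y h hx hy => ⟨z, x, hx, y, hy, h.symm⟩
    obtain ⟨a, b, c, hab, hac, hbc, rfl⟩ := Finset.card_eq_three.1 (h3 e he)
    obtain ⟨a', ha', ha⟩ := hS a _ he (by simp)
    obtain ⟨b', hb', hb⟩ := hS b _ he (by simp)
    obtain ⟨c', hc', hc⟩ := hS c _ he (by simp)
    simp only [Finset.mem_erase, Finset.mem_insert, Finset.mem_singleton] at ha hb hc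
    have p1 : ({a, b, c} : Finset V) = {a, c, b} := by rw [Finset.pair_comm b c]
    have p2 : ({a, b, c} : Finset V) = {b, a, c} := by rw [Finset.insert_comm]
    have p3 : ({a, b, c} : Finset V) = {b, c, a} := by
      rw [Finset.insert_comm a b, Finset.pair_comm a c]
    have p4 : ({a, b, c} : Finset V) = {c, a, b} := by
      rw [Finset.pair_comm b c, Finset.insert_comm a c]
    have p5 : ({a, b, c} : Finset V) = {c, b, a} := by
      rw [Finset.insert_comm a b, Finset.pair_comm a c, Finset.insert_comm b c]
    have k0 := key a b c rfl
    have k1 := key a c b p1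
    have k2 := key b a c p2
    have k3 := key b c a p3
    have k4 := key c a b p4
    have k5 := key c b a p5
    have sa : b ∈ S a ∨ c ∈ S a := by
      rcases ha with ⟨hne, rfl | rfl | rfl⟩
      exacts [absurd rfl hne, Or.inl ha', Or.inr ha']
    have sb : a ∈ S b ∨ c ∈ S b := by
      rcases hb with ⟨hne, rfl | rfl | rfl⟩
      exacts [Or.inl hb', absurd rfl hne, Or.inr hb']
    have sc : a ∈ S c ∨ b ∈ S c := by
      rcases hc with ⟨hne, rfl | rfl | rfl⟩
      exacts [Or.inl hc', Or.inr hc', absurd rfl hne]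
    rcases sa with sa | sa <;> rcases sb with sb | sb <;> rcases sc with sc | sc <;>
      first
      | exact k0 sa sb
      | exact k1 sa sc
      | exact k2 sb sa
      | exact k3 sb sc
      | exact k4 sc sa
      | exact k5 sc sb
  refine (Finset.card_le_card hsub).trans ?_
  refine (Finset.card_biUnion_le_card_mul _ _ (K * K) fun z _ => ?_).trans
    (by rw [Finset.card_univ, mul_comm])
  refine (Finset.card_biUnion_le_card_mul _ _ K fun x _ => ?_).trans
    (Nat.mul_le_mul_right K (hK z))
  exact Finset.card_image_le.trans (hK x)

/-- Sets indexed by `Fin 3 × Fin t` whose sizes within each block are, in some order, `t`, `2 * t`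
and `3 * t` have a system of distinct representatives. -/
theorem exists_distinct_representatives {V : Type*} [DecidableEq V] (t : ℕ)
    (L : Fin 3 × Fin t → Finset V) (σ : Fin t → Equiv.Perm (Fin 3))
    (hL : ∀ j i, (L (j, i)).card = ((σ i j : ℕ) + 1) * t) :
    ∃ g : Fin 3 × Fin t → V, Function.Injective g ∧ ∀ p, g p ∈ L p := by
  rw [← Finset.all_card_le_biUnion_card_iff_exists_injective]
  intro s
  rcases s.eq_empty_or_nonempty with rfl | hs
  · simp
  obtain ⟨⟨j₀, i₀⟩, hp, hmax⟩ :=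
    Finset.exists_max_image s (fun p => (σ p.2 p.1 : Fin 3)) hs
  refine le_trans ?_ (Finset.card_le_card (Finset.subset_biUnion_of_mem L hp))
  rw [hL]
  have hcard : (Finset.Iic (σ i₀ j₀) ×ˢ (Finset.univ : Finset (Fin t))).card
      = ((σ i₀ j₀ : ℕ) + 1) * t := by
    simp [Finset.card_product]
  rw [← hcard]
  refine Finset.card_le_card_of_injOn (fun p => (σ p.2 p.1, p.2)) ?_ ?_
  · intro p hps
    simpa using hmax p hps
  · rintro ⟨j, i⟩ - ⟨j', i'⟩ - h
    simp only [Prod.mk.injEq] at h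
    obtain ⟨h1, rfl⟩ := h
    simpa using h1

/-- A pair of codegree more than `k` has `k` extensions outside any given third vertex. -/
theorem exists_extensions_of_lt_pairDeg {V : Type*} [Fintype V] [DecidableEq V]
    (H : Finset (Finset V)) (h3 : ∀ e ∈ H, e.card = 3) (u v z : V) (huv : u ≠ v) (k : ℕ)
    (hk : k + 1 ≤ pairDeg H u v) :
    ∃ L : Finset V, L.card = k ∧ ∀ w ∈ L, {u, v, w} ∈ H ∧ w ∉ ({u, v, z} : Finset V) := by
  set N : Finset V := Finset.univ.filter fun w => w ≠ u ∧ w ≠ v ∧ {u, v, w} ∈ H with hN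
  have hle : pairDeg H u v ≤ N.card := by
    refine le_trans (Finset.card_le_card ?_)
      (Finset.card_image_le (s := N) (f := fun w => ({u, v, w} : Finset V)))
    intro e he
    obtain ⟨heH, hu, hv⟩ := Finset.mem_filter.1 he
    have hpair : ({u, v} : Finset V) ⊆ e := by
      simp [Finset.insert_subset_iff, hu, hv]
    have hone : (e \ {u, v}).card = 1 := by
      rw [Finset.card_sdiff_of_subset hpair, h3 e heH, Finset.card_pair huv]
    obtain ⟨w, hw⟩ := Finset.card_eq_one.1 hone
    have hwmem : w ∈ e \ {u, v} := by simp [hw]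
    have heq : ({u, v, w} : Finset V) = e := by
      ext y
      have : y ∈ e \ {u, v} ↔ y = w := by simp [hw]
      simp only [Finset.mem_sdiff, Finset.mem_insert, Finset.mem_singleton] at this ⊢
      grind
    refine Finset.mem_image.2 ⟨w, ?_, heq⟩
    simp only [Finset.mem_sdiff, Finset.mem_insert, Finset.mem_singleton, not_or] at hwmem
    simp [hN, hwmem, heq, heH]
  have hcard : k ≤ (N.erase z).card := by
    have := Finset.pred_card_le_card_erase (s := N) (a := z)
    omega
  obtain ⟨L, hLN, hL⟩ := Finset.exists_subset_card_eq hcard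
  refine ⟨L, hL, fun w hw => ?_⟩
  have := hLN hw
  simp only [hN, Finset.mem_erase, Finset.mem_filter, Finset.mem_univ, true_and] at this
  simp only [Finset.mem_insert, Finset.mem_singleton]
  tauto

/-- The hyperedge `e = {v, a, b}` comes with extension sets for the pairs `va`, `vb` and `ab`,
avoiding `e`, whose sizes are `t`, `2 * t` and `3 * t` in the order prescribed by `σ`. -/
structure HasExtensions {V : Type*} [DecidableEq V] (t : ℕ) (H : Finset (Finset V)) (v : V)
    (e : Finset V) (a b : V) (L : Fin 3 → Finset V) (σ : Equiv.Perm (Fin 3)) : Prop where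
  eq : e = {v, a, b}
  ne_left : v ≠ a
  ne_right : v ≠ b
  ne_outer : a ≠ b
  card_eq : ∀ j, (L j).card = ((σ j : ℕ) + 1) * t
  notMem : ∀ j, ∀ w ∈ L j, w ∉ e
  left_mem : ∀ w ∈ L 0, {v, a, w} ∈ H
  right_mem : ∀ w ∈ L 1, {v, b, w} ∈ H
  outer_mem : ∀ w ∈ L 2, {a, b, w} ∈ H

namespace HasExtensions

variable {V : Type*} [DecidableEq V] {t : ℕ} {H : Finset (Finset V)} {v : V} {e : Finset V}
  {a b : V} {L : Fin 3 → Finset V} {σ : Equiv.Perm (Fin 3)}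

theorem center_mem (h : HasExtensions t H v e a b L σ) : v ∈ e := by
  rw [h.eq]
  simp

theorem left_vertex_mem (h : HasExtensions t H v e a b L σ) : a ∈ e := by
  rw [h.eq]
  simp

theorem right_vertex_mem (h : HasExtensions t H v e a b L σ) : b ∈ e := by
  rw [h.eq]
  simp

end HasExtensions

/-- Every vertex of a heavy hyperedge serves as a center with extension sets. -/
theorem exists_hasExtensions {V : Type*} [Fintype V] [DecidableEq V] (t : ℕ)
    (H : Finset (Finset V)) (h3 : ∀ e ∈ H, e.card = 3) (x y z : V) (hxy : x ≠ y) (hxz : x ≠ z)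
    (hyz : y ≠ z) (dxy : t + 1 ≤ pairDeg H x y) (dxz : 2 * t + 1 ≤ pairDeg H x z)
    (dyz : 3 * t + 1 ≤ pairDeg H y z) (v : V) (hv : v ∈ ({x, y, z} : Finset V)) :
    ∃ a b L σ, HasExtensions t H v {x, y, z} a b L σ := by
  obtain ⟨A, hA, hA'⟩ := exists_extensions_of_lt_pairDeg H h3 x y z hxy _ dxy
  obtain ⟨B, hB, hB'⟩ := exists_extensions_of_lt_pairDeg H h3 x z y hxz _ dxz
  obtain ⟨C, hC, hC'⟩ := exists_extensions_of_lt_pairDeg H h3 y z x hyz _ dyz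
  have pB : ({x, z, y} : Finset V) = {x, y, z} := by
    ext; simp only [Finset.mem_insert, Finset.mem_singleton]; tauto
  have pC : ({y, z, x} : Finset V) = {x, y, z} := by
    ext; simp only [Finset.mem_insert, Finset.mem_singleton]; tauto
  have pD : ({y, x, z} : Finset V) = {x, y, z} := by
    ext; simp only [Finset.mem_insert, Finset.mem_singleton]; tauto
  have pE : ({z, x, y} : Finset V) = {x, y, z} := by
    ext; simp only [Finset.mem_insert, Finset.mem_singleton]; tauto
  rw [pB] at hB'
  rw [pC] at hC'
  simp only [Finset.mem_insert, Finset.mem_singleton] at hv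
  rcases hv with rfl | rfl | rfl
  · refine ⟨y, z, ![A, B, C], 1, rfl, hxy, hxz, hyz, ?_, ?_, ?_, ?_, ?_⟩
    · intro j; fin_cases j <;> simp [hA, hB, hC]
    · intro j w hw; fin_cases j
      exacts [(hA' w hw).2, (hB' w hw).2, (hC' w hw).2]
    · exact fun w hw => (hA' w hw).1
    · exact fun w hw => (hB' w hw).1
    · exact fun w hw => (hC' w hw).1
  · refine ⟨x, z, ![A, C, B], Equiv.swap 1 2, pD.symm, hxy.symm, hyz, hxz, ?_, ?_, ?_, ?_, ?_⟩
    · intro j; fin_cases j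
      · exact hA.trans (one_mul t).symm
      · exact hC
      · exact hB
    · intro j w hw; fin_cases j
      exacts [(hA' w hw).2, (hC' w hw).2, (hB' w hw).2]
    · intro w hw
      rw [Finset.insert_comm]
      exact (hA' w hw).1
    · exact fun w hw => (hC' w hw).1
    · exact fun w hw => (hB' w hw).1
  · refine ⟨x, y, ![B, C, A], finRotate 3, pE.symm, hxz.symm, hyz.symm, hxy, ?_, ?_, ?_, ?_, ?_⟩
    · intro j; fin_cases j
      · exact hB
      · exact hC
      · exact hA.trans (one_mul t).symm
    · intro j w hw; fin_cases j
      exacts [(hB' w hw).2, (hC' w hw).2, (hA' w hw).2]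
    · intro w hw
      rw [Finset.insert_comm]
      exact (hB' w hw).1
    · intro w hw
      rw [Finset.insert_comm]
      exact (hC' w hw).1
    · exact fun w hw => (hA' w hw).1

/-- Sufficiently many hyperedges with extensions, pairwise meeting only in `v`, yield a copy of
the expanded fan with center `v`. -/
theorem containsFanExp_of_sunflower {V : Type*} [DecidableEq V] (t : ℕ)
    (H : Finset (Finset V)) (v : V) (F : Finset (Finset V))
    (hext : ∀ e ∈ F, ∃ a b L σ, HasExtensions t H v e a b L σ)
    (hdis : ∀ e ∈ F, ∀ e' ∈ F, e ≠ e' → Disjoint (e.erase v) (e'.erase v))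
    (hcard : F.card = t * (2 * (6 * t) + 1)) : ContainsFanExp t H := by
  classical
  have : Nonempty V := ⟨v⟩
  choose! a b L σ hE using hext
  have hvL : ∀ e ∈ F, ∀ j, v ∉ L e j := fun e he j hv =>
    (hE e he).notMem j v hv (hE e he).center_mem
  let R : Finset V → Finset V → Prop := fun e e' => ∃ j, ∃ w ∈ L e j, w ∈ e'
  have hout : ∀ e ∈ F, (F.filter fun e' => R e e').card ≤ 6 * t := by
    intro e he
    have hU : (Finset.univ.biUnion (L e)).card ≤ 6 * t := by
      refine Finset.card_biUnion_le.trans ?_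
      rw [Finset.sum_congr rfl fun j _ => (hE e he).card_eq j,
        Equiv.sum_comp (σ e) (fun j : Fin 3 => ((j : ℕ) + 1) * t), Fin.sum_univ_three]
      simp
      omega
    refine le_trans ?_ hU
    have hw : ∀ e' ∈ F.filter fun e' => R e e',
        ∃ w, w ∈ Finset.univ.biUnion (L e) ∧ w ∈ e'.erase v := by
      intro e' he'
      obtain ⟨-, j, w, hwL, hwe⟩ := Finset.mem_filter.1 he'
      refine ⟨w, Finset.mem_biUnion.2 ⟨j, Finset.mem_univ j, hwL⟩, Finset.mem_erase.2 ⟨?_, hwe⟩⟩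
      rintro rfl
      exact hvL e he j hwL
    choose! f hf using hw
    refine Finset.card_le_card_of_injOn f (fun e' he' => (hf e' he').1) ?_
    intro e₁ h₁ e₂ h₂ h
    by_contra hne
    refine Finset.disjoint_left.1 (hdis e₁ (Finset.mem_filter.1 h₁).1 e₂
      (Finset.mem_filter.1 h₂).1 hne) (hf e₁ h₁).2 ?_
    rw [h]
    exact (hf e₂ h₂).2
  obtain ⟨S, hSF, hScard, hind⟩ :=
    exists_independent_of_outdegree_le R (6 * t) t F hout hcard.ge
  let ε := (Finset.equivFinOfCardEq hScard).symm
  let d : Fin t → Finset V := fun i => (ε i : Finset V)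
  have hdS : ∀ i, d i ∈ S := fun i => (ε i).2
  have hd : ∀ i i', d i = d i' → i = i' := fun i i' h => ε.injective (Subtype.ext h)
  have hX := fun i => hE (d i) (hSF (hdS i))
  obtain ⟨g, hginj, hgL⟩ := exists_distinct_representatives t (fun p => L (d p.2) p.1)
    (fun i => σ (d i)) (fun j i => (hX i).card_eq j)
  have hg : ∀ j i i', g (j, i) ∉ d i' := by
    intro j i i' hmem
    by_cases hii : d i = d i'
    · exact (hX i).notMem j _ (hgL (j, i)) (hii ▸ hmem)
    · exact hind _ (hdS i) _ (hdS i') hii ⟨j, _, hgL (j, i), hmem⟩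
  have hgv : ∀ j i, g (j, i) ≠ v := fun j i h =>
    hvL _ (hSF (hdS i)) j (h ▸ hgL (j, i))
  have ha : ∀ i, a (d i) ∈ (d i).erase v := fun i =>
    Finset.mem_erase.2 ⟨(hX i).ne_left.symm, (hX i).left_vertex_mem⟩
  have hb : ∀ i, b (d i) ∈ (d i).erase v := fun i =>
    Finset.mem_erase.2 ⟨(hX i).ne_right.symm, (hX i).right_vertex_mem⟩
  have hsame : ∀ i i' w, w ∈ (d i).erase v → w ∈ (d i').erase v → i = i' := by
    intro i i' w hw hw'
    by_contra hne
    exact Finset.disjoint_left.1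
      (hdis _ (hSF (hdS i)) _ (hSF (hdS i')) fun h => hne (hd i i' h)) hw hw'
  have hav : ∀ i, a (d i) ≠ v := fun i => (Finset.mem_erase.1 (ha i)).1
  have hbv : ∀ i, b (d i) ≠ v := fun i => (Finset.mem_erase.1 (hb i)).1
  have haa : ∀ i i', a (d i) = a (d i') → i = i' := fun i i' h =>
    hsame i i' _ (ha i) (h ▸ ha i')
  have hbb : ∀ i i', b (d i) = b (d i') → i = i' := fun i i' h =>
    hsame i i' _ (hb i) (h ▸ hb i')
  have hab : ∀ i i', a (d i) ≠ b (d i') := fun i i' h => by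
    obtain rfl := hsame i i' _ (ha i) (h ▸ hb i')
    exact (hX i).ne_outer h
  have hag : ∀ i j i', a (d i) ≠ g (j, i') := fun i j i' h =>
    hg j i' i (h ▸ (Finset.mem_erase.1 (ha i)).2)
  have hbg : ∀ i j i', b (d i) ≠ g (j, i') := fun i j i' h =>
    hg j i' i (h ▸ (Finset.mem_erase.1 (hb i)).2)
  have hgg : ∀ j i j' i', g (j, i) = g (j', i') → j = j' ∧ i = i' := fun j i j' i' h => by
    simpa using hginj h
  let φ : Fin 5 → Fin t → V := ![fun i => a (d i), fun i => b (d i), fun i => g (0, i),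
    fun i => g (1, i), fun i => g (2, i)]
  refine ⟨Sum.elim (fun _ => v) fun p => φ p.1 p.2, ?_, fun i =>
    ⟨(hX i).left_mem _ (hgL (0, i)), (hX i).right_mem _ (hgL (1, i)),
      (hX i).outer_mem _ (hgL (2, i))⟩⟩
  have hφv : ∀ k i, φ k i ≠ v := by
    intro k i
    fin_cases k
    exacts [hav i, hbv i, hgv 0 i, hgv 1 i, hgv 2 i]
  have hφ : ∀ k i k' i', φ k i = φ k' i' → k = k' ∧ i = i' := by
    intro k i k' i' h
    fin_cases k <;> fin_cases k' <;>
      first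
      | exact ⟨rfl, haa _ _ h⟩
      | exact ⟨rfl, hbb _ _ h⟩
      | exact ⟨rfl, (hgg _ _ _ _ h).2⟩
      | exact absurd h (hab _ _)
      | exact absurd h.symm (hab _ _)
      | exact absurd h (hag _ _ _)
      | exact absurd h.symm (hag _ _ _)
      | exact absurd h (hbg _ _ _)
      | exact absurd h.symm (hbg _ _ _)
      | exact absurd (hgg _ _ _ _ h).1 (by decide)
  rintro (⟨⟩ | ⟨k, i⟩) (⟨⟩ | ⟨k', i'⟩) h
  · rfl
  · exact absurd h.symm (hφv k' i')
  · exact absurd h (hφv k i)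
  · obtain ⟨rfl, rfl⟩ := hφ k i k' i' h
    rfl

theorem linear_bound_heavy_hyperedges (t : ℕ) (ht : 1 < t) :
    ∃ C : ℕ, ∀ n : ℕ, ∀ H : Finset (Finset (Fin n)),
      (∀ e ∈ H, e.card = 3) → ¬ ContainsFanExp t H →
      (H.filter fun e => ∃ x y z : Fin n, e = {x, y, z} ∧
        x ≠ y ∧ x ≠ z ∧ y ≠ z ∧
        t + 1 ≤ pairDeg H x y ∧ 2 * t + 1 ≤ pairDeg H x z ∧
        3 * t + 1 ≤ pairDeg H y z).card ≤ C * n := by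
  set K := 2 * (t * (2 * (6 * t) + 1))
  refine ⟨K * K, fun n H h3 hfree => ?_⟩
  set G := H.filter fun e => ∃ x y z : Fin n, e = {x, y, z} ∧
    x ≠ y ∧ x ≠ z ∧ y ≠ z ∧
    t + 1 ≤ pairDeg H x y ∧ 2 * t + 1 ≤ pairDeg H x z ∧
    3 * t + 1 ≤ pairDeg H y z
  have hG3 : ∀ e ∈ G, e.card = 3 := fun e he => h3 e (Finset.mem_filter.1 he).1
  have hS : ∀ v, ∃ S : Finset (Fin n), S.card ≤ K ∧
      ∀ e ∈ G, v ∈ e → ∃ w ∈ S, w ∈ e.erase v := by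
    intro v
    have hcard : ∀ e ∈ G.filter fun e => v ∈ e, (e.erase v).card = 2 := by
      intro e he
      obtain ⟨heG, hv⟩ := Finset.mem_filter.1 he
      rw [Finset.card_erase_of_mem hv, hG3 e heG]
    rcases exists_disjoint_subfamily_or_transversal (G.filter fun e => v ∈ e)
      (fun e => e.erase v) 2 (fun e he => Finset.card_pos.1 (by rw [hcard e he]; norm_num))
      (fun e he => (hcard e he).le) (t * (2 * (6 * t) + 1)) with
      ⟨F, hFG, hF, hdis⟩ | ⟨S, hSc, hcov⟩
    · refine absurd (containsFanExp_of_sunflower t H v F (fun e he => ?_) hdis hF) hfree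
      obtain ⟨heG, hv⟩ := Finset.mem_filter.1 (hFG he)
      obtain ⟨-, x, y, z, rfl, hxy, hxz, hyz, dxy, dxz, dyz⟩ := Finset.mem_filter.1 heG
      exact exists_hasExtensions t H h3 x y z hxy hxz hyz dxy dxz dyz v hv
    · exact ⟨S, hSc, fun e he hv => hcov e (Finset.mem_filter.2 ⟨he, hv⟩)⟩
  choose S hSK hScov using hS
  simpa using card_le_of_link_transversals G hG3 S K hSK hScov
end

section
/- For every integer t > 1 there exists a constant C such that for every n the following holds: if H is an n-vertex F_t^3-free 3-graph with exactly ex_3(n, F_t^3) hyperedges, then the number of hyperedges of H that contain at least three pairs each of which is contained in at least 2t+1 and at most 3t hyperedges of H is at most Cn. -/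
/-- The Turán number `ex_3(n, F_t^3)`. -/
noncomputable def exFan3 (t n : ℕ) : ℕ :=
  sSup {m | ∃ H : Finset (Finset (Fin n)),
    (∀ e ∈ H, e.card = 3) ∧ ¬ ContainsFanExp t H ∧ H.card = m}

theorem exists_injective_of_le_card {V : Type*} [DecidableEq V] {t : ℕ} (f : Fin t → Finset V)
    (hf : ∀ i, t ≤ (f i).card) : ∃ g : Fin t → V, Function.Injective g ∧ ∀ i, g i ∈ f i := by
  refine (Finset.all_card_le_biUnion_card_iff_exists_injective f).1 fun s => ?_
  rcases s.eq_empty_or_nonempty with rfl | ⟨i, hi⟩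
  · simp
  · calc s.card ≤ t := by simpa using s.card_le_univ
      _ ≤ (f i).card := hf i
      _ ≤ _ := Finset.card_le_card (Finset.subset_biUnion_of_mem f hi)

/-- A copy of the expanded fan, given by its center `v`, its other core vertices `x i`, `y i`, and
its expansion vertices `r i`, `s i`, `c i`. -/
theorem containsFanExp_of_injective {V : Type*} [DecidableEq V] {t : ℕ} {H : Finset (Finset V)}
    (v : V) (x y r s c : Fin t → V)
    (hx : x.Injective) (hy : y.Injective) (hr : r.Injective) (hs : s.Injective) (hc : c.Injective)
    (hxy : ∀ i j, x i ≠ y j) (hxr : ∀ i j, x i ≠ r j) (hxs : ∀ i j, x i ≠ s j)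
    (hxc : ∀ i j, x i ≠ c j) (hyr : ∀ i j, y i ≠ r j) (hys : ∀ i j, y i ≠ s j)
    (hyc : ∀ i j, y i ≠ c j) (hrs : ∀ i j, r i ≠ s j) (hrc : ∀ i j, r i ≠ c j)
    (hsc : ∀ i j, s i ≠ c j)
    (hv : ∀ i, v ≠ x i ∧ v ≠ y i ∧ v ≠ r i ∧ v ≠ s i ∧ v ≠ c i)
    (h₁ : ∀ i, {v, x i, r i} ∈ H) (h₂ : ∀ i, {v, y i, s i} ∈ H)
    (h₃ : ∀ i, {x i, y i, c i} ∈ H) : ContainsFanExp t H := by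
  refine ⟨Sum.elim (fun _ => v) fun q => ![x, y, r, s, c] q.1 q.2, ?_, fun i => ?_⟩
  · have hvq : ∀ q : Fin 5 × Fin t, v ≠ ![x, y, r, s, c] q.1 q.2 := by
      rintro ⟨j, i⟩
      obtain ⟨h1, h2, h3, h4, h5⟩ := hv i
      fin_cases j <;> assumption
    refine Function.Injective.sumElim (fun _ _ _ => rfl) ?_ fun _ => hvq
    rintro ⟨j, i⟩ ⟨j', i'⟩ h
    fin_cases j <;> fin_cases j' <;> simp at h ⊢ <;> grind [Function.Injective]
  · exact ⟨h₁ i, h₂ i, h₃ i⟩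

/-- Expanded fans in a sunflower with kernel `K` and petals `P i`, where `A i`, `B i` and `C i`
are sets of expansion vertices for the pairs `v, a i`, then `v, b i`, then `a i, b i`. -/
theorem containsFanExp_of_sunflower_s7 {V : Type*} [DecidableEq V] {t : ℕ} (ht : 1 < t)
    {H : Finset (Finset V)} (v : V) (a b : Fin t ⊕ Fin t → V)
    (A B C P : Fin t ⊕ Fin t → Finset V) (K KA KB KC : Finset V)
    (hP : ∀ i j x, x ∈ P i → x ∈ P j → i = j) (hPK : ∀ i x, x ∈ P i → x ∉ K)
    (ha : ∀ i, a i ∈ P i) (hb : ∀ i, b i ∈ P i) (hab : ∀ i, a i ≠ b i)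
    (hvP : ∀ i, v ∉ P i) (hvK : v ∉ K)
    (hA : ∀ i x, x ∈ A i → x ∈ K ∨ x ∈ P i) (hB : ∀ i x, x ∈ B i → x ∈ K ∨ x ∈ P i)
    (hC : ∀ i x, x ∈ C i → x ∈ K ∨ x ∈ P i)
    (hKA : ∀ i, A i ∩ K = KA) (hKB : ∀ i, B i ∩ K = KB) (hKC : ∀ i, C i ∩ K = KC)
    (haA : ∀ i, a i ∉ A i ∧ b i ∉ A i) (haB : ∀ i, a i ∉ B i ∧ b i ∉ B i)
    (haC : ∀ i, a i ∉ C i ∧ b i ∉ C i)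
    (cA : ∀ i, 2 * t ≤ (A i).card) (cB : ∀ i, 2 * t ≤ (B i).card)
    (cC : ∀ i, 2 * t ≤ (C i).card)
    (eA : ∀ i, ∀ x ∈ A i, {v, a i, x} ∈ H) (eB : ∀ i, ∀ x ∈ B i, {v, b i, x} ∈ H)
    (eC : ∀ i, ∀ x ∈ C i, {a i, b i, x} ∈ H) : ContainsFanExp t H := by
  have mA : ∀ i x, x ∈ KA ↔ x ∈ A i ∧ x ∈ K := fun i x => by rw [← hKA i, Finset.mem_inter]
  have mB : ∀ i x, x ∈ KB ↔ x ∈ B i ∧ x ∈ K := fun i x => by rw [← hKB i, Finset.mem_inter]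
  have mC : ∀ i x, x ∈ KC ↔ x ∈ C i ∧ x ∈ K := fun i x => by rw [← hKC i, Finset.mem_inter]
  have hinl : ∀ i j : Fin t, (Sum.inl i : Fin t ⊕ Fin t) = Sum.inl j → i = j :=
    fun i j h => Sum.inl_injective h
  have hinr : ∀ i j : Fin t, (Sum.inr i : Fin t ⊕ Fin t) = Sum.inr j → i = j :=
    fun i j h => Sum.inr_injective h
  have hne : ∀ i j : Fin t, (Sum.inl i : Fin t ⊕ Fin t) ≠ Sum.inr j := fun i j => by simp
  have aInj : (fun i : Fin t => a (.inl i)).Injective := fun i j h =>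
    hinl i j (hP _ _ _ (ha _) (by simpa only [h] using ha (.inl j)))
  have bInj : (fun i : Fin t => b (.inl i)).Injective := fun i j h =>
    hinl i j (hP _ _ _ (hb _) (by simpa only [h] using hb (.inl j)))
  have abne : ∀ i j, a i ≠ b j := by
    intro i j h
    have := hP i j (a i) (ha i) (h ▸ hb j)
    subst this
    exact hab i h
  have standard : ∀ r s c : Fin t → V, r.Injective → s.Injective → c.Injective →
      (∀ i j, r i ≠ s j) → (∀ i j, r i ≠ c j) → (∀ i j, s i ≠ c j) →
      (∀ i, r i ∈ A (.inl i)) → (∀ i, s i ∈ B (.inl i)) → (∀ i, c i ∈ C (.inl i)) →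
      ContainsFanExp t H := by
    intro r s c hr hs hc hrs hrc hsc rA sB cC'
    refine containsFanExp_of_injective v (fun i => a (.inl i)) (fun i => b (.inl i)) r s c
      aInj bInj hr hs hc (fun i j => abne _ _) ?_ ?_ ?_ ?_ ?_ ?_ hrs hrc hsc ?_
      (fun i => eA _ _ (rA i)) (fun i => eB _ _ (sB i)) (fun i => eC _ _ (cC' i)) <;> grind
  by_cases hT : t ≤ ((KA ∪ KB) ∩ KC).card
  · obtain ⟨T, hTs, hTc⟩ := Finset.exists_subset_card_eq hT
    obtain ⟨y, hy, hyT⟩ := exists_injective_of_le_card (fun _ : Fin t => T) fun _ => hTc.ge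
    obtain ⟨r, hr, hrA⟩ := exists_injective_of_le_card (fun i : Fin t => A (.inl i) \ T) fun i => by
      have := Finset.le_card_sdiff T (A (.inl i))
      have := cA (.inl i)
      omega
    have hs : ∀ i, ∃ s ∈ P (.inr i), {v, y i, s} ∈ H := by
      intro i
      have h := Finset.mem_inter.1 (hTs (hyT i))
      rcases Finset.mem_union.1 h.1 with h | h
      · refine ⟨a (.inr i), ha _, ?_⟩
        rw [Finset.pair_comm]
        exact eA _ _ ((mA (.inr i) _).1 h).1
      · refine ⟨b (.inr i), hb _, ?_⟩
        rw [Finset.pair_comm]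
        exact eB _ _ ((mB (.inr i) _).1 h).1
    choose s sP sH using hs
    have yK : ∀ i, y i ∈ K := fun i =>
      ((mC (.inl i) _).1 (Finset.mem_inter.1 (hTs (hyT i))).2).2
    have yC : ∀ i, y i ∈ C (.inl i) := fun i =>
      ((mC (.inl i) _).1 (Finset.mem_inter.1 (hTs (hyT i))).2).1
    have rA : ∀ i, r i ∈ A (.inl i) := fun i => (Finset.mem_sdiff.1 (hrA i)).1
    have rT : ∀ i, r i ∉ T := fun i => (Finset.mem_sdiff.1 (hrA i)).2
    have sInj : s.Injective := fun i j h => hinr i j (hP _ _ _ (sP i) (h ▸ sP j))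
    refine containsFanExp_of_injective v (fun i => a (.inl i)) y r s (fun i => b (.inl i))
      aInj hy hr sInj bInj ?_ ?_ ?_ (fun i j => abne _ _) ?_ ?_ ?_ ?_ ?_ ?_ ?_
      (fun i => eA _ _ (rA i)) sH (fun i => ?_)
    case refine_11 =>
      rw [Finset.pair_comm]
      exact eC _ _ (yC i)
    all_goals grind
  · have cT : ∀ i : Fin t, t + 1 ≤ (C (.inl i) \ ((KA ∪ KB) ∩ KC)).card := fun i => by
      have := Finset.le_card_sdiff ((KA ∪ KB) ∩ KC) (C (.inl i))
      have := cC (.inl i)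
      omega
    have cT' : ∀ (r : Fin t → V) (i : Fin t),
        t ≤ ((C (.inl i) \ ((KA ∪ KB) ∩ KC)).erase (r i)).card := fun r i => by
      have := Finset.pred_card_le_card_erase (s := C (.inl i) \ ((KA ∪ KB) ∩ KC)) (a := r i)
      have := cT i
      omega
    by_cases hKBt : t ≤ KB.card
    · obtain ⟨S, hSs, hSc⟩ := Finset.exists_subset_card_eq hKBt
      obtain ⟨s, hs, hsS⟩ := exists_injective_of_le_card (fun _ : Fin t => S) fun _ => hSc.ge
      obtain ⟨r, hr, hrA⟩ := exists_injective_of_le_card (fun i : Fin t => A (.inl i) \ S)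
        fun i => by
          have := Finset.le_card_sdiff S (A (.inl i))
          have := cA (.inl i)
          omega
      obtain ⟨c, hc, hcC⟩ := exists_injective_of_le_card _ (cT' r)
      simp only [Finset.mem_sdiff, Finset.mem_erase, Finset.mem_inter, Finset.mem_union]
        at hrA hcC
      refine standard r s c hr hs hc ?_ ?_ ?_ ?_ ?_ ?_ <;>
        clear standard cT cT' cA cB cC eA eB eC aInj bInj hr hs hc hKA hKB hKC <;> grind
    by_cases hKAt : t ≤ KA.card
    · obtain ⟨S, hSs, hSc⟩ := Finset.exists_subset_card_eq hKAt
      obtain ⟨r, hr, hrS⟩ := exists_injective_of_le_card (fun _ : Fin t => S) fun _ => hSc.ge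
      obtain ⟨s, hs, hsB⟩ := exists_injective_of_le_card (fun i : Fin t => B (.inl i) \ S)
        fun i => by
          have := Finset.le_card_sdiff S (B (.inl i))
          have := cB (.inl i)
          omega
      obtain ⟨c, hc, hcC⟩ := exists_injective_of_le_card _ (cT' s)
      simp only [Finset.mem_sdiff, Finset.mem_erase, Finset.mem_inter, Finset.mem_union]
        at hsB hcC
      refine standard r s c hr hs hc ?_ ?_ ?_ ?_ ?_ ?_ <;>
        clear standard cT cT' cA cB cC eA eB eC aInj bInj hr hs hc hKA hKB hKC <;> grind
    · obtain ⟨c, hc, hcC⟩ := exists_injective_of_le_card _ fun i => (Nat.le_succ t).trans (cT i)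
      have hr : ∀ i : Fin t, ((A (.inl i) \ KA).erase (c i)).Nonempty := fun i => by
        have h₁ := Finset.le_card_sdiff KA (A (.inl i))
        have h₂ := Finset.pred_card_le_card_erase (s := A (.inl i) \ KA) (a := c i)
        have := cA (.inl i)
        rw [← Finset.card_pos]
        omega
      choose r hr using hr
      have hs : ∀ i : Fin t, (((B (.inl i) \ KB).erase (c i)).erase (r i)).Nonempty := fun i => by
        have h₁ := Finset.le_card_sdiff KB (B (.inl i))
        have h₂ := Finset.pred_card_le_card_erase (s := B (.inl i) \ KB) (a := c i)
        have h₃ := Finset.pred_card_le_card_erase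
          (s := (B (.inl i) \ KB).erase (c i)) (a := r i)
        have := cB (.inl i)
        rw [← Finset.card_pos]
        omega
      choose s hs using hs
      simp only [Finset.mem_sdiff, Finset.mem_erase, Finset.mem_inter, Finset.mem_union]
        at hr hs hcC
      have rP : ∀ i, r i ∈ P (.inl i) := by grind
      have sP : ∀ i, s i ∈ P (.inl i) := by grind
      have rInj : r.Injective := fun i j h => hinl i j (hP _ _ _ (rP i) (h ▸ rP j))
      have sInj : s.Injective := fun i j h => hinl i j (hP _ _ _ (sP i) (h ▸ sP j))
      refine standard r s c rInj sInj hc ?_ ?_ ?_ ?_ ?_ ?_ <;>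
        clear standard cT cT' cA cB cC eA eB eC aInj bInj rInj sInj hc hKA hKB hKC <;> grind

/-- An indexed form of the sunflower lemma. -/
theorem exists_sunflower (k p : ℕ) : ∃ m : ℕ, ∀ {ι V : Type} [DecidableEq ι] [DecidableEq V]
    (I : Finset ι) (U : ι → Finset V), (∀ i ∈ I, (U i).card ≤ k) → m ≤ I.card →
    ∃ J ⊆ I, p ≤ J.card ∧ ∃ K : Finset V, (∀ i ∈ J, K ⊆ U i) ∧
      ∀ i ∈ J, ∀ j ∈ J, ∀ x, x ∈ U i \ K → x ∈ U j \ K → i = j := by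
  induction k with
  | zero =>
    refine ⟨p, fun I U hU hI => ⟨I, subset_rfl, hI, ∅, by simp, fun i hi j _ x hx => ?_⟩⟩
    have := Finset.card_eq_zero.1 (Nat.le_zero.1 (hU i hi))
    simp [this] at hx
  | succ k ih =>
    obtain ⟨m, hm⟩ := ih
    refine ⟨p + p * (k + 1) * m + 1, fun {ι V} _ _ I U hU hI => ?_⟩
    let Q : Finset ι → Prop := fun J => ∀ i ∈ J, ∀ j ∈ J, ∀ x, x ∈ U i → x ∈ U j → i = j
    classical
    obtain ⟨J, hJ, hmax⟩ := Finset.exists_max_image (I.powerset.filter Q) Finset.card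
      ⟨∅, by simp [Q]⟩
    obtain ⟨hJI, hJQ⟩ := Finset.mem_filter.1 hJ
    rw [Finset.mem_powerset] at hJI
    by_cases hp : p ≤ J.card
    · exact ⟨J, hJI, hp, ∅, by simp, by simpa using hJQ⟩
    have hW : (J.biUnion U).card ≤ p * (k + 1) :=
      (Finset.card_biUnion_le_card_mul J U (k + 1) fun i hi => hU i (hJI hi)).trans
        (Nat.mul_le_mul_right _ (by omega))
    have hmeet : ∀ i ∈ I \ J, ∃ y ∈ J.biUnion U, y ∈ U i := by
      intro i hi
      obtain ⟨hiI, hiJ⟩ := Finset.mem_sdiff.1 hi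
      by_contra! hcon
      have hdis : ∀ x ∈ U i, ∀ j ∈ J, x ∉ U j := fun x hx j hj hxj =>
        hcon x (Finset.mem_biUnion.2 ⟨j, hj, hxj⟩) hx
      have := hmax (insert i J) (Finset.mem_filter.2
        ⟨Finset.mem_powerset.2 (Finset.insert_subset hiI hJI), by
          intro a ha b hb x hxa hxb
          rw [Finset.mem_insert] at ha hb
          rcases ha with rfl | ha <;> rcases hb with rfl | hb
          · rfl
          · exact (hdis x hxa b hb hxb).elim
          · exact (hdis x hxb a ha hxa).elim
          · exact hJQ a ha b hb x hxa hxb⟩)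
      rw [Finset.card_insert_of_notMem hiJ] at this
      omega
    obtain ⟨y, hylt⟩ : ∃ y, m < ((I \ J).filter fun i => y ∈ U i).card := by
      by_contra! hcon
      have h₁ : I \ J ⊆ (J.biUnion U).biUnion fun y => (I \ J).filter fun i => y ∈ U i := by
        intro i hi
        obtain ⟨y, hy, hyi⟩ := hmeet i hi
        exact Finset.mem_biUnion.2 ⟨y, hy, Finset.mem_filter.2 ⟨hi, hyi⟩⟩
      have h₂ := (Finset.card_le_card h₁).trans
        (Finset.card_biUnion_le_card_mul _ _ m fun y _ => hcon y)
      have h₃ := Finset.le_card_sdiff J I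
      have h₄ := Nat.mul_le_mul_right m hW
      omega
    obtain ⟨J', hJ', hpJ', K, hK, hdis⟩ := hm ((I \ J).filter fun i => y ∈ U i)
      (fun i => (U i).erase y) (fun i hi => by
        obtain ⟨hi, hy⟩ := Finset.mem_filter.1 hi
        rw [Finset.card_erase_of_mem hy]
        have := hU i (Finset.mem_sdiff.1 hi).1
        omega) hylt.le
    have hyU : ∀ i ∈ J', y ∈ U i := fun i hi =>
      (Finset.mem_filter.1 (hJ' hi)).2
    refine ⟨J', fun i hi => (Finset.mem_sdiff.1 (Finset.mem_filter.1 (hJ' hi)).1).1, hpJ',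
      insert y K, fun i hi => ?_, fun i hi j hj z hzi hzj => hdis i hi j hj z ?_ ?_⟩
    · exact Finset.insert_subset (hyU i hi) ((hK i hi).trans (Finset.erase_subset _ _))
    · grind
    · grind

theorem card_filter_insert_pair {n : ℕ} {H : Finset (Finset (Fin n))} (hH : ∀ e ∈ H, e.card = 3)
    {x y : Fin n} (hxy : x ≠ y) :
    (Finset.univ.filter fun z => ({x, y, z} : Finset (Fin n)) ∈ H).card = pairDegP H {x, y} := by
  have hz : ∀ z, ({x, y, z} : Finset (Fin n)) ∈ H → z ≠ x ∧ z ≠ y := by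
    intro z hz
    have := hH _ hz
    constructor <;> rintro rfl
    · have h : ({z, y, z} : Finset (Fin n)) = {z, y} := by ext; simp; tauto
      rw [h, Finset.card_pair hxy] at this
      omega
    · have h : ({x, z, z} : Finset (Fin n)) = {x, z} := by ext; simp
      rw [h, Finset.card_pair hxy] at this
      omega
  refine Finset.card_bij (fun z _ => {x, y, z}) ?_ ?_ ?_
  · intro z hz
    simp only [Finset.mem_filter, Finset.mem_univ, true_and] at hz ⊢
    refine ⟨hz, fun w hw => ?_⟩
    simp only [Finset.mem_insert, Finset.mem_singleton] at hw ⊢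
    tauto
  · intro z hz₁ w hw₁ h
    have hw := hz w (Finset.mem_filter.1 hw₁).2
    have : w ∈ ({x, y, z} : Finset (Fin n)) := h ▸ by simp
    simp only [Finset.mem_insert, Finset.mem_singleton] at this
    tauto
  · intro e he
    obtain ⟨he, hsub⟩ := Finset.mem_filter.1 he
    have hc := Finset.card_sdiff_of_subset hsub
    rw [hH e he, Finset.card_pair hxy] at hc
    obtain ⟨z, hz⟩ := Finset.card_eq_one.1 hc
    have : ({x, y, z} : Finset (Fin n)) = e := by
      rw [← Finset.sdiff_union_of_subset hsub, hz]
      ext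
      simp
      tauto
    exact ⟨z, by simpa [this] using he, this⟩

/-- The hyperedges of `H` containing at least three pairs of degree between `2 t + 1` and `3 t`. -/
def mediumEdges {V : Type*} [DecidableEq V] (t : ℕ) (H : Finset (Finset V)) :
    Finset (Finset V) :=
  H.filter fun e => 3 ≤ ((e.powersetCard 2).filter fun p =>
    2 * t + 1 ≤ pairDegP H p ∧ pairDegP H p ≤ 3 * t).card

theorem pairDegP_of_mem_mediumEdges {V : Type*} [DecidableEq V] {t : ℕ} {H : Finset (Finset V)}
    (hH : ∀ e ∈ H, e.card = 3) {e : Finset V} (he : e ∈ mediumEdges t H) {x y : V}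
    (hx : x ∈ e) (hy : y ∈ e) (hxy : x ≠ y) :
    2 * t + 1 ≤ pairDegP H {x, y} ∧ pairDegP H {x, y} ≤ 3 * t := by
  obtain ⟨heH, h3⟩ := Finset.mem_filter.1 he
  have hc : (e.powersetCard 2).card = 3 := by
    rw [Finset.card_powersetCard, hH e heH]
    rfl
  have := Finset.eq_of_subset_of_card_le (Finset.filter_subset _ (e.powersetCard 2))
    (hc.le.trans h3)
  have hp : ({x, y} : Finset V) ∈ e.powersetCard 2 := by
    rw [Finset.mem_powersetCard]
    exact ⟨by simp [Finset.insert_subset_iff, hx, hy], Finset.card_pair hxy⟩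
  rw [← this] at hp
  exact (Finset.mem_filter.1 hp).2

theorem exists_forall_card_mediumEdges_filter_mem_le (t : ℕ) (ht : 1 < t) :
    ∃ D : ℕ, ∀ (n : ℕ) (H : Finset (Finset (Fin n))),
      (∀ e ∈ H, e.card = 3) → ¬ ContainsFanExp t H →
      ∀ v, ((mediumEdges t H).filter fun e => v ∈ e).card ≤ D := by
  set k := 2 + 9 * t with hk
  obtain ⟨m, hm⟩ := exists_sunflower k (k * (3 * t) + (2 ^ k) ^ 3 * (2 * t) + 1)
  refine ⟨m, fun n H hH hfree v => ?_⟩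
  by_contra! hlt
  set S := (mediumEdges t H).filter fun e => v ∈ e
  have hshape : ∀ e : S, ∃ a b, e.1 = {v, a, b} ∧ v ≠ a ∧ v ≠ b ∧ a ≠ b := by
    rintro ⟨e, he⟩
    obtain ⟨he, hve⟩ := Finset.mem_filter.1 he
    have hc := Finset.card_erase_of_mem hve
    rw [hH e (Finset.mem_filter.1 he).1] at hc
    obtain ⟨a, b, hab, h⟩ := Finset.card_eq_two.1 hc
    have ha : a ∈ e.erase v := by simp [h]
    have hb : b ∈ e.erase v := by simp [h]
    exact ⟨a, b, by rw [← h, Finset.insert_erase hve], (Finset.ne_of_mem_erase ha).symm,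
      (Finset.ne_of_mem_erase hb).symm, hab⟩
  choose a b hab hva hvb hne using hshape
  have hmed : ∀ e : S, e.1 ∈ mediumEdges t H := fun e => (Finset.mem_filter.1 e.2).1
  let N : Fin n → Fin n → Finset (Fin n) := fun x y =>
    Finset.univ.filter fun z => ({x, y, z} : Finset (Fin n)) ∈ H
  have hN : ∀ x y z, z ∈ N x y ↔ ({x, y, z} : Finset (Fin n)) ∈ H := by simp [N]
  have hNne : ∀ x y z, z ∈ N x y → z ≠ x ∧ z ≠ y := by
    intro x y z hz
    have h := hH _ ((hN x y z).1 hz)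
    constructor <;> rintro rfl
    · rw [Finset.insert_eq_of_mem (by simp)] at h
      exact absurd h (Finset.card_le_two.trans_lt (by omega)).ne
    · have := (Finset.card_le_two (a := x) (b := z))
      simp at h
      omega
  have hNcard : ∀ e : S, ∀ x ∈ e.1, ∀ y ∈ e.1, ∀ z, x ≠ y →
      2 * t ≤ ((N x y).erase z).card ∧ ((N x y).erase z).card ≤ 3 * t := by
    intro e x hx y hy z hxy
    have h₁ := pairDegP_of_mem_mediumEdges hH (hmed e) hx hy hxy
    rw [← card_filter_insert_pair hH hxy] at h₁
    have h₂ := Finset.pred_card_le_card_erase (s := N x y) (a := z)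
    have h₃ := Finset.card_erase_le (s := N x y) (a := z)
    simp only [N] at h₂ h₃ ⊢
    omega
  have hve : ∀ e : S, v ∈ e.1 := fun e => by rw [hab e]; simp
  have hae : ∀ e : S, a e ∈ e.1 := fun e => by rw [hab e]; simp
  have hbe : ∀ e : S, b e ∈ e.1 := fun e => by rw [hab e]; simp
  let A := fun e => (N v (a e)).erase (b e)
  let B := fun e => (N v (b e)).erase (a e)
  let C := fun e => (N (a e) (b e)).erase v
  have cA := fun e => hNcard e v (hve e) (a e) (hae e) (b e) (hva e)
  have cB := fun e => hNcard e v (hve e) (b e) (hbe e) (a e) (hvb e)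
  have cC := fun e => hNcard e (a e) (hae e) (b e) (hbe e) v (hne e)
  let U := fun e => {a e, b e} ∪ (A e ∪ (B e ∪ C e))
  have hUcard : ∀ e, (U e).card ≤ k := fun e => by
    have h₁ := Finset.card_union_le {a e, b e} (A e ∪ (B e ∪ C e))
    have h₂ := Finset.card_union_le (A e) (B e ∪ C e)
    have h₃ := Finset.card_union_le (B e) (C e)
    have h₄ := Finset.card_le_two (a := a e) (b := b e)
    have h₅ : (A e).card ≤ 3 * t := (cA e).2
    have h₆ : (B e).card ≤ 3 * t := (cB e).2
    have h₇ : (C e).card ≤ 3 * t := (cC e).2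
    simp only [U]
    omega
  obtain ⟨J, -, hJ, K, hK, hdis⟩ := hm Finset.univ U (fun e _ => hUcard e)
    (by rw [Finset.card_univ, Fintype.card_coe]; exact hlt.le)
  have hvU : ∀ e, v ∉ U e := by
    intro e he
    simp only [U, A, B, C, Finset.mem_union, Finset.mem_insert, Finset.mem_singleton,
      Finset.mem_erase] at he
    have := hNne v (a e) v
    have := hNne v (b e) v
    have := hva e
    have := hvb e
    tauto
  obtain ⟨e₀, he₀⟩ : J.Nonempty := Finset.card_pos.1 (by omega)
  have hKk : K.card ≤ k := (Finset.card_le_card (hK e₀ he₀)).trans (hUcard e₀)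
  have hbad : (J.filter fun e => a e ∈ K ∨ b e ∈ K).card ≤ k * (3 * t) := by
    calc _ ≤ (K.biUnion fun x => J.filter fun e => a e = x ∨ b e = x).card := by
          refine Finset.card_le_card fun e he => ?_
          obtain ⟨he, h | h⟩ := Finset.mem_filter.1 he <;>
            exact Finset.mem_biUnion.2 ⟨_, h, by simp [he]⟩
      _ ≤ K.card * (3 * t) := by
          refine Finset.card_biUnion_le_card_mul _ _ _ fun x _ => ?_
          rcases (J.filter fun e => a e = x ∨ b e = x).eq_empty_or_nonempty with h | ⟨e, he⟩
          · simp [h]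
          have hx : ∀ e ∈ J.filter fun e => a e = x ∨ b e = x, x ∈ e.1 ∧ v ≠ x := by
            intro e he
            obtain ⟨-, rfl | rfl⟩ := Finset.mem_filter.1 he
            · exact ⟨hae e, hva e⟩
            · exact ⟨hbe e, hvb e⟩
          refine le_trans ?_
            (pairDegP_of_mem_mediumEdges hH (hmed e) (hve e) (hx e he).1 (hx e he).2).2
          refine Finset.card_le_card_of_injOn Subtype.val (fun f hf => ?_)
            Subtype.val_injective.injOn
          refine Finset.mem_coe.2 (Finset.mem_filter.2 ⟨(Finset.mem_filter.1 (hmed f)).1, ?_⟩)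
          simp [Finset.insert_subset_iff, hve f, (hx f hf).1]
      _ ≤ _ := Nat.mul_le_mul_right _ hKk
  have hgood := Finset.card_filter_add_card_filter_not (s := J) (fun e => a e ∈ K ∨ b e ∈ K)
  obtain ⟨⟨KA, KB, KC⟩, -, hF⟩ := Finset.exists_lt_card_fiber_of_mul_lt_card_of_maps_to
    (s := J.filter fun e => ¬ (a e ∈ K ∨ b e ∈ K))
    (t := K.powerset ×ˢ K.powerset ×ˢ K.powerset)
    (f := fun e => (A e ∩ K, B e ∩ K, C e ∩ K)) (n := 2 * t)
    (fun e _ => by simp [Finset.inter_subset_right]) (by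
      rw [Finset.card_product, Finset.card_product, Finset.card_powerset]
      have h : 2 ^ K.card * (2 ^ K.card * 2 ^ K.card) ≤ (2 ^ k) ^ 3 := by
        calc _ = (2 ^ K.card) ^ 3 := by ring
          _ ≤ _ := Nat.pow_le_pow_left (Nat.pow_le_pow_right (by omega) hKk) 3
      have := Nat.mul_le_mul_right (2 * t) h
      omega)
  set F := (J.filter fun e => ¬ (a e ∈ K ∨ b e ∈ K)).filter
    fun e => (A e ∩ K, B e ∩ K, C e ∩ K) = (KA, KB, KC)
  obtain ⟨g⟩ : Nonempty (Fin t ⊕ Fin t ↪ F) := Function.Embedding.nonempty_of_card_le (by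
    rw [Fintype.card_sum, Fintype.card_fin, Fintype.card_coe]
    omega)
  have hg : ∀ i, (g i).1 ∈ J ∧ a (g i).1 ∉ K ∧ b (g i).1 ∉ K ∧
      A (g i).1 ∩ K = KA ∧ B (g i).1 ∩ K = KB ∧ C (g i).1 ∩ K = KC := fun i => by
    have := (g i).2
    simp only [F, Finset.mem_filter, Prod.mk.injEq, not_or] at this
    tauto
  refine hfree (containsFanExp_of_sunflower_s7 ht v (fun i => a (g i).1) (fun i => b (g i).1)
    (fun i => A (g i).1) (fun i => B (g i).1) (fun i => C (g i).1) (fun i => U (g i).1 \ K)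
    K KA KB KC ?_ ?_ ?_ ?_ ?_ ?_ ?_ ?_ ?_ ?_ ?_ ?_ ?_ ?_ ?_ ?_ ?_ ?_ ?_ ?_ ?_ ?_)
  · exact fun i j x hi hj =>
      g.injective (Subtype.ext (hdis _ (hg i).1 _ (hg j).1 x hi hj))
  · exact fun i x hx => (Finset.mem_sdiff.1 hx).2
  · exact fun i => Finset.mem_sdiff.2 ⟨by simp [U], (hg i).2.1⟩
  · exact fun i => Finset.mem_sdiff.2 ⟨by simp [U], (hg i).2.2.1⟩
  · exact fun i => hne _
  · exact fun i h => hvU _ (Finset.mem_sdiff.1 h).1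
  · exact fun h => hvU _ (hK e₀ he₀ h)
  · intro i x hx
    by_cases h : x ∈ K <;> simp [U, h, hx]
  · intro i x hx
    by_cases h : x ∈ K <;> simp [U, h, hx]
  · intro i x hx
    by_cases h : x ∈ K <;> simp [U, h, hx]
  · exact fun i => (hg i).2.2.2.1
  · exact fun i => (hg i).2.2.2.2.1
  · exact fun i => (hg i).2.2.2.2.2
  · exact fun i => ⟨fun h => (hNne _ _ _ (Finset.mem_of_mem_erase h)).2 rfl,
      Finset.notMem_erase _ _⟩
  · exact fun i => ⟨Finset.notMem_erase _ _,
      fun h => (hNne _ _ _ (Finset.mem_of_mem_erase h)).2 rfl⟩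
  · exact fun i => ⟨fun h => (hNne _ _ _ (Finset.mem_of_mem_erase h)).1 rfl,
      fun h => (hNne _ _ _ (Finset.mem_of_mem_erase h)).2 rfl⟩
  · exact fun i => (cA _).1
  · exact fun i => (cB _).1
  · exact fun i => (cC _).1
  · exact fun i x hx => (hN _ _ _).1 (Finset.mem_of_mem_erase hx)
  · exact fun i x hx => (hN _ _ _).1 (Finset.mem_of_mem_erase hx)
  · exact fun i x hx => (hN _ _ _).1 (Finset.mem_of_mem_erase hx)

theorem linear_bound_H3 (t : ℕ) (ht : 1 < t) :
    ∃ C : ℕ, ∀ n : ℕ, ∀ H : Finset (Finset (Fin n)),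
      (∀ e ∈ H, e.card = 3) → ¬ ContainsFanExp t H → H.card = exFan3 t n →
      (H.filter fun e => 3 ≤ ((e.powersetCard 2).filter fun p =>
        2 * t + 1 ≤ pairDegP H p ∧ pairDegP H p ≤ 3 * t).card).card ≤ C * n := by
  obtain ⟨D, hD⟩ := exists_forall_card_mediumEdges_filter_mem_le t ht
  refine ⟨D, fun n H hH hfree _ => ?_⟩
  change (mediumEdges t H).card ≤ D * n
  calc (mediumEdges t H).card
      ≤ (Finset.univ.biUnion fun v => (mediumEdges t H).filter fun e => v ∈ e).card := by
        refine Finset.card_le_card fun e he => ?_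
        obtain ⟨v, hv⟩ : e.Nonempty :=
          Finset.card_pos.1 (by rw [hH e (Finset.mem_filter.1 he).1]; omega)
        exact Finset.mem_biUnion.2 ⟨v, Finset.mem_univ v, Finset.mem_filter.2 ⟨he, hv⟩⟩
    _ ≤ (Finset.univ : Finset (Fin n)).card * D :=
        Finset.card_biUnion_le_card_mul _ _ _ fun v _ => hD n H hH hfree v
    _ = D * n := by rw [Finset.card_univ, Fintype.card_fin, mul_comm]
end

section
/- For every integer t > 1 there exists a constant C such that for every n the following holds: if H is an n-vertex F_t^3-free 3-graph with exactly ex_3(n, F_t^3) hyperedges, then the number of hyperedges of H that contain at least two pairs each of which is contained in at least t+1 and at most 2t hyperedges of H is at most Cn. -/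
namespace FanExpansion

open Finset

section Basic

variable {V : Type*} [DecidableEq V] {H : Finset (Finset V)} {a b c x : V}

theorem powersetCard_two_triple (hab : a ≠ b) (hac : a ≠ c) (hbc : b ≠ c) :
    ({a, b, c} : Finset V).powersetCard 2 = {{a, b}, {a, c}, {b, c}} := by
  symm
  apply eq_of_subset_of_card_le
  · intro p hp
    simp only [mem_insert, mem_singleton] at hp
    rw [mem_powersetCard]
    rcases hp with rfl | rfl | rfl
    · exact ⟨by intro y; simp; tauto, card_pair hab⟩
    · exact ⟨by intro y; simp; tauto, card_pair hac⟩
    · exact ⟨by intro y; simp; tauto, card_pair hbc⟩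
  · rw [card_powersetCard, card_eq_three.2 ⟨a, b, c, hab, hac, hbc, rfl⟩]
    have h1 : ({a, b} : Finset V) ≠ {a, c} := by
      intro h
      have : b ∈ ({a, c} : Finset V) := h ▸ (by simp)
      simp at this; tauto
    have h2 : ({a, b} : Finset V) ≠ {b, c} := by
      intro h
      have : a ∈ ({b, c} : Finset V) := h ▸ (by simp)
      simp at this; tauto
    have h3 : ({a, c} : Finset V) ≠ {b, c} := by
      intro h
      have : a ∈ ({b, c} : Finset V) := h ▸ (by simp)
      simp at this; tauto
    rw [card_eq_three.2 ⟨_, _, _, h1, h2, h3, rfl⟩]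
    decide

theorem exists_triple_of_mem (hH : ∀ e ∈ H, e.card = 3) {e : Finset V} (he : e ∈ H) (hc : c ∈ e) :
    ∃ a b, c ≠ a ∧ c ≠ b ∧ a ≠ b ∧ e = {c, a, b} := by
  have h2 : (e.erase c).card = 2 := by rw [card_erase_of_mem hc, hH e he]
  obtain ⟨a, b, hab, h⟩ := card_eq_two.1 h2
  have ha : a ∈ e.erase c := by simp [h]
  have hb : b ∈ e.erase c := by simp [h]
  exact ⟨a, b, (ne_of_mem_erase ha).symm, (ne_of_mem_erase hb).symm, hab, by
    rw [← h, insert_erase hc]⟩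

variable [Fintype V]

/-- The vertices that complete the pair `{a, b}` to a hyperedge of `H`. -/
def nbr (H : Finset (Finset V)) (a b : V) : Finset V :=
  univ.filter fun x => ({a, b, x} : Finset V) ∈ H

theorem mem_nbr : x ∈ nbr H a b ↔ ({a, b, x} : Finset V) ∈ H := by
  simp [nbr]

theorem nbr_comm : nbr H a b = nbr H b a := by
  ext x
  rw [mem_nbr, mem_nbr, Finset.insert_comm]

theorem mem_nbr_swap : x ∈ nbr H a b ↔ b ∈ nbr H a x := by
  rw [mem_nbr, mem_nbr, Finset.pair_comm]

theorem mem_nbr_rotate : x ∈ nbr H a b ↔ a ∈ nbr H b x := by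
  rw [nbr_comm, mem_nbr_swap]

theorem ne_of_mem_nbr (hH : ∀ e ∈ H, e.card = 3) (h : x ∈ nbr H a b) :
    a ≠ b ∧ a ≠ x ∧ b ≠ x := by
  have h3 := hH _ (mem_nbr.1 h)
  refine ⟨?_, ?_, ?_⟩ <;> rintro rfl
  · have := (card_le_two (a := a) (b := x))
    simp only [mem_singleton, insert_eq_of_mem, mem_insert, true_or] at h3
    omega
  · have := (card_le_two (a := a) (b := b))
    rw [Finset.pair_comm, insert_eq_of_mem (by simp)] at h3
    omega
  · have := (card_le_two (a := a) (b := b))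
    rw [insert_eq_of_mem (s := {b}) (by simp)] at h3
    omega

theorem pairDegP_pair (hH : ∀ e ∈ H, e.card = 3) (hab : a ≠ b) :
    pairDegP H {a, b} = (nbr H a b).card := by
  unfold pairDegP
  have himg : (H.filter fun h => ({a, b} : Finset V) ⊆ h)
      = (nbr H a b).image fun x => ({a, b, x} : Finset V) := by
    ext e
    simp only [mem_filter, mem_image, mem_nbr]
    constructor
    · rintro ⟨he, hs⟩
      have h1 : (e \ {a, b}).card = 1 := by
        rw [card_sdiff_of_subset hs, hH e he, card_pair hab]
      obtain ⟨x, hx⟩ := card_eq_one.1 h1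
      have : ({a, b, x} : Finset V) = e := by
        rw [← union_sdiff_of_subset hs, hx]
        ext y; simp
      exact ⟨x, this ▸ he, this⟩
    · rintro ⟨x, hx, rfl⟩
      exact ⟨hx, by intro y; simp; tauto⟩
  rw [himg, card_image_of_injOn]
  intro x hx y hy hxy
  have hx' := ne_of_mem_nbr hH hx
  have : x ∈ ({a, b, y} : Finset V) := by
    have h : x ∈ ({a, b, x} : Finset V) := by simp
    simpa only [hxy] using h
  simp only [mem_insert, mem_singleton] at this
  rcases this with h | h | h
  · exact absurd h.symm hx'.2.1
  · exact absurd h.symm hx'.2.2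
  · exact h

end Basic

section Representatives

variable {V ι : Type*} [DecidableEq V] [Fintype ι]

/-- A family of finite sets has distinct representatives if the number of members whose rank is at
most that of `x` never exceeds the rank of `x`. -/
theorem exists_injective_of_rank (X : ι → Finset V) (g : ι → ℕ) (hg : ∀ x, g x ≤ (X x).card)
    (h : ∀ x, (univ.filter fun y => g y ≤ g x).card ≤ g x) :
    ∃ f : ι → V, Function.Injective f ∧ ∀ x, f x ∈ X x := by
  classical
  rw [← Finset.all_card_le_biUnion_card_iff_exists_injective]
  intro s
  rcases s.eq_empty_or_nonempty with rfl | hs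
  · simp
  obtain ⟨x, hx, hmax⟩ := s.exists_max_image g hs
  calc s.card ≤ (univ.filter fun y => g y ≤ g x).card :=
        card_le_card fun y hy => by simpa using hmax y hy
    _ ≤ g x := h x
    _ ≤ (X x).card := hg x
    _ ≤ _ := card_le_card (subset_biUnion_of_mem X hx)

variable {t : ℕ} {H : Finset (Finset V)}

theorem containsFanExp_of_core (hι : Fintype.card ι = t) (c : V) (a b : ι → V) (p : Fin 3 × ι → V)
    (ha : Function.Injective a) (hb : Function.Injective b) (hab : ∀ i j, a i ≠ b j)
    (hca : ∀ i, c ≠ a i) (hcb : ∀ i, c ≠ b i) (hp : Function.Injective p)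
    (hpc : ∀ x, p x ≠ c) (hpa : ∀ x i, p x ≠ a i) (hpb : ∀ x i, p x ≠ b i)
    (h0 : ∀ i, ({c, a i, p (0, i)} : Finset V) ∈ H)
    (h1 : ∀ i, ({c, b i, p (1, i)} : Finset V) ∈ H)
    (h2 : ∀ i, ({a i, b i, p (2, i)} : Finset V) ∈ H) : ContainsFanExp t H := by
  obtain ⟨e⟩ : Nonempty (Fin t ≃ ι) := ⟨(Fintype.equivFinOfCardEq hι).symm⟩
  have hp' : ∀ j i j' i', p (j, i) = p (j', i') ↔ j = j' ∧ i = i' := fun j i j' i' => by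
    rw [hp.eq_iff, Prod.mk.injEq]
  refine ⟨Sum.elim (fun _ => c) fun x =>
    (![a (e x.2), b (e x.2), p (0, e x.2), p (1, e x.2), p (2, e x.2)] : Fin 5 → V) x.1, ?_, ?_⟩
  · rintro (⟨⟩ | ⟨j, i⟩) (⟨⟩ | ⟨j', i'⟩) h
    · rfl
    · fin_cases j' <;> simp at h
      · exact absurd h (hca _)
      · exact absurd h (hcb _)
      all_goals exact absurd h.symm (hpc _)
    · fin_cases j <;> simp at h
      · exact absurd h.symm (hca _)
      · exact absurd h.symm (hcb _)
      all_goals exact absurd h (hpc _)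
    · fin_cases j <;> fin_cases j' <;>
        simp [ha.eq_iff, hb.eq_iff, hp', hab, hpa, hpb, fun x i => (hpa x i).symm,
          fun x i => (hpb x i).symm, fun i j => (hab j i).symm] at h ⊢ <;> exact h
  · intro i
    exact ⟨h0 _, h1 _, h2 _⟩

end Representatives

section Covering

/-- A digraph with out-degrees at most `k` contains an independent set of every size `s` such that
there are at least `(2 * k + 1) * s` vertices. -/
theorem exists_independent {α : Type*} (R : α → α → Prop) [DecidableRel R] [DecidableEq α] (k s : ℕ)
    (T : Finset α) (hk : ∀ x ∈ T, (T.filter fun y => R x y).card ≤ k)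
    (hs : (2 * k + 1) * s ≤ T.card) :
    ∃ I ⊆ T, I.card = s ∧ ∀ x ∈ I, ∀ y ∈ I, x ≠ y → ¬ R x y := by
  induction s generalizing T with
  | zero => exact ⟨∅, by simp, rfl, by simp⟩
  | succ s ih =>
    obtain ⟨x, hx, hin⟩ : ∃ x ∈ T, (T.filter fun y => R y x).card ≤ k := by
      apply exists_le_of_sum_le (s := T) (f := fun x => (T.filter fun y => R y x).card)
        (g := fun _ => k)
      · apply card_pos.1; nlinarith
      · calc ∑ x ∈ T, (T.filter fun y => R y x).card
            = ∑ y ∈ T, (T.filter fun x => R y x).card :=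
              (sum_card_bipartiteAbove_eq_sum_card_bipartiteBelow (s := T) (t := T) R).symm
          _ ≤ ∑ _y ∈ T, k := sum_le_sum hk
    let B : Finset α := insert x ((T.filter fun y => R x y) ∪ T.filter fun y => R y x)
    have hB : B.card ≤ 2 * k + 1 := by
      have h1 : B.card ≤ _ := card_insert_le x ((T.filter fun y => R x y) ∪ T.filter fun y => R y x)
      have h2 := card_union_le (T.filter fun y => R x y) (T.filter fun y => R y x)
      have h3 := hk x hx
      omega
    obtain ⟨I, hI, hc, hind⟩ := ih (T \ B)
      (fun y hy => (card_le_card (filter_subset_filter _ sdiff_subset)).trans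
        (hk y (mem_sdiff.1 hy).1))
      (by
        have := le_card_sdiff B T
        rw [mul_add] at hs
        omega)
    have hxI : x ∉ I := fun h => (mem_sdiff.1 (hI h)).2 (mem_insert_self _ _)
    have hout : ∀ y ∈ I, ¬ R x y ∧ ¬ R y x := fun y hy => by
      have h := mem_sdiff.1 (hI hy)
      simp only [B, mem_insert, mem_union, mem_filter, not_or, not_and] at h
      exact ⟨h.2.2.1 h.1, h.2.2.2 h.1⟩
    refine ⟨insert x I, insert_subset hx (hI.trans sdiff_subset), by
      rw [card_insert_of_notMem hxI, hc], ?_⟩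
    intro y hy z hz hyz
    rw [mem_insert] at hy hz
    rcases hy with rfl | hy <;> rcases hz with rfl | hz
    · exact absurd rfl hyz
    · exact (hout z hz).1
    · exact (hout y hy).2
    · exact hind y hy z hz hyz

variable {V : Type*} [DecidableEq V]

/-- The pairs in `T` have no common entries. -/
def PairsDisjoint (T : Finset (V × V)) : Prop :=
  ∀ x ∈ T, ∀ y ∈ T, x ≠ y → x.1 ≠ y.1 ∧ x.1 ≠ y.2 ∧ x.2 ≠ y.1 ∧ x.2 ≠ y.2

variable [Fintype V]

theorem exists_cover (P : V → V → Prop) (m : ℕ)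
    (h : ∀ T : Finset (V × V), PairsDisjoint T → (∀ x ∈ T, P x.1 x.2) → T.card ≤ m) :
    ∃ X : Finset V, X.card ≤ 2 * m ∧ ∀ a b, P a b → a ∈ X ∨ b ∈ X := by
  classical
  let 𝒯 : Finset (Finset (V × V)) :=
    univ.filter fun T => PairsDisjoint T ∧ ∀ x ∈ T, P x.1 x.2
  obtain ⟨T, hT, hmax⟩ := 𝒯.exists_max_image card ⟨∅, by simp [𝒯, PairsDisjoint]⟩
  simp only [𝒯, mem_filter, mem_univ, true_and] at hT hmax
  refine ⟨T.image Prod.fst ∪ T.image Prod.snd, ?_, ?_⟩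
  · have h1 := card_union_le (T.image Prod.fst) (T.image Prod.snd)
    have h2 := card_image_le (s := T) (f := Prod.fst)
    have h3 := card_image_le (s := T) (f := Prod.snd)
    have := h T hT.1 hT.2
    omega
  · intro a b hab
    by_contra hcon
    simp only [mem_union, mem_image, not_or, not_exists, not_and] at hcon
    have hfree : ∀ x ∈ T, x.1 ≠ a ∧ x.1 ≠ b ∧ x.2 ≠ a ∧ x.2 ≠ b := fun x hx =>
      ⟨hcon.1.1 x hx, hcon.2.1 x hx, hcon.1.2 x hx, hcon.2.2 x hx⟩
    have hnot : (a, b) ∉ T := fun h => (hfree _ h).1 rfl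
    have := hmax (insert (a, b) T) ⟨?_, ?_⟩
    · rw [card_insert_of_notMem hnot] at this
      omega
    · intro x hx y hy hxy
      rw [mem_insert] at hx hy
      rcases hx with rfl | hx <;> rcases hy with rfl | hy
      · exact absurd rfl hxy
      · have := hfree y hy
        exact ⟨this.1.symm, this.2.2.1.symm, this.2.1.symm, this.2.2.2.symm⟩
      · exact hfree x hx
      · exact hT.1 x hx y hy hxy
    · intro x hx
      rw [mem_insert] at hx
      rcases hx with rfl | hx
      · exact hab
      · exact hT.2 x hx

/-- If every vertex of every hyperedge in `A` points to another vertex of that hyperedge, and no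
vertex points to more than `m` vertices, then `A` has linearly many hyperedges. -/
theorem card_le_of_pointers (A : Finset (Finset V)) (hA : ∀ e ∈ A, e.card = 3) (X : V → Finset V)
    (m : ℕ) (hX : ∀ v, (X v).card ≤ m) (h : ∀ e ∈ A, ∀ v ∈ e, ∃ u ∈ e, u ≠ v ∧ u ∈ X v) :
    A.card ≤ Fintype.card V * (m * m) := by
  have hsub : A ⊆ univ.biUnion fun x => (X x).biUnion fun y =>
      (X y).image fun z => ({x, y, z} : Finset V) := by
    intro e he
    have hpath : ∃ x y z, x ∈ e ∧ y ∈ e ∧ z ∈ e ∧ x ≠ y ∧ x ≠ z ∧ y ≠ z ∧ y ∈ X x ∧ z ∈ X y := by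
      obtain ⟨v, hv⟩ : e.Nonempty := card_pos.1 (by rw [hA e he]; norm_num)
      obtain ⟨u, hu, huv, hu'⟩ := h e he v hv
      obtain ⟨w, hw, hwu, hw'⟩ := h e he u hu
      by_cases hwv : w = v
      · subst hwv
        obtain ⟨r, hr⟩ : (e \ {w, u}).Nonempty := card_pos.1 (by
          have := le_card_sdiff ({w, u} : Finset V) e
          have h2 := card_le_two (a := w) (b := u)
          have := hA e he
          omega)
        simp only [mem_sdiff, mem_insert, mem_singleton, not_or] at hr
        obtain ⟨hre, hrw, hru⟩ := hr
        obtain ⟨q, hq, hqr, hq'⟩ := h e he r hre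
        by_cases hqw : q = w
        · subst hqw
          exact ⟨r, q, u, hre, hq, hu, hqr.symm, hru, hwu, hq', hu'⟩
        · by_cases hqu : q = u
          · subst hqu
            exact ⟨r, q, w, hre, hq, hw, hqr.symm, hrw, huv, hq', hw'⟩
          · exfalso
            have hs : ({w, u, r, q} : Finset V) ⊆ e := by
              intro y hy
              simp only [mem_insert, mem_singleton] at hy
              rcases hy with rfl | rfl | rfl | rfl <;> assumption
            have hc := card_le_card hs
            rw [hA e he, card_insert_of_notMem, card_insert_of_notMem, card_pair hqr.symm] at hc
            · omega
            · simp [Ne.symm hru, Ne.symm hqu]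
            · simp [Ne.symm hrw, Ne.symm hqw, hwu]
      · exact ⟨v, u, w, hv, hu, hw, huv.symm, Ne.symm hwv, hwu.symm, hu', hw'⟩
    obtain ⟨x, y, z, hx, hy, hz, hxy, hxz, hyz, h1, h2⟩ := hpath
    simp only [mem_biUnion, mem_univ, true_and, mem_image]
    refine ⟨x, y, h1, z, h2, eq_of_subset_of_card_le ?_ ?_⟩
    · intro r hr
      simp only [mem_insert, mem_singleton] at hr
      rcases hr with rfl | rfl | rfl <;> assumption
    · rw [hA e he, card_eq_three.2 ⟨x, y, z, hxy, hxz, hyz, rfl⟩]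
  refine (card_le_card hsub).trans ?_
  rw [← card_univ]
  refine card_biUnion_le_card_mul _ _ _ fun x _ => ?_
  refine (card_biUnion_le_card_mul _ _ m fun y _ => card_image_le.trans (hX y)).trans ?_
  exact Nat.mul_le_mul_right _ (hX x)

end Covering

section Ample

variable {V : Type*} [DecidableEq V]

/-- All pairs of `e` have degree above `t`, all but one above `2 * t`, and some above `3 * t`. -/
def Ample (t : ℕ) (H : Finset (Finset V)) (e : Finset V) : Prop :=
  (∀ p ∈ e.powersetCard 2, t + 1 ≤ pairDegP H p) ∧
  (∀ p ∈ e.powersetCard 2, ∀ q ∈ e.powersetCard 2, p ≠ q →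
    2 * t + 1 ≤ pairDegP H p ∨ 2 * t + 1 ≤ pairDegP H q) ∧
  ∃ p ∈ e.powersetCard 2, 3 * t + 1 ≤ pairDegP H p

theorem exists_perm_of_thresholds {t x y z : ℕ} (hx : t + 1 ≤ x) (hy : t + 1 ≤ y) (hz : t + 1 ≤ z)
    (hxy : 2 * t + 1 ≤ x ∨ 2 * t + 1 ≤ y) (hxz : 2 * t + 1 ≤ x ∨ 2 * t + 1 ≤ z)
    (hyz : 2 * t + 1 ≤ y ∨ 2 * t + 1 ≤ z)
    (h : 3 * t + 1 ≤ x ∨ 3 * t + 1 ≤ y ∨ 3 * t + 1 ≤ z) :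
    ∃ σ : Equiv.Perm (Fin 3), ∀ j, t * ((σ j : ℕ) + 1) + 1 ≤ ![x, y, z] j := by
  have key : ∀ σ : Equiv.Perm (Fin 3), t * ((σ 0 : ℕ) + 1) + 1 ≤ x → t * ((σ 1 : ℕ) + 1) + 1 ≤ y →
      t * ((σ 2 : ℕ) + 1) + 1 ≤ z → ∀ j, t * ((σ j : ℕ) + 1) + 1 ≤ ![x, y, z] j := by
    intro σ h0 h1 h2 j
    fin_cases j
    · exact h0
    · exact h1
    · exact h2
  rcases h with h | h | h
  · rcases hyz with h' | h'
    · refine ⟨Equiv.swap 0 2, key _ ?_ ?_ ?_⟩ <;> simp [Equiv.swap_apply_def] <;> omega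
    · refine ⟨(finRotate 3)⁻¹, key _ ?_ ?_ ?_⟩
      · rw [show (((finRotate 3)⁻¹ : Equiv.Perm (Fin 3)) 0 : ℕ) = 2 by decide]; omega
      · rw [show (((finRotate 3)⁻¹ : Equiv.Perm (Fin 3)) 1 : ℕ) = 0 by decide]; omega
      · rw [show (((finRotate 3)⁻¹ : Equiv.Perm (Fin 3)) 2 : ℕ) = 1 by decide]; omega
  · rcases hxz with h' | h'
    · refine ⟨finRotate 3, key _ ?_ ?_ ?_⟩
      · rw [show (finRotate 3 0 : ℕ) = 1 by decide]; omega
      · rw [show (finRotate 3 1 : ℕ) = 2 by decide]; omega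
      · rw [show (finRotate 3 2 : ℕ) = 0 by decide]; omega
    · refine ⟨Equiv.swap 1 2, key _ ?_ ?_ ?_⟩ <;> simp [Equiv.swap_apply_def] <;> omega
  · rcases hxy with h' | h'
    · refine ⟨Equiv.swap 0 1, key _ ?_ ?_ ?_⟩ <;> simp [Equiv.swap_apply_def] <;> omega
    · refine ⟨1, key _ ?_ ?_ ?_⟩ <;> simp <;> omega

variable [Fintype V] {t : ℕ} {H : Finset (Finset V)}

theorem ample_triple_iff (hH : ∀ e ∈ H, e.card = 3) {a b c : V} (hab : a ≠ b) (hac : a ≠ c)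
    (hbc : b ≠ c) : Ample t H {a, b, c} ↔
      (t + 1 ≤ (nbr H a b).card ∧ t + 1 ≤ (nbr H a c).card ∧ t + 1 ≤ (nbr H b c).card) ∧
      ((2 * t + 1 ≤ (nbr H a b).card ∨ 2 * t + 1 ≤ (nbr H a c).card) ∧
        (2 * t + 1 ≤ (nbr H a b).card ∨ 2 * t + 1 ≤ (nbr H b c).card) ∧
        (2 * t + 1 ≤ (nbr H a c).card ∨ 2 * t + 1 ≤ (nbr H b c).card)) ∧
      (3 * t + 1 ≤ (nbr H a b).card ∨ 3 * t + 1 ≤ (nbr H a c).card ∨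
        3 * t + 1 ≤ (nbr H b c).card) := by
  have h1 : ({a, b} : Finset V) ≠ {a, c} := by
    intro h
    have : b ∈ ({a, c} : Finset V) := h ▸ (by simp)
    simp at this; tauto
  have h2 : ({a, b} : Finset V) ≠ {b, c} := by
    intro h
    have : a ∈ ({b, c} : Finset V) := h ▸ (by simp)
    simp at this; tauto
  have h3 : ({a, c} : Finset V) ≠ {b, c} := by
    intro h
    have : a ∈ ({b, c} : Finset V) := h ▸ (by simp)
    simp at this; tauto
  unfold Ample
  rw [powersetCard_two_triple hab hac hbc]
  simp only [mem_insert, mem_singleton, forall_eq_or_imp, forall_eq, exists_eq_or_imp,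
    exists_eq_left, pairDegP_pair hH hab, pairDegP_pair hH hac, pairDegP_pair hH hbc, ne_eq,
    not_true_eq_false, h1, h2, h3, h1.symm, h2.symm, h3.symm, not_false_eq_true, false_imp_iff,
    true_imp_iff, true_and, and_true]
  generalize (nbr H a b).card = x, (nbr H a c).card = y, (nbr H b c).card = z
  constructor <;> rintro ⟨h, h', h''⟩ <;> refine ⟨h, ?_, h''⟩ <;> clear h h'' <;> tauto

/-- Disjoint core pairs at `c` whose expansion vertices can be picked from sets of sizes
`t`, `2 * t`, `3 * t` form a fan. -/
theorem containsFanExp_of_ranked {ι : Type*} [Fintype ι] (hι : Fintype.card ι = t) (c : V)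
    (a b : ι → V) (X : Fin 3 × ι → Finset V) (σ : ι → Equiv.Perm (Fin 3))
    (ha : Function.Injective a) (hb : Function.Injective b) (hab : ∀ i j, a i ≠ b j)
    (hca : ∀ i, c ≠ a i) (hcb : ∀ i, c ≠ b i)
    (hX : ∀ x, t * ((σ x.2 x.1 : ℕ) + 1) ≤ (X x).card)
    (hXc : ∀ x, c ∉ X x) (hXa : ∀ x i, a i ∉ X x) (hXb : ∀ x i, b i ∉ X x)
    (h0 : ∀ i, X (0, i) ⊆ nbr H c (a i)) (h1 : ∀ i, X (1, i) ⊆ nbr H c (b i))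
    (h2 : ∀ i, X (2, i) ⊆ nbr H (a i) (b i)) : ContainsFanExp t H := by
  classical
  obtain ⟨p, hp, hpX⟩ := exists_injective_of_rank X (fun x => t * ((σ x.2 x.1 : ℕ) + 1)) hX (by
    intro x
    rcases Nat.eq_zero_or_pos t with rfl | ht
    · have : IsEmpty ι := Fintype.card_eq_zero_iff.1 hι
      exact isEmptyElim x.2
    have hsub : (univ.filter fun y : Fin 3 × ι => t * ((σ y.2 y.1 : ℕ) + 1) ≤
        t * ((σ x.2 x.1 : ℕ) + 1)) ⊆ univ.biUnion fun i : ι =>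
          (Iic (σ x.2 x.1)).image fun j => ((σ i).symm j, i) := by
      intro y hy
      simp only [mem_filter, mem_univ, true_and, Nat.mul_le_mul_left_iff ht] at hy
      simp only [mem_biUnion, mem_univ, true_and, mem_image, mem_Iic]
      refine ⟨y.2, σ y.2 y.1, ?_, by simp⟩
      rw [Fin.le_def]; omega
    refine (card_le_card hsub).trans ?_
    refine (card_biUnion_le_card_mul _ _ ((σ x.2 x.1 : ℕ) + 1) fun i _ => ?_).trans ?_
    · exact card_image_le.trans (by simp)
    · rw [card_univ, hι])
  exact containsFanExp_of_core hι c a b p ha hb hab hca hcb hp (fun x h => hXc x (h ▸ hpX x))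
    (fun x i h => hXa x i (h ▸ hpX x)) (fun x i h => hXb x i (h ▸ hpX x))
    (fun i => mem_nbr.1 (h0 i (hpX _))) (fun i => mem_nbr.1 (h1 i (hpX _)))
    (fun i => mem_nbr.1 (h2 i (hpX _)))

theorem card_lt_of_ample_matching (hH : ∀ e ∈ H, e.card = 3) (hF : ¬ ContainsFanExp t H) (c : V)
    (T : Finset (V × V)) (hT : PairsDisjoint T)
    (hA : ∀ x ∈ T, ({c, x.1, x.2} : Finset V) ∈ H ∧ Ample t H {c, x.1, x.2}) :
    T.card ≤ (2 * (6 * t) + 1) * t := by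
  classical
  by_contra hcard
  have hne : ∀ x ∈ T, c ≠ x.1 ∧ c ≠ x.2 ∧ x.1 ≠ x.2 := fun x hx =>
    ne_of_mem_nbr hH (mem_nbr.2 (hA x hx).1)
  have hσ : ∀ x ∈ T, ∃ σ : Equiv.Perm (Fin 3), ∃ Y : Fin 3 → Finset V,
      (∀ j, (Y j).card = t * ((σ j : ℕ) + 1)) ∧
      Y 0 ⊆ (nbr H c x.1).erase x.2 ∧ Y 1 ⊆ (nbr H c x.2).erase x.1 ∧
      Y 2 ⊆ (nbr H x.1 x.2).erase c := by
    intro x hx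
    obtain ⟨h1, h2, h3⟩ := hne x hx
    obtain ⟨⟨p1, p2, p3⟩, ⟨q1, q2, q3⟩, r⟩ := (ample_triple_iff hH h1 h2 h3).1 (hA x hx).2
    obtain ⟨σ, hσ⟩ := exists_perm_of_thresholds p1 p2 p3 q1 q2 q3 r
    have g0 := hσ 0
    have g1 := hσ 1
    have g2 := hσ 2
    simp only [Matrix.cons_val] at g0 g1 g2
    obtain ⟨Y0, hY0, k0⟩ := exists_subset_card_eq
      (show t * ((σ 0 : ℕ) + 1) ≤ ((nbr H c x.1).erase x.2).card by
        have := pred_card_le_card_erase (s := nbr H c x.1) (a := x.2); omega)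
    obtain ⟨Y1, hY1, k1⟩ := exists_subset_card_eq
      (show t * ((σ 1 : ℕ) + 1) ≤ ((nbr H c x.2).erase x.1).card by
        have := pred_card_le_card_erase (s := nbr H c x.2) (a := x.1); omega)
    obtain ⟨Y2, hY2, k2⟩ := exists_subset_card_eq
      (show t * ((σ 2 : ℕ) + 1) ≤ ((nbr H x.1 x.2).erase c).card by
        have := pred_card_le_card_erase (s := nbr H x.1 x.2) (a := c); omega)
    refine ⟨σ, ![Y0, Y1, Y2], ?_, hY0, hY1, hY2⟩
    intro j
    fin_cases j
    · exact k0
    · exact k1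
    · exact k2
  choose! σ Y hY hY0 hY1 hY2 using hσ
  let U : V × V → Finset V := fun x => univ.biUnion (Y x)
  have hU : ∀ x ∈ T, (U x).card ≤ 6 * t := by
    intro x hx
    have hsum : ∑ j, ((σ x j : ℕ) + 1) = 6 := by
      rw [Equiv.sum_comp (σ x) fun j : Fin 3 => (j : ℕ) + 1]
      decide
    calc (U x).card ≤ ∑ j, (Y x j).card := card_biUnion_le
      _ = ∑ j, t * ((σ x j : ℕ) + 1) := sum_congr rfl fun j _ => hY x hx j
      _ = 6 * t := by rw [← mul_sum, hsum, mul_comm]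
  obtain ⟨I, hIT, hI, hind⟩ := exists_independent
    (fun x y : V × V => y.1 ∈ U x ∨ y.2 ∈ U x) (6 * t) t T (by
      intro x hx
      refine le_trans ?_ (hU x hx)
      apply card_le_card_of_injOn (fun y => if y.1 ∈ U x then y.1 else y.2)
      · intro y hy
        simp only [coe_filter, Set.mem_ofPred_eq] at hy
        simp only [mem_coe]
        split_ifs with h
        · exact h
        · exact hy.2.resolve_left h
      · intro y hy z hz hyz
        simp only [coe_filter, Set.mem_ofPred_eq] at hy hz
        by_contra hne'
        have := hT y hy.1 z hz.1 hne'
        simp only at hyz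
        split_ifs at hyz <;> tauto) (by omega)
  have hself : ∀ x ∈ T, x.1 ∉ U x ∧ x.2 ∉ U x ∧ c ∉ U x := by
    intro x hx
    have mem_cases : ∀ v ∈ U x, (v ∈ nbr H c x.1 ∧ v ≠ x.2) ∨ (v ∈ nbr H c x.2 ∧ v ≠ x.1) ∨
        (v ∈ nbr H x.1 x.2 ∧ v ≠ c) := by
      intro v hv
      simp only [U, mem_biUnion, mem_univ, true_and] at hv
      obtain ⟨j, hj⟩ := hv
      fin_cases j
      · have := mem_erase.1 (hY0 x hx hj); tauto
      · have := mem_erase.1 (hY1 x hx hj); tauto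
      · have := mem_erase.1 (hY2 x hx hj); tauto
    refine ⟨?_, ?_, ?_⟩ <;> intro hv <;> rcases mem_cases _ hv with h | h | h <;>
      have := ne_of_mem_nbr hH h.1 <;> tauto
  have hcore : ∀ x ∈ I, ∀ y ∈ I, y.1 ∉ U x ∧ y.2 ∉ U x := by
    intro x hx y hy
    by_cases hxy : x = y
    · subst hxy
      exact ⟨(hself x (hIT hx)).1, (hself x (hIT hx)).2.1⟩
    · exact not_or.1 (hind x hx y hy hxy)
  have hsubU : ∀ x j, Y x j ⊆ U x := fun x j => subset_biUnion_of_mem (Y x) (mem_univ j)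
  refine hF (containsFanExp_of_ranked (ι := I) (by simpa using hI) c (fun i => i.1.1)
    (fun i => i.1.2) (fun x => Y x.2 x.1) (fun i => σ i) ?_ ?_ ?_ ?_ ?_ ?_ ?_ ?_ ?_ ?_ ?_ ?_)
  · intro i j hij
    by_contra hne'
    exact (hT i (hIT i.2) j (hIT j.2) (fun h => hne' (Subtype.ext h))).1 hij
  · intro i j hij
    by_contra hne'
    exact (hT i (hIT i.2) j (hIT j.2) (fun h => hne' (Subtype.ext h))).2.2.2 hij
  · intro i j
    by_cases hij : i = j
    · subst hij
      exact (hne i (hIT i.2)).2.2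
    · exact (hT i (hIT i.2) j (hIT j.2) (fun h => hij (Subtype.ext h))).2.1
  · exact fun i => (hne i (hIT i.2)).1
  · exact fun i => (hne i (hIT i.2)).2.1
  · exact fun x => (hY x.2 (hIT x.2.2) x.1).ge
  · exact fun x h => (hself x.2 (hIT x.2.2)).2.2 (hsubU _ _ h)
  · exact fun x i h => (hcore x.2 x.2.2 i i.2).1 (hsubU _ _ h)
  · exact fun x i h => (hcore x.2 x.2.2 i i.2).2 (hsubU _ _ h)
  · exact fun i => (hY0 i (hIT i.2)).trans (erase_subset _ _)
  · exact fun i => (hY1 i (hIT i.2)).trans (erase_subset _ _)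
  · exact fun i => (hY2 i (hIT i.2)).trans (erase_subset _ _)

open Classical in
/-- A fan-free `3`-graph has linearly many ample hyperedges. -/
theorem card_ample_le (hH : ∀ e ∈ H, e.card = 3) (hF : ¬ ContainsFanExp t H) :
    (H.filter (Ample t H)).card ≤ Fintype.card V *
      ((2 * ((2 * (6 * t) + 1) * t)) * (2 * ((2 * (6 * t) + 1) * t))) := by
  choose X hX hcov using fun c : V => exists_cover
    (fun a b => ({c, a, b} : Finset V) ∈ H ∧ Ample t H {c, a, b}) ((2 * (6 * t) + 1) * t)
    (fun T hT hA => card_lt_of_ample_matching hH hF c T hT hA)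
  refine card_le_of_pointers _ (fun e he => hH e (mem_filter.1 he).1) X _ hX ?_
  intro e he v hv
  obtain ⟨he, hA⟩ := mem_filter.1 he
  obtain ⟨a, b, hva, hvb, hab, rfl⟩ := exists_triple_of_mem hH he hv
  rcases hcov v a b ⟨he, hA⟩ with h | h
  · exact ⟨a, by simp, hva.symm, h⟩
  · exact ⟨b, by simp, hvb.symm, h⟩

end Ample

section Tight

variable {V : Type*} [DecidableEq V] [Fintype V]

/-- A degree above which pairs count as heavy. -/
def heavyDeg (t : ℕ) : ℕ := 4 * t * t + 10 * t

/-- The hyperedge `{c, a, b}` has two pairs of degree exactly `2 * t` at `c`, and `{a, b}` is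
heavy. -/
def Tight (t : ℕ) (H : Finset (Finset V)) (c a b : V) : Prop :=
  ({c, a, b} : Finset V) ∈ H ∧ (nbr H c a).card = 2 * t ∧ (nbr H c b).card = 2 * t ∧
    heavyDeg t ≤ (nbr H a b).card

open Classical in
/-- The vertices `a` such that some `{c, a, b}` is tight at `c`. -/
noncomputable def arms (t : ℕ) (H : Finset (Finset V)) (c : V) : Finset V :=
  univ.filter fun a => ∃ b, Tight t H c a b

/-- Distinct pairs in `T` are disjoint and not joined in the link of `c`. -/
def Scattered (H : Finset (Finset V)) (c : V) (T : Finset (V × V)) : Prop :=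
  ∀ x ∈ T, ∀ y ∈ T, x ≠ y →
    y.1 ∉ nbr H c x.1 ∧ y.1 ∉ nbr H c x.2 ∧ y.2 ∉ nbr H c x.1 ∧ y.2 ∉ nbr H c x.2

variable {t : ℕ} {H : Finset (Finset V)} {a b c a' b' : V} {T : Finset (V × V)}

theorem mem_arms : a ∈ arms t H c ↔ ∃ b, Tight t H c a b := by
  simp [arms]

theorem Tight.swap (h : Tight t H c a b) : Tight t H c b a :=
  ⟨by rw [Finset.pair_comm]; exact h.1, h.2.2.1, h.2.1, by rw [nbr_comm]; exact h.2.2.2⟩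

theorem Tight.mem_left (h : Tight t H c a b) : b ∈ nbr H c a := mem_nbr.2 h.1

theorem Tight.mem_right (h : Tight t H c a b) : a ∈ nbr H c b := h.swap.mem_left

theorem Scattered.subset {T' : Finset (V × V)} (h : Scattered H c T) (hT : T' ⊆ T) :
    Scattered H c T' :=
  fun x hx y hy => h x (hT hx) y (hT hy)

theorem Scattered.insert (h : Scattered H c T)
    (hab : ∀ y ∈ T, y.1 ∉ nbr H c a ∧ y.1 ∉ nbr H c b ∧ y.2 ∉ nbr H c a ∧ y.2 ∉ nbr H c b) :
    Scattered H c (insert (a, b) T) := by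
  intro x hx y hy hxy
  rw [mem_insert] at hx hy
  rcases hx with rfl | hx <;> rcases hy with rfl | hy
  · exact absurd rfl hxy
  · exact hab y hy
  · have := hab x hx
    rw [mem_nbr_swap, mem_nbr_swap (b := b), mem_nbr_swap (x := x.2),
      mem_nbr_swap (b := b) (x := x.2)] at this
    tauto
  · exact h x hx y hy hxy

theorem Scattered.pairsDisjoint (h : Scattered H c T) (hT : ∀ x ∈ T, Tight t H c x.1 x.2) :
    PairsDisjoint T := by
  intro x hx y hy hxy
  have h1 := (hT x hx).mem_left
  have h2 := (hT x hx).mem_right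
  have := h x hx y hy hxy
  refine ⟨?_, ?_, ?_, ?_⟩ <;> intro he <;> rw [he] at h1 h2 <;> tauto

theorem Scattered.fst_injective (h : Scattered H c T) (hT : ∀ x ∈ T, Tight t H c x.1 x.2) :
    Function.Injective fun i : T => i.1.1 := by
  intro i j hij
  by_contra hne
  exact (h.pairsDisjoint hT i i.2 j j.2 fun h => hne (Subtype.ext h)).1 hij

theorem Scattered.snd_injective (h : Scattered H c T) (hT : ∀ x ∈ T, Tight t H c x.1 x.2) :
    Function.Injective fun i : T => i.1.2 := by
  intro i j hij
  by_contra hne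
  exact (h.pairsDisjoint hT i i.2 j j.2 fun h => hne (Subtype.ext h)).2.2.2 hij

theorem Scattered.fst_ne_snd (hH : ∀ e ∈ H, e.card = 3) (h : Scattered H c T)
    (hT : ∀ x ∈ T, Tight t H c x.1 x.2) (i j : T) : i.1.1 ≠ j.1.2 := by
  by_cases hij : i = j
  · subst hij
    exact (ne_of_mem_nbr hH (hT i i.2).mem_left).2.2
  · exact (h.pairsDisjoint hT i i.2 j j.2 fun h => hij (Subtype.ext h)).2.1

theorem Scattered.notMem_erase (hH : ∀ e ∈ H, e.card = 3) (h : Scattered H c T) {x y : V × V} (hx : x ∈ T) (hy : y ∈ T) :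
    y.1 ∉ (nbr H c x.1).erase x.2 ∧ y.1 ∉ (nbr H c x.2).erase x.1 ∧
      y.2 ∉ (nbr H c x.1).erase x.2 ∧ y.2 ∉ (nbr H c x.2).erase x.1 := by
  by_cases hxy : x = y
  · subst hxy
    simp only [mem_erase, not_and]
    refine ⟨fun _ h => (ne_of_mem_nbr hH h).2.2 rfl, fun h => absurd rfl h, fun h => absurd rfl h,
      fun _ h => (ne_of_mem_nbr hH h).2.2 rfl⟩
  · have := h x hx y hy hxy
    simp only [mem_erase, not_and]
    tauto

/-- If `t` scattered tight hyperedges at `c` do not extend to a fan, then the links at `c` of all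
their other vertices agree. -/
theorem exists_common_link_of_card_eq (hH : ∀ e ∈ H, e.card = 3) (hF : ¬ ContainsFanExp t H)
    (hT : ∀ x ∈ T, Tight t H c x.1 x.2) (hS : Scattered H c T) (hc : T.card = t) :
    ∃ Z, ∀ x ∈ T, (nbr H c x.1).erase x.2 = Z ∧ (nbr H c x.2).erase x.1 = Z := by
  classical
  by_contra hZ
  let core : Finset V := insert c (T.image Prod.fst ∪ T.image Prod.snd)
  have hcore : core.card ≤ 2 * t + 1 := by
    have h1 : core.card ≤ _ := card_insert_le c (T.image Prod.fst ∪ T.image Prod.snd)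
    have h2 := card_union_le (T.image Prod.fst) (T.image Prod.snd)
    have h3 := card_image_le (s := T) (f := Prod.fst)
    have h4 := card_image_le (s := T) (f := Prod.snd)
    omega
  let X : Fin 3 × T → Finset V := fun y => ![(nbr H c y.2.1.1).erase y.2.1.2,
    (nbr H c y.2.1.2).erase y.2.1.1, nbr H y.2.1.1 y.2.1.2 \ core] y.1
  have hX01 : ∀ y, y.1 ≠ 2 → (X y).card = 2 * t - 1 := by
    rintro ⟨j, i⟩ hj
    have h := hT i i.2
    fin_cases j
    · change ((nbr H c i.1.1).erase i.1.2).card = _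
      rw [card_erase_of_mem h.mem_left, h.2.1]
    · change ((nbr H c i.1.2).erase i.1.1).card = _
      rw [card_erase_of_mem h.mem_right, h.2.2.1]
    · exact absurd rfl hj
  have hX2 : ∀ i, 3 * t ≤ (X (2, i)).card := by
    intro i
    have h : heavyDeg t ≤ _ := (hT i i.2).2.2.2
    have hK : 5 * t + 1 ≤ heavyDeg t := by
      have : 0 < t := hc ▸ card_pos.2 ⟨i, i.2⟩
      unfold heavyDeg
      nlinarith
    have := le_card_sdiff core (nbr H i.1.1 i.1.2)
    change 3 * t ≤ (nbr H i.1.1 i.1.2 \ core).card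
    omega
  have hall : ∀ s : Finset (Fin 3 × T), s.card ≤ (s.biUnion X).card := by
    intro s
    by_cases h2 : ∃ i, (2, i) ∈ s
    · obtain ⟨i, hi⟩ := h2
      calc s.card ≤ Fintype.card (Fin 3 × T) := card_le_univ s
        _ = 3 * t := by simp [hc]
        _ ≤ (X (2, i)).card := hX2 i
        _ ≤ _ := card_le_card (subset_biUnion_of_mem X hi)
    have hs2 : ∀ y ∈ s, y.1 ≠ 2 := fun y hy h => h2 ⟨y.2, by rw [← h]; exact hy⟩
    have hs : s ⊆ ({0, 1} : Finset (Fin 3)) ×ˢ (univ : Finset T) := by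
      intro y hy
      have := hs2 y hy
      simp only [mem_product, mem_insert, mem_singleton, mem_univ, and_true]
      omega
    have hsc : (({0, 1} : Finset (Fin 3)) ×ˢ (univ : Finset T)).card = 2 * t := by
      rw [card_product]; simp [hc]
    rcases s.eq_empty_or_nonempty with rfl | ⟨y, hy⟩
    · simp
    by_contra hlt
    have hle := card_le_card hs
    have hy1 : 2 * t - 1 ≤ (s.biUnion X).card :=
      (hX01 y (hs2 y hy)).symm.le.trans (card_le_card (subset_biUnion_of_mem X hy))
    have hseq : s = ({0, 1} : Finset (Fin 3)) ×ˢ (univ : Finset T) :=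
      eq_of_subset_of_card_le hs (by omega)
    have hall' : ∀ z ∈ s, X z = s.biUnion X := fun z hz =>
      eq_of_subset_of_card_le (subset_biUnion_of_mem X hz) (by rw [hX01 z (hs2 z hz)]; omega)
    exact hZ ⟨s.biUnion X, fun x hx => ⟨hall' (0, ⟨x, hx⟩) (by simp [hseq]),
      hall' (1, ⟨x, hx⟩) (by simp [hseq])⟩⟩
  obtain ⟨p, hp, hpX⟩ := (Finset.all_card_le_biUnion_card_iff_exists_injective X).1 hall
  have hp0 : ∀ i, p (0, i) ∈ (nbr H c i.1.1).erase i.1.2 := fun i => hpX (0, i)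
  have hp1 : ∀ i, p (1, i) ∈ (nbr H c i.1.2).erase i.1.1 := fun i => hpX (1, i)
  have hp2 : ∀ i, p (2, i) ∈ nbr H i.1.1 i.1.2 \ core := fun i => hpX (2, i)
  have hpcore : ∀ y, p y ∉ core := by
    rintro ⟨j, i⟩ h
    have key : ∀ x, (x ∈ (nbr H c i.1.1).erase i.1.2 ∨ x ∈ (nbr H c i.1.2).erase i.1.1) →
        x ∉ core := by
      intro x hx hcx
      simp only [core, mem_insert, mem_union, mem_image] at hcx
      rcases hcx with rfl | ⟨y, hy, rfl⟩ | ⟨y, hy, rfl⟩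
      · rcases hx with hx | hx <;> exact (ne_of_mem_nbr hH (mem_of_mem_erase hx)).2.1 rfl
      · have := hS.notMem_erase hH i.2 hy
        tauto
      · have := hS.notMem_erase hH i.2 hy
        tauto
    fin_cases j
    · exact key _ (Or.inl (hp0 i)) h
    · exact key _ (Or.inr (hp1 i)) h
    · exact (mem_sdiff.1 (hp2 i)).2 h
  have hne := fun i : T => ne_of_mem_nbr hH (hT i i.2).mem_left
  refine hF (containsFanExp_of_core (ι := T) (by simpa using hc) c (fun i => i.1.1)
    (fun i => i.1.2) p (hS.fst_injective hT) (hS.snd_injective hT) (hS.fst_ne_snd hH hT)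
    (fun i => (hne i).1) (fun i => (hne i).2.1) hp ?_ ?_ ?_
    (fun i => mem_nbr.1 (mem_of_mem_erase (hp0 i)))
    (fun i => mem_nbr.1 (mem_of_mem_erase (hp1 i)))
    (fun i => mem_nbr.1 (mem_sdiff.1 (hp2 i)).1))
  · exact fun x h => hpcore x (by rw [h]; exact mem_insert_self _ _)
  · exact fun x i h => hpcore x (by
      rw [h]; exact mem_insert_of_mem (mem_union_left _ (mem_image_of_mem _ i.2)))
  · exact fun x i h => hpcore x (by
      rw [h]; exact mem_insert_of_mem (mem_union_right _ (mem_image_of_mem _ i.2)))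

theorem exists_common_link (ht : 1 < t) (hH : ∀ e ∈ H, e.card = 3) (hF : ¬ ContainsFanExp t H)
    (hT : ∀ x ∈ T, Tight t H c x.1 x.2) (hS : Scattered H c T) (hc : t ≤ T.card) :
    ∃ Z, ∀ x ∈ T, (nbr H c x.1).erase x.2 = Z ∧ (nbr H c x.2).erase x.1 = Z := by
  obtain ⟨x, hx⟩ : T.Nonempty := card_pos.1 (by omega)
  refine ⟨(nbr H c x.1).erase x.2, fun y hy => ?_⟩
  obtain ⟨T', hsub, hT', hc'⟩ := exists_subsuperset_card_eq
    (show {x, y} ⊆ T by intro z; simp only [mem_insert, mem_singleton]; rintro (rfl | rfl) <;> assumption)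
    (card_le_two.trans ht) hc
  obtain ⟨Z, hZ⟩ := exists_common_link_of_card_eq hH hF (fun z hz => hT z (hT' hz))
    (hS.subset hT') hc'
  rw [(hZ x (hsub (by simp))).1]
  exact hZ y (hsub (by simp))

open Classical in
/-- The vertices joined to `F` by arms at `c`. -/
noncomputable def reach (t : ℕ) (H : Finset (Finset V)) (c : V) (F : Finset V) : Finset V :=
  F.biUnion fun x => if (nbr H c x).card = 2 * t then nbr H c x else ∅

theorem card_reach_le (F : Finset V) : (reach t H c F).card ≤ F.card * (2 * t) := by
  refine card_biUnion_le_card_mul _ _ _ fun x _ => ?_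
  split_ifs with h
  · exact h.le
  · simp

theorem Tight.mem_reach (h : Tight t H c a b) {F : Finset V} (hb : b ∈ F) : a ∈ reach t H c F := by
  simp only [reach, mem_biUnion]
  exact ⟨b, hb, by rw [if_pos h.2.2.1]; exact h.mem_right⟩

theorem exists_tight_avoiding (F : Finset V) (h : (2 * t + 1) * F.card < (arms t H c).card) :
    ∃ a b, Tight t H c a b ∧ a ∉ F ∧ b ∉ F := by
  classical
  by_contra! hcon
  have hsub : arms t H c ⊆ F ∪ reach t H c F := by
    intro a ha
    obtain ⟨b, hb⟩ := mem_arms.1 ha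
    by_cases haF : a ∈ F
    · exact mem_union_left _ haF
    · exact mem_union_right _ (hb.mem_reach (hcon a b hb haF))
  have h1 := card_le_card hsub
  have h2 := card_union_le F (reach t H c F)
  have h3 := card_reach_le (t := t) (H := H) (c := c) F
  nlinarith

theorem exists_scattered (m : ℕ) (F : Finset V)
    (h : (2 * t + 1) * (F.card + 4 * t * m) < (arms t H c).card) :
    ∃ T : Finset (V × V), T.card = m ∧ Scattered H c T ∧ (∀ x ∈ T, Tight t H c x.1 x.2) ∧
      ∀ x ∈ T, x.1 ∉ F ∧ x.2 ∉ F := by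
  induction m generalizing F with
  | zero => exact ⟨∅, by simp [Scattered]⟩
  | succ m ih =>
    obtain ⟨a, b, hab, ha, hb⟩ := exists_tight_avoiding (t := t) (H := H) (c := c) F
      (lt_of_le_of_lt (Nat.mul_le_mul_left _ (Nat.le_add_right _ _)) h)
    have hcard : (F ∪ (nbr H c a ∪ nbr H c b)).card ≤ F.card + 4 * t := by
      have h1 := card_union_le F (nbr H c a ∪ nbr H c b)
      have h2 := card_union_le (nbr H c a) (nbr H c b)
      rw [hab.2.1, hab.2.2.1] at h2
      omega
    obtain ⟨T, hT, hS, htight, hav⟩ := ih (F ∪ (nbr H c a ∪ nbr H c b)) (by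
      refine lt_of_le_of_lt (Nat.mul_le_mul_left _ ?_) h
      rw [mul_add]
      omega)
    simp only [mem_union, not_or] at hav
    have hnot : (a, b) ∉ T := fun h => (hav _ h).2.2.1 hab.mem_left
    refine ⟨insert (a, b) T, by rw [card_insert_of_notMem hnot, hT], hS.insert fun y hy => ?_, ?_,
      ?_⟩
    · have := hav y hy
      tauto
    · intro x hx
      rcases mem_insert.1 hx with rfl | hx
      · exact hab
      · exact htight x hx
    · intro x hx
      rcases mem_insert.1 hx with rfl | hx
      · exact ⟨ha, hb⟩
      · exact ⟨(hav x hx).1.1, (hav x hx).2.1⟩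

/-- A triangle `c, a, a'` with expansion vertices `x, y, w` completes scattered tight hyperedges
at `c` with common link `Z` to a fan, if `Z` contains at most one of `x, y, w`. -/
theorem containsFanExp_of_common_link {Z : Finset V} {x y w : V} (ht : 1 < t)
    (hH : ∀ e ∈ H, e.card = 3) (hT : ∀ x ∈ T, Tight t H c x.1 x.2) (hS : Scattered H c T)
    (hTc : T.card = t - 1)
    (hZ : ∀ x ∈ T, (nbr H c x.1).erase x.2 = Z ∧ (nbr H c x.2).erase x.1 = Z)
    (hcard : 2 * t - 2 ≤ (Z \ {x, y, w}).card)
    (hx : x ∈ nbr H c a) (hy : y ∈ nbr H c a') (hw : w ∈ nbr H a a')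
    (hxy : x ≠ y) (hxw : x ≠ w) (hyw : y ≠ w) (hxa' : x ≠ a') (hya : y ≠ a) (hwc : w ≠ c)
    (haZ : a ∉ Z) (haZ' : a' ∉ Z)
    (hav : ∀ v ∈ ({a, a', x, y, w} : Finset V), ∀ z ∈ T, v ≠ z.1 ∧ v ≠ z.2) :
    ContainsFanExp t H := by
  classical
  have hav' : ∀ z ∈ T, (a ≠ z.1 ∧ a ≠ z.2) ∧ (a' ≠ z.1 ∧ a' ≠ z.2) ∧ (x ≠ z.1 ∧ x ≠ z.2) ∧
      (y ≠ z.1 ∧ y ≠ z.2) ∧ (w ≠ z.1 ∧ w ≠ z.2) := by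
    intro z hz
    exact ⟨hav a (by simp) z hz, hav a' (by simp) z hz, hav x (by simp) z hz,
      hav y (by simp) z hz, hav w (by simp) z hz⟩
  have hnx := ne_of_mem_nbr hH hx
  have hny := ne_of_mem_nbr hH hy
  have hnw := ne_of_mem_nbr hH hw
  have hne := fun i : T => ne_of_mem_nbr hH (hT i i.2).mem_left
  let core : Finset V := T.image Prod.fst ∪ T.image Prod.snd ∪ {c, a, a', x, y, w}
  have hcore : core.card ≤ 2 * t + 4 := by
    have h1 : core.card ≤ _ :=
      card_union_le (T.image Prod.fst ∪ T.image Prod.snd) {c, a, a', x, y, w}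
    have h2 := card_union_le (T.image Prod.fst) (T.image Prod.snd)
    have h3 := card_image_le (s := T) (f := Prod.fst)
    have h4 := card_image_le (s := T) (f := Prod.snd)
    have h5 := card_le_six (a := c) (b := a) (c := a') (d := x) (e := y) (f := w)
    omega
  let X : Fin 3 × T → Finset V := fun y' =>
    if y'.1 = 2 then nbr H y'.2.1.1 y'.2.1.2 \ core else Z \ {x, y, w}
  obtain ⟨q, hq, hqX⟩ := exists_injective_of_rank X
    (fun y' => if y'.1 = 2 then 3 * t else 2 * t - 2) (by
      rintro ⟨j, i⟩
      by_cases hj : j = 2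
      · have h := (hT i i.2).2.2.2
        have hK : 5 * t + 4 ≤ heavyDeg t := by
          unfold heavyDeg
          nlinarith
        have := le_card_sdiff core (nbr H i.1.1 i.1.2)
        simp only [X, hj, if_true]
        omega
      · simpa only [X, hj, if_false] using hcard) (by
      rintro ⟨j, i⟩
      by_cases hj : j = 2
      · simp only [hj, if_true]
        refine (card_le_univ _).trans ?_
        simp [hTc]
      · simp only [hj, if_false]
        have hsub : (univ.filter fun y' : Fin 3 × T =>
            (if y'.1 = 2 then 3 * t else 2 * t - 2) ≤ 2 * t - 2) ⊆
            ({0, 1} : Finset (Fin 3)) ×ˢ (univ : Finset T) := by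
          rintro ⟨k, i'⟩ h
          simp only [mem_filter, mem_univ, true_and] at h
          simp only [mem_product, mem_insert, mem_singleton, mem_univ, and_true]
          split_ifs at h with hk
          · omega
          · omega
        refine (card_le_card hsub).trans ?_
        rw [card_product]
        simp [hTc]
        omega)
  have hq0 : ∀ j i, j ≠ 2 → q (j, i) ∈ Z \ {x, y, w} := fun j i hj => by
    have := hqX (j, i)
    simpa only [X, hj, if_false] using this
  have hq2 : ∀ i : T, q (2, i) ∈ nbr H i.1.1 i.1.2 \ core := fun i => by
    have := hqX (2, i)
    simpa only [X, if_true] using this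
  have hqcore : ∀ z, q z ∉ core := by
    rintro ⟨j, i⟩ h
    by_cases hj : j = 2
    · subst hj
      exact (mem_sdiff.1 (hq2 i)).2 h
    · have hz := mem_sdiff.1 (hq0 j i hj)
      have hzZ := hz.1
      simp only [core, mem_union, mem_image] at h
      rcases h with (⟨z, hz', hzq⟩ | ⟨z, hz', hzq⟩) | h
      · rw [← hzq, ← (hZ z hz').1] at hzZ
        exact (hS.notMem_erase hH hz' hz').1 hzZ
      · rw [← hzq, ← (hZ z hz').1] at hzZ
        exact (hS.notMem_erase hH hz' hz').2.2.1 hzZ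
      · simp only [mem_insert, mem_singleton] at h
        have hz2 := hz.2
        simp only [mem_insert, mem_singleton] at hz2
        rcases h with h | h | h | h
        · rw [h, ← (hZ i i.2).1] at hzZ
          exact (ne_of_mem_nbr hH (mem_of_mem_erase hzZ)).2.1 rfl
        · exact haZ (h ▸ hzZ)
        · exact haZ' (h ▸ hzZ)
        · exact hz2 h
  have hq' : ∀ z, q z ≠ c ∧ q z ≠ a ∧ q z ≠ a' ∧ q z ≠ x ∧ q z ≠ y ∧ q z ≠ w := by
    intro z
    have := hqcore z
    simp only [core, mem_union, mem_insert, mem_singleton, not_or] at this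
    exact this.2
  have hqT : ∀ z, ∀ i : T, q z ≠ i.1.1 ∧ q z ≠ i.1.2 := by
    intro z i
    have := hqcore z
    simp only [core, mem_union, not_or] at this
    exact ⟨fun h => this.1.1 (h ▸ mem_image_of_mem _ i.2),
      fun h => this.1.2 (h ▸ mem_image_of_mem _ i.2)⟩
  let A : Option T → V := fun o => o.elim a fun i => i.1.1
  let B : Option T → V := fun o => o.elim a' fun i => i.1.2
  let p : Fin 3 × Option T → V := fun z => z.2.elim ((![x, y, w] : Fin 3 → V) z.1) fun i => q (z.1, i)
  have hdiag : ∀ j : Fin 3, (![x, y, w] : Fin 3 → V) j ≠ c ∧ (![x, y, w] : Fin 3 → V) j ≠ a ∧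
      (![x, y, w] : Fin 3 → V) j ≠ a' ∧ (∀ z, q z ≠ (![x, y, w] : Fin 3 → V) j) ∧
      ∀ i : T, (![x, y, w] : Fin 3 → V) j ≠ i.1.1 ∧ (![x, y, w] : Fin 3 → V) j ≠ i.1.2 := by
    intro j
    fin_cases j
    · exact ⟨hnx.2.1.symm, hnx.2.2.symm, hxa', fun z => (hq' z).2.2.2.1,
        fun i => (hav' i i.2).2.2.1⟩
    · exact ⟨hny.2.1.symm, hya, hny.2.2.symm, fun z => (hq' z).2.2.2.2.1,
        fun i => (hav' i i.2).2.2.2.1⟩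
    · exact ⟨hwc, hnw.2.1.symm, hnw.2.2.symm, fun z => (hq' z).2.2.2.2.2,
        fun i => (hav' i i.2).2.2.2.2⟩
  refine containsFanExp_of_core (ι := Option T) (by simp [hTc]; omega) c A B p
    ?_ ?_ ?_ ?_ ?_ ?_ ?_ ?_ ?_ ?_ ?_ ?_
  · rintro (_ | i) (_ | j) h
    · rfl
    · exact absurd h (hav' j j.2).1.1
    · exact absurd h.symm (hav' i i.2).1.1
    · exact congrArg some (hS.fst_injective hT h)
  · rintro (_ | i) (_ | j) h
    · rfl
    · exact absurd h (hav' j j.2).2.1.2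
    · exact absurd h.symm (hav' i i.2).2.1.2
    · exact congrArg some (hS.snd_injective hT h)
  · rintro (_ | i) (_ | j)
    · exact hnw.1
    · exact (hav' j j.2).1.2
    · exact (hav' i i.2).2.1.1.symm
    · exact hS.fst_ne_snd hH hT i j
  · rintro (_ | i)
    · exact hnx.1
    · exact (hne i).1
  · rintro (_ | i)
    · exact hny.1
    · exact (hne i).2.1
  · rintro ⟨j, _ | i⟩ ⟨j', _ | i'⟩ h
    · have hinj : Function.Injective (![x, y, w] : Fin 3 → V) := by
        intro k k' hk
        fin_cases k <;> fin_cases k' <;>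
          simp [hxy, hxw, hyw, hxy.symm, hxw.symm, hyw.symm] at hk ⊢
      have hj : j = j' := hinj h
      rw [hj]
    · exact absurd h.symm ((hdiag j).2.2.2.1 _)
    · exact absurd h ((hdiag j').2.2.2.1 _)
    · obtain ⟨h1, h2⟩ := Prod.mk.inj (hq h)
      have hj : j = j' := h1
      have hi : i = i' := h2
      rw [hj, hi]
  · rintro ⟨j, _ | i⟩
    · exact (hdiag j).1
    · exact (hq' _).1
  · rintro ⟨j, _ | i⟩ (_ | k)
    · exact (hdiag j).2.1
    · exact ((hdiag j).2.2.2.2 k).1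
    · exact (hq' _).2.1
    · exact (hqT _ k).1
  · rintro ⟨j, _ | i⟩ (_ | k)
    · exact (hdiag j).2.2.1
    · exact ((hdiag j).2.2.2.2 k).2
    · exact (hq' _).2.2.1
    · exact (hqT _ k).2
  · rintro (_ | i)
    · exact mem_nbr.1 hx
    · have := (mem_sdiff.1 (hq0 0 i (by decide))).1
      rw [← (hZ i i.2).1] at this
      exact mem_nbr.1 (mem_of_mem_erase this)
  · rintro (_ | i)
    · exact mem_nbr.1 hy
    · have := (mem_sdiff.1 (hq0 1 i (by decide))).1
      rw [← (hZ i i.2).2] at this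
      exact mem_nbr.1 (mem_of_mem_erase this)
  · rintro (_ | i)
    · exact mem_nbr.1 hw
    · exact mem_nbr.1 (mem_sdiff.1 (hq2 i)).1

end Tight

section Links

variable {V : Type*} [DecidableEq V] [Fintype V] {t : ℕ} {H : Finset (Finset V)} {a b c a' b' : V}

/-- If many arms leave `c`, the arms of far apart tight hyperedges at `c` form pairs of degree
zero. -/
theorem Tight.nbr_eq_empty (ht : 1 < t) (hH : ∀ e ∈ H, e.card = 3) (hF : ¬ ContainsFanExp t H)
    (h : Tight t H c a b) (h' : Tight t H c a' b')
    (hdis : a' ∉ nbr H c a ∧ a' ∉ nbr H c b ∧ b' ∉ nbr H c a ∧ b' ∉ nbr H c b)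
    (hc : (2 * t + 1) * (8 * t + 1 + 4 * t * t) < (arms t H c).card) : nbr H a a' = ∅ := by
  classical
  rw [eq_empty_iff_forall_notMem]
  intro w hw
  obtain ⟨F, hFa, hFb, hFa', hFb', hwF, hFc⟩ : ∃ F : Finset V, nbr H c a ⊆ F ∧ nbr H c b ⊆ F ∧
      nbr H c a' ⊆ F ∧ nbr H c b' ⊆ F ∧ w ∈ F ∧ F.card ≤ 8 * t + 1 := by
    refine ⟨insert w (nbr H c a ∪ nbr H c b ∪ (nbr H c a' ∪ nbr H c b')), ?_, ?_, ?_, ?_,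
      mem_insert_self _ _, ?_⟩
    iterate 4 exact fun x hx => by simp only [mem_insert, mem_union]; tauto
    have h1 := card_insert_le w (nbr H c a ∪ nbr H c b ∪ (nbr H c a' ∪ nbr H c b'))
    have h2 := card_union_le (nbr H c a ∪ nbr H c b) (nbr H c a' ∪ nbr H c b')
    have h3 := card_union_le (nbr H c a) (nbr H c b)
    have h4 := card_union_le (nbr H c a') (nbr H c b')
    rw [h.2.1, h.2.2.1] at h3
    rw [h'.2.1, h'.2.2.1] at h4
    omega
  obtain ⟨T, hTc, hS, hT, hav⟩ := exists_scattered (t := t) (H := H) (c := c) (t - 1) F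
    (lt_of_le_of_lt (Nat.mul_le_mul_left _ (add_le_add hFc
      (Nat.mul_le_mul_left _ (Nat.sub_le t 1)))) hc)
  have hS' : Scattered H c (insert (a, b) (insert (a', b') T)) := by
    refine (hS.insert fun y hy => ?_).insert fun y hy => ?_
    · exact ⟨fun e => (hav y hy).1 (hFa' e), fun e => (hav y hy).1 (hFb' e),
        fun e => (hav y hy).2 (hFa' e), fun e => (hav y hy).2 (hFb' e)⟩
    · rcases mem_insert.1 hy with rfl | hy
      · exact ⟨hdis.1, hdis.2.1, hdis.2.2⟩
      · exact ⟨fun e => (hav y hy).1 (hFa e), fun e => (hav y hy).1 (hFb e),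
          fun e => (hav y hy).2 (hFa e), fun e => (hav y hy).2 (hFb e)⟩
  have hT' : ∀ x ∈ insert (a, b) (insert (a', b') T), Tight t H c x.1 x.2 := by
    intro x hx
    rcases mem_insert.1 hx with rfl | hx
    · exact h
    rcases mem_insert.1 hx with rfl | hx
    · exact h'
    · exact hT x hx
  have hcard : t ≤ (insert (a, b) (insert (a', b') T)).card := by
    have hnot : (a', b') ∉ T := fun hm => (hav _ hm).2 (hFa' h'.mem_left)
    have := card_le_card (subset_insert (a, b) (insert (a', b') T))
    rw [card_insert_of_notMem hnot] at this
    omega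
  obtain ⟨Z, hZ⟩ := exists_common_link ht hH hF hT' hS' hcard
  have hab : (a, b) ∈ insert (a, b) (insert (a', b') T) := mem_insert_self _ _
  have hab' : (a', b') ∈ insert (a, b) (insert (a', b') T) := by simp
  have hZa := (hZ _ hab).1
  have hZa' := (hZ _ hab').1
  have hnot := hS'.notMem_erase hH hab hab
  have hnot' := hS'.notMem_erase hH hab' hab'
  simp only [hZ _ hab] at hnot
  simp only [hZ _ hab'] at hnot'
  have haZ := hnot.1
  have hbZ := hnot.2.2.1
  have haZ' := hnot'.1
  have hbZ' := hnot'.2.2.1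
  have hZc : Z.card = 2 * t - 1 := by
    rw [← hZa]
    dsimp only
    rw [card_erase_of_mem h.mem_left, h.2.1]
  have hZT : ∀ z ∈ T, (nbr H c z.1).erase z.2 = Z ∧ (nbr H c z.2).erase z.1 = Z :=
    fun z hz => hZ z (mem_insert_of_mem (mem_insert_of_mem hz))
  have hbb' : b ≠ b' := fun e => hdis.2.2.1 (e ▸ h.mem_left)
  have hba' : b ≠ a' := fun e => hdis.1 (e ▸ h.mem_left)
  have hb'a : b' ≠ a := fun e => hdis.2.2.2 (e ▸ h.mem_right)
  have hwc : w ≠ c := fun e => hdis.1 (mem_nbr_rotate.1 (mem_nbr_rotate.1 (e ▸ hw)))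
  have hcs : ∀ v x y w : V, (x ∈ Z → x = v) → (y ∈ Z → y = v) → (w ∈ Z → w = v) →
      2 * t - 2 ≤ (Z \ {x, y, w}).card := by
    intro v x y w hx hy hw
    have hsub : Z.erase v ⊆ Z \ {x, y, w} := by
      intro u hu
      have hu' := mem_erase.1 hu
      simp only [mem_sdiff, mem_insert, mem_singleton, not_or]
      refine ⟨hu'.2, ?_, ?_, ?_⟩ <;> rintro rfl <;> tauto
    have h1 := card_le_card hsub
    have h2 := pred_card_le_card_erase (s := Z) (a := v)
    omega
  have havoid : ∀ v ∈ F, ∀ z ∈ T, v ≠ z.1 ∧ v ≠ z.2 := fun v hv z hz =>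
    ⟨fun e => (hav z hz).1 (e ▸ hv), fun e => (hav z hz).2 (e ▸ hv)⟩
  have haF := hFb h.mem_right
  have hbF := hFa h.mem_left
  have haF' := hFb' h'.mem_right
  have hbF' := hFa' h'.mem_left
  obtain ⟨z, hz⟩ : Z.Nonempty := card_pos.1 (by omega)
  have hza : z ∈ nbr H c a := mem_of_mem_erase (hZa ▸ hz)
  have hza' : z ∈ nbr H c a' := mem_of_mem_erase (hZa' ▸ hz)
  have hzF := hFa hza
  have hzne : ∀ v, v ∉ Z → z ≠ v := fun v hv e => hv (e ▸ hz)
  have hall : ∀ x ∈ F, ∀ y ∈ F, ∀ v ∈ ({a, a', x, y, w} : Finset V), ∀ z ∈ T,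
      v ≠ z.1 ∧ v ≠ z.2 := by
    intro x hx y hy v hv
    simp only [mem_insert, mem_singleton] at hv
    exact havoid v (by rcases hv with rfl | rfl | rfl | rfl | rfl <;> assumption)
  by_cases hwb : w = b
  · exact hF (containsFanExp_of_common_link ht hH hT hS hTc hZT
      (hcs z z b' w (fun _ => rfl) (fun h => absurd h hbZ') (fun h => absurd (hwb ▸ h) hbZ))
      hza h'.mem_left hw (hzne _ hbZ') (hwb ▸ hzne _ hbZ) (hwb ▸ hbb'.symm) (hzne _ haZ') hb'a
      hwc haZ haZ' (hall z hzF b' hbF'))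
  by_cases hwb' : w = b'
  · exact hF (containsFanExp_of_common_link ht hH hT hS hTc hZT
      (hcs z b z w (fun h => absurd h hbZ) (fun _ => rfl) (fun h => absurd (hwb' ▸ h) hbZ'))
      h.mem_left hza' hw (hzne _ hbZ).symm (Ne.symm hwb) (hwb' ▸ hzne _ hbZ') hba' (hzne _ haZ)
      hwc haZ haZ' (hall b hbF z hzF))
  · exact hF (containsFanExp_of_common_link ht hH hT hS hTc hZT
      (hcs w b b' w (fun h => absurd h hbZ) (fun h => absurd h hbZ') (fun _ => rfl))
      h.mem_left h'.mem_left hw hbb' (Ne.symm hwb) (Ne.symm hwb') hba' hb'a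
      hwc haZ haZ' (hall b hbF b' hbF'))

theorem card_arms_le (ht : 1 < t) (hH : ∀ e ∈ H, e.card = 3) (hF : ¬ ContainsFanExp t H)
    (ha : a ∈ arms t H c) (hc : (2 * t + 1) * (8 * t + 1 + 4 * t * t) < (arms t H c).card) :
    (arms t H c).card ≤
      (univ.filter fun a' => a ≠ a' ∧ nbr H a a' = ∅).card + 4 * t * (2 * t + 1) := by
  obtain ⟨b, h⟩ := mem_arms.1 ha
  let M := nbr H c a ∪ nbr H c b
  have hM : M.card ≤ 4 * t := by
    have := card_union_le (nbr H c a) (nbr H c b)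
    rw [h.2.1, h.2.2.1] at this
    change (nbr H c a ∪ nbr H c b).card ≤ _
    omega
  have hsub : arms t H c ⊆ (univ.filter fun a' => a ≠ a' ∧ nbr H a a' = ∅) ∪
      (M ∪ reach t H c M) := by
    intro a' ha'
    obtain ⟨b', h'⟩ := mem_arms.1 ha'
    by_cases haM : a' ∈ M
    · exact mem_union_right _ (mem_union_left _ haM)
    by_cases hbM : b' ∈ M
    · exact mem_union_right _ (mem_union_right _ (h'.mem_reach hbM))
    refine mem_union_left _ (mem_filter.2 ⟨mem_univ _, ?_, ?_⟩)
    · rintro rfl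
      exact haM (mem_union_right _ h.mem_right)
    · simp only [M, mem_union, not_or] at haM hbM
      exact h.nbr_eq_empty ht hH hF h' ⟨haM.1, haM.2, hbM⟩ hc
  have h1 := card_le_card hsub
  have h2 := card_union_le (univ.filter fun a' => a ≠ a' ∧ nbr H a a' = ∅) (M ∪ reach t H c M)
  have h3 := card_union_le M (reach t H c M)
  have h4 := card_reach_le (t := t) (H := H) (c := c) M
  nlinarith

/-- The sum of the inverse degrees of the pairs of `e`. -/
def weight (H : Finset (Finset V)) (e : Finset V) : ℚ :=
  ∑ p ∈ e.powersetCard 2, (pairDegP H p : ℚ)⁻¹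

/-- The weight of `e` exceeds `1 / t` by a constant. -/
def Rich (t : ℕ) (H : Finset (Finset V)) (e : Finset V) : Prop :=
  (t : ℚ)⁻¹ + (heavyDeg t : ℚ)⁻¹ ≤ weight H e

theorem weight_triple (hH : ∀ e ∈ H, e.card = 3) (hab : a ≠ b) (hac : a ≠ c) (hbc : b ≠ c) :
    weight H {a, b, c} =
      ((nbr H a b).card : ℚ)⁻¹ + ((nbr H a c).card : ℚ)⁻¹ + ((nbr H b c).card : ℚ)⁻¹ := by
  have h1 : ({a, b} : Finset V) ≠ {a, c} := by
    intro h
    have : b ∈ ({a, c} : Finset V) := h ▸ (by simp)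
    simp at this; tauto
  have h2 : ({a, b} : Finset V) ≠ {b, c} := by
    intro h
    have : a ∈ ({b, c} : Finset V) := h ▸ (by simp)
    simp at this; tauto
  have h3 : ({a, c} : Finset V) ≠ {b, c} := by
    intro h
    have : a ∈ ({b, c} : Finset V) := h ▸ (by simp)
    simp at this; tauto
  rw [weight, powersetCard_two_triple hab hac hbc, sum_insert (by simp [h1, h2]),
    sum_insert (by simp [h3]), sum_singleton, pairDegP_pair hH hab, pairDegP_pair hH hac,
    pairDegP_pair hH hbc, add_assoc]

theorem inv_add_inv_le_of_two_small {t x y z : ℕ} (hx : 0 < x) (hy : 0 < y) (hz : 0 < z)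
    (hx' : x ≤ 2 * t) (hy' : y ≤ 2 * t) (h : x < 2 * t ∨ y < 2 * t ∨ z < heavyDeg t) :
    (t : ℚ)⁻¹ + (heavyDeg t : ℚ)⁻¹ ≤ (x : ℚ)⁻¹ + (y : ℚ)⁻¹ + (z : ℚ)⁻¹ := by
  have hanti : ∀ {m k : ℕ}, 0 < m → m ≤ k → (k : ℚ)⁻¹ ≤ (m : ℚ)⁻¹ := fun hm hmk =>
    inv_anti₀ (by exact_mod_cast hm) (by exact_mod_cast hmk)
  have ht : 0 < t := by omega
  have ht' : (1 : ℚ) ≤ t := by exact_mod_cast ht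
  have hz0 : (0 : ℚ) < (z : ℚ)⁻¹ := inv_pos.2 (by exact_mod_cast hz)
  have hx1 := hanti hx hx'
  have hy1 := hanti hy hy'
  have hhalf : (t : ℚ)⁻¹ = ((2 * t : ℕ) : ℚ)⁻¹ + ((2 * t : ℕ) : ℚ)⁻¹ := by
    push_cast
    field_simp
    norm_num
  have hone : (heavyDeg t : ℚ)⁻¹ + ((2 * t : ℕ) : ℚ)⁻¹ ≤ ((2 * t - 1 : ℕ) : ℚ)⁻¹ := by
    have h1 : (heavyDeg t : ℚ)⁻¹ ≤ (2 * t * (2 * t - 1) : ℚ)⁻¹ := by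
      refine inv_anti₀ (by nlinarith) ?_
      unfold heavyDeg
      push_cast
      nlinarith
    have h2 : (2 * t * (2 * t - 1) : ℚ)⁻¹ + ((2 * t : ℕ) : ℚ)⁻¹ = ((2 * t - 1 : ℕ) : ℚ)⁻¹ := by
      rw [Nat.cast_sub (by omega)]
      push_cast
      have : (2 * t - 1 : ℚ) ≠ 0 := by linarith
      field_simp
      ring
    linarith
  rcases h with h | h | h
  · have := hanti hx (Nat.le_sub_one_of_lt h)
    linarith
  · have := hanti hy (Nat.le_sub_one_of_lt h)
    linarith
  · have := hanti hz h.le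
    linarith

theorem inv_add_inv_le_of_bounded {t x y z : ℕ} (hx : 0 < x) (hy : 0 < y) (hz : 0 < z)
    (hx' : x ≤ 2 * t) (hy' : y ≤ 3 * t) (hz' : z ≤ 3 * t) :
    (t : ℚ)⁻¹ + (heavyDeg t : ℚ)⁻¹ ≤ (x : ℚ)⁻¹ + (y : ℚ)⁻¹ + (z : ℚ)⁻¹ := by
  have hanti : ∀ {m k : ℕ}, 0 < m → m ≤ k → (k : ℚ)⁻¹ ≤ (m : ℚ)⁻¹ := fun hm hmk =>
    inv_anti₀ (by exact_mod_cast hm) (by exact_mod_cast hmk)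
  have ht : 0 < t := by omega
  have ht' : (1 : ℚ) ≤ t := by exact_mod_cast ht
  have hx1 := hanti hx hx'
  have hy1 := hanti hy hy'
  have hz1 := hanti hz hz'
  have hK : (heavyDeg t : ℚ)⁻¹ ≤ ((6 * t : ℕ) : ℚ)⁻¹ := hanti (by omega) (by
    unfold heavyDeg
    nlinarith)
  have : (t : ℚ)⁻¹ + ((6 * t : ℕ) : ℚ)⁻¹ =
      ((2 * t : ℕ) : ℚ)⁻¹ + ((3 * t : ℕ) : ℚ)⁻¹ + ((3 * t : ℕ) : ℚ)⁻¹ := by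
    push_cast
    field_simp
    norm_num
  linarith

theorem nbr_card_pos (he : ({a, b, c} : Finset V) ∈ H) : 0 < (nbr H a b).card :=
  card_pos.2 ⟨c, mem_nbr.2 he⟩

/-- Hyperedges that are not ample have weight at least `1 / t`. -/
theorem inv_le_weight (ht : 0 < t) (hH : ∀ e ∈ H, e.card = 3) {e : Finset V} (he : e ∈ H)
    (hA : ¬ Ample t H e) : (t : ℚ)⁻¹ ≤ weight H e := by
  obtain ⟨a, b, c, hab, hac, hbc, rfl⟩ := card_eq_three.1 (hH e he)
  rw [ample_triple_iff hH hab hac hbc] at hA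
  rw [weight_triple hH hab hac hbc]
  have hx := nbr_card_pos he
  have hy : 0 < (nbr H a c).card := nbr_card_pos (c := b) (by rwa [pair_comm c b])
  have hz : 0 < (nbr H b c).card := card_pos.2 ⟨a, mem_nbr_rotate.1 (mem_nbr.2 he)⟩
  generalize (nbr H a b).card = x, (nbr H a c).card = y, (nbr H b c).card = z at *
  have hanti : ∀ {m k : ℕ}, 0 < m → m ≤ k → (k : ℚ)⁻¹ ≤ (m : ℚ)⁻¹ := fun hm hmk =>
    inv_anti₀ (by exact_mod_cast hm) (by exact_mod_cast hmk)
  have hpos : ∀ {m : ℕ}, 0 < m → (0 : ℚ) < (m : ℚ)⁻¹ := fun hm =>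
    inv_pos.2 (by exact_mod_cast hm)
  have ht' : (0 : ℚ) < t := by exact_mod_cast ht
  have hhalf : (t : ℚ)⁻¹ = ((2 * t : ℕ) : ℚ)⁻¹ + ((2 * t : ℕ) : ℚ)⁻¹ := by
    push_cast
    field_simp
    norm_num
  have hthird : (t : ℚ)⁻¹ =
      ((3 * t : ℕ) : ℚ)⁻¹ + ((3 * t : ℕ) : ℚ)⁻¹ + ((3 * t : ℕ) : ℚ)⁻¹ := by
    push_cast
    field_simp
    norm_num
  have hx0 := hpos hx
  have hy0 := hpos hy
  have hz0 := hpos hz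
  by_cases h1 : x ≤ t
  · linarith [hanti hx h1]
  by_cases h2 : y ≤ t
  · linarith [hanti hy h2]
  by_cases h3 : z ≤ t
  · linarith [hanti hz h3]
  by_cases h4 : x ≤ 2 * t ∧ y ≤ 2 * t
  · linarith [hanti hx h4.1, hanti hy h4.2]
  by_cases h5 : x ≤ 2 * t ∧ z ≤ 2 * t
  · linarith [hanti hx h5.1, hanti hz h5.2]
  by_cases h6 : y ≤ 2 * t ∧ z ≤ 2 * t
  · linarith [hanti hy h6.1, hanti hz h6.2]
  have h7 : x ≤ 3 * t ∧ y ≤ 3 * t ∧ z ≤ 3 * t := by omega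
  linarith [hanti hx h7.1, hanti hy h7.2.1, hanti hz h7.2.2]

theorem tight_of_not_rich (hH : ∀ e ∈ H, e.card = 3) (he : ({c, a, b} : Finset V) ∈ H)
    (hR : ¬ Rich t H {c, a, b}) (ha : (nbr H c a).card ≤ 2 * t) (hb : (nbr H c b).card ≤ 2 * t) :
    Tight t H c a b := by
  have hne := ne_of_mem_nbr hH (mem_nbr.2 he)
  rw [Rich, weight_triple hH hne.1 hne.2.1 hne.2.2] at hR
  have hx := nbr_card_pos he
  have hy : 0 < (nbr H c b).card := nbr_card_pos (c := a) (by rwa [pair_comm b a])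
  have hz : 0 < (nbr H a b).card := card_pos.2 ⟨c, mem_nbr_rotate.1 (mem_nbr.2 he)⟩
  have : ¬((nbr H c a).card < 2 * t ∨ (nbr H c b).card < 2 * t ∨ (nbr H a b).card < heavyDeg t) :=
    fun h => hR (inv_add_inv_le_of_two_small hx hy hz ha hb h)
  exact ⟨he, by omega, by omega, by omega⟩

theorem exists_tight_of_not_rich (hH : ∀ e ∈ H, e.card = 3) {e : Finset V} (he : e ∈ H)
    (hR : ¬ Rich t H e) (h2 : 2 ≤ ((e.powersetCard 2).filter fun p =>
      t + 1 ≤ pairDegP H p ∧ pairDegP H p ≤ 2 * t).card) :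
    ∃ c a b, e = {c, a, b} ∧ Tight t H c a b := by
  obtain ⟨a, b, c, hab, hac, hbc, rfl⟩ := card_eq_three.1 (hH e he)
  obtain ⟨p, hp, q, hq, hpq⟩ := one_lt_card.1 h2
  rw [powersetCard_two_triple hab hac hbc] at hp hq
  simp only [mem_filter, mem_insert, mem_singleton] at hp hq
  have e1 : ({a, b, c} : Finset V) = {b, a, c} := insert_comm _ _ _
  have e2 : ({a, b, c} : Finset V) = {c, a, b} := by rw [pair_comm b c, insert_comm]
  have key : ((nbr H a b).card ≤ 2 * t ∧ (nbr H a c).card ≤ 2 * t) ∨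
      ((nbr H a b).card ≤ 2 * t ∧ (nbr H b c).card ≤ 2 * t) ∨
      ((nbr H a c).card ≤ 2 * t ∧ (nbr H b c).card ≤ 2 * t) := by
    obtain ⟨hp, -, hp2⟩ := hp
    obtain ⟨hq, -, hq2⟩ := hq
    rcases hp with rfl | rfl | rfl <;> rcases hq with rfl | rfl | rfl <;>
      simp only [pairDegP_pair hH, hab, hac, hbc, ne_eq, not_false_eq_true] at hp2 hq2 <;> tauto
  rcases key with ⟨h1, h2⟩ | ⟨h1, h2⟩ | ⟨h1, h2⟩
  · exact ⟨a, b, c, rfl, tight_of_not_rich hH he hR h1 h2⟩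
  · exact ⟨b, a, c, e1, tight_of_not_rich hH (e1 ▸ he) (e1 ▸ hR) (by rwa [nbr_comm]) h2⟩
  · exact ⟨c, a, b, e2, tight_of_not_rich hH (e2 ▸ he) (e2 ▸ hR) (by rwa [nbr_comm])
      (by rwa [nbr_comm])⟩

/-- If many arms leave `c`, then arms lying in no ample or rich hyperedge are symmetric. -/
theorem mem_arms_symm (ht : 1 < t) (hH : ∀ e ∈ H, e.card = 3) (hF : ¬ ContainsFanExp t H)
    (ha : a ∈ arms t H c) (hc : (2 * t + 1) * (4 * t + 4 * t * (2 * t)) < (arms t H c).card)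
    (hnice : ∀ f ∈ H, c ∈ f → a ∈ f → ¬ Ample t H f ∧ ¬ Rich t H f) : c ∈ arms t H a := by
  classical
  obtain ⟨b, h⟩ := mem_arms.1 ha
  have hFc : (nbr H c a ∪ nbr H c b).card ≤ 4 * t := by
    have := card_union_le (nbr H c a) (nbr H c b)
    rw [h.2.1, h.2.2.1] at this
    omega
  obtain ⟨T, hTc, hS, hT, hav⟩ := exists_scattered (t := t) (H := H) (c := c) (2 * t)
    (nbr H c a ∪ nbr H c b)
    (lt_of_le_of_lt (Nat.mul_le_mul_left _ (Nat.add_le_add_right hFc _)) hc)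
  simp only [mem_union, not_or] at hav
  have hS' : Scattered H c (insert (a, b) T) := hS.insert fun y hy => by
    have := hav y hy
    tauto
  have hT' : ∀ x ∈ insert (a, b) T, Tight t H c x.1 x.2 := by
    intro x hx
    rcases mem_insert.1 hx with rfl | hx
    · exact h
    · exact hT x hx
  have hcard : (insert (a, b) T).card = 2 * t + 1 := by
    rw [card_insert_of_notMem fun hm => (hav _ hm).2.1 h.mem_left, hTc]
  obtain ⟨Z, hZ⟩ := exists_common_link ht hH hF hT' hS' (by omega)
  have hZa := (hZ _ (mem_insert_self _ _)).1
  dsimp only at hZa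
  obtain ⟨z, hz⟩ : Z.Nonempty := card_pos.1 (by
    rw [← hZa, card_erase_of_mem h.mem_left, h.2.1]
    omega)
  have hza : z ∈ nbr H c a := mem_of_mem_erase (hZa ▸ hz)
  have hcz : 2 * t + 1 ≤ (nbr H c z).card := by
    rw [← hcard]
    refine card_le_card_of_injOn Prod.fst (fun x hx => ?_) fun x hx y hy hxy => ?_
    · exact mem_nbr_swap.1 (mem_of_mem_erase ((hZ x hx).1 ▸ hz))
    · exact congrArg Subtype.val (hS'.fst_injective hT' (a₁ := ⟨x, hx⟩) (a₂ := ⟨y, hy⟩) hxy)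
  have hf := mem_nbr.1 hza
  have hne := ne_of_mem_nbr hH hza
  obtain ⟨hA, hR⟩ := hnice _ hf (by simp) (by simp)
  have hca : (nbr H a c).card = 2 * t := by rw [nbr_comm, h.2.1]
  have hf' : ({a, c, z} : Finset V) ∈ H := by rwa [insert_comm]
  refine mem_arms.2 ⟨z, tight_of_not_rich hH hf' (by rwa [insert_comm]) hca.le ?_⟩
  by_contra! haz
  rw [ample_triple_iff hH hne.1 hne.2.1 hne.2.2, h.2.1] at hA
  rw [Rich, weight_triple hH hne.1 hne.2.1 hne.2.2, h.2.1] at hR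
  exact hR (inv_add_inv_le_of_bounded (by omega) (by omega) (by omega) le_rfl (by omega)
    (by omega))

end Links

section Counting

variable {V : Type*} [DecidableEq V] [Fintype V] {t : ℕ} {H : Finset (Finset V)} {a b c : V}

/-- The pairs contained in no hyperedge. -/
def uncovered (H : Finset (Finset V)) : Finset (Finset V) :=
  ((univ : Finset V).powersetCard 2).filter fun p => pairDegP H p = 0

theorem sum_weight_add_card_uncovered (H : Finset (Finset V)) :
    ∑ e ∈ H, weight H e + (uncovered H).card = ((Fintype.card V).choose 2 : ℕ) := by
  have h1 : ∑ e ∈ H, weight H e = ∑ p ∈ (univ : Finset V).powersetCard 2,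
      ∑ _e ∈ H with p ⊆ _e, (pairDegP H p : ℚ)⁻¹ := by
    unfold weight
    refine sum_comm' fun e p => ?_
    simp only [mem_powersetCard, mem_filter, subset_univ, true_and]
    tauto
  rw [h1, uncovered, card_filter, ← card_univ, ← card_powersetCard, card_eq_sum_ones]
  push_cast
  rw [← sum_add_distrib]
  refine sum_congr rfl fun p _ => ?_
  rw [sum_const, nsmul_eq_mul]
  change (pairDegP H p : ℚ) * _ + _ = 1
  split_ifs with h
  · simp [h]
  · simp [h]

open Classical in
/-- If `H` has nearly `t` hyperedges for every pair of vertices and few ample hyperedges, then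
there are few rich hyperedges and few uncovered pairs. -/
theorem card_rich_add_card_uncovered_le (ht : 0 < t) (hH : ∀ e ∈ H, e.card = 3) {m : ℕ}
    (hm : t * (Fintype.card V).choose 2 + (H.filter (Ample t H)).card ≤ H.card + m) :
    (H.filter fun e => Rich t H e ∧ ¬ Ample t H e).card + heavyDeg t * (uncovered H).card ≤
      heavyDeg t * m := by
  have hpt : ∀ e ∈ H, ((if ¬ Ample t H e then (t : ℚ)⁻¹ else 0) +
      if Rich t H e ∧ ¬ Ample t H e then (heavyDeg t : ℚ)⁻¹ else 0) ≤ weight H e := by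
    intro e he
    by_cases hA : Ample t H e
    · simpa [hA] using show 0 ≤ weight H e from sum_nonneg fun _ _ => by positivity
    · by_cases hR : Rich t H e
      · have hR' := hR
        unfold Rich at hR'
        simpa only [hA, hR, not_false_eq_true, and_self, if_true] using hR'
      · simpa [hA, hR] using inv_le_weight ht hH he hA
  have hsum := sum_le_sum hpt
  rw [sum_add_distrib, ← sum_filter, ← sum_filter, sum_const, sum_const, nsmul_eq_mul,
    nsmul_eq_mul] at hsum
  have htot := sum_weight_add_card_uncovered H
  have hsplit := card_filter_add_card_filter_not (s := H) (Ample t H)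
  have ht1 : (1 : ℚ) ≤ t := by exact_mod_cast ht
  have hK : (0 : ℚ) < heavyDeg t := by
    have : 0 < heavyDeg t := by unfold heavyDeg; omega
    exact_mod_cast this
  have hm' : (t : ℚ) * ((Fintype.card V).choose 2 : ℕ) ≤
      (H.filter fun e => ¬ Ample t H e).card + m := by
    have : t * (Fintype.card V).choose 2 ≤ (H.filter fun e => ¬ Ample t H e).card + m := by omega
    exact_mod_cast this
  have hchoose : (((Fintype.card V).choose 2 : ℕ) : ℚ) ≤
      (H.filter fun e => ¬ Ample t H e).card * (t : ℚ)⁻¹ + m := by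
    have h1 : (((Fintype.card V).choose 2 : ℕ) : ℚ) ≤
        ((H.filter fun e => ¬ Ample t H e).card + m) * (t : ℚ)⁻¹ := by
      rw [← div_eq_mul_inv, le_div_iff₀ (by linarith), mul_comm]
      exact hm'
    have h2 : (m : ℚ) * (t : ℚ)⁻¹ ≤ m :=
      mul_le_of_le_one_right (Nat.cast_nonneg _) (inv_le_one_of_one_le₀ ht1)
    linarith
  have hmain : ((H.filter fun e => Rich t H e ∧ ¬ Ample t H e).card : ℚ) * (heavyDeg t : ℚ)⁻¹ +
      (uncovered H).card ≤ m := by linarith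
  have hfin := mul_le_mul_of_nonneg_left hmain hK.le
  rw [mul_add, mul_left_comm, mul_inv_cancel₀ hK.ne', mul_one] at hfin
  exact_mod_cast hfin

theorem sum_card_nonadjacent_le (H : Finset (Finset V)) (hH : ∀ e ∈ H, e.card = 3) :
    ∑ a : V, (univ.filter fun a' => a ≠ a' ∧ nbr H a a' = ∅).card ≤ 4 * (uncovered H).card := by
  have h1 : ∑ a : V, (univ.filter fun a' => a ≠ a' ∧ nbr H a a' = ∅).card =
      ((univ : Finset (V × V)).filter fun x => x.1 ≠ x.2 ∧ nbr H x.1 x.2 = ∅).card := by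
    simp only [card_filter, Fintype.sum_prod_type]
  have h2 : ((univ : Finset (V × V)).filter fun x => x.1 ≠ x.2 ∧ nbr H x.1 x.2 = ∅) ⊆
      (uncovered H).biUnion fun p => p ×ˢ p := by
    rintro ⟨a, a'⟩ h
    simp only [mem_filter, mem_univ, true_and] at h
    simp only [mem_biUnion, mem_product]
    exact ⟨{a, a'}, by simp [uncovered, pairDegP_pair hH h.1, h.1, h.2], by simp, by simp⟩
  rw [h1, mul_comm]
  refine (card_le_card h2).trans (card_biUnion_le_card_mul _ _ _ fun p hp => ?_)
  rw [card_product, (mem_powersetCard.1 (mem_filter.1 hp).1).2]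

/-- Beyond this number of arms at `c` the structure of the arms is rigid. -/
def manyArms (t : ℕ) : ℕ := (2 * t + 1) * (8 * t + 1 + 4 * t * (2 * t))

open Classical in
theorem sum_card_arms_le (ht : 1 < t) (hH : ∀ e ∈ H, e.card = 3) (hF : ¬ ContainsFanExp t H) :
    ∑ c : V, (arms t H c).card ≤ manyArms t * Fintype.card V +
      9 * (H.filter fun e => Ample t H e ∨ Rich t H e).card +
      2 * (4 * (uncovered H).card + 4 * t * (2 * t + 1) * Fintype.card V) := by
  let N : V → ℕ := fun a =>
    (univ.filter fun a' => a ≠ a' ∧ nbr H a a' = ∅).card + 4 * t * (2 * t + 1)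
  have hN : ∑ a, N a ≤ 4 * (uncovered H).card + 4 * t * (2 * t + 1) * Fintype.card V := by
    simp only [N, sum_add_distrib, sum_const, card_univ, smul_eq_mul]
    have := sum_card_nonadjacent_le H hH
    linarith
  have hk1 : (2 * t + 1) * (8 * t + 1 + 4 * t * t) ≤ manyArms t :=
    Nat.mul_le_mul_left _ (by nlinarith)
  have hk2 : (2 * t + 1) * (4 * t + 4 * t * (2 * t)) ≤ manyArms t :=
    Nat.mul_le_mul_left _ (by omega)
  let nice : V → V → Prop := fun c a =>
    ∀ f ∈ H, c ∈ f → a ∈ f → ¬ Ample t H f ∧ ¬ Rich t H f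
  let P : Finset (V × V) := univ.filter fun x => x.2 ∈ arms t H x.1
  let P₁ : Finset (V × V) := P.filter fun x => (arms t H x.1).card ≤ manyArms t
  let P₂ : Finset (V × V) := (H.filter fun e => Ample t H e ∨ Rich t H e).biUnion fun f => f ×ˢ f
  let P₃ : Finset (V × V) := univ.filter fun x => x.2 ∈ arms t H x.1 ∧ x.1 ∈ arms t H x.2 ∧
    manyArms t < (arms t H x.1).card ∧ (arms t H x.2).card ≤ (arms t H x.1).card
  let P₄ : Finset (V × V) := univ.filter fun x => x.2 ∈ arms t H x.1 ∧ x.1 ∈ arms t H x.2 ∧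
    manyArms t < (arms t H x.2).card ∧ (arms t H x.1).card ≤ (arms t H x.2).card
  have hP : ∑ c : V, (arms t H c).card = P.card := by
    simp only [P, card_filter, Fintype.sum_prod_type]
    refine sum_congr rfl fun c _ => ?_
    rw [← card_filter, filter_mem_eq_inter, univ_inter]
  have hsub : P ⊆ P₁ ∪ P₂ ∪ (P₃ ∪ P₄) := by
    rintro ⟨c, a⟩ hx
    have ha : a ∈ arms t H c := (mem_filter.1 hx).2
    by_cases hc : (arms t H c).card ≤ manyArms t
    · exact mem_union_left _ (mem_union_left _ (mem_filter.2 ⟨hx, hc⟩))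
    by_cases hn : nice c a
    · have hca := mem_arms_symm ht hH hF ha (by omega) hn
      refine mem_union_right _ ?_
      rcases le_total (arms t H a).card (arms t H c).card with h | h
      · exact mem_union_left _ (mem_filter.2 ⟨mem_univ _, ha, hca, by dsimp only; omega, h⟩)
      · exact mem_union_right _ (mem_filter.2 ⟨mem_univ _, ha, hca, by dsimp only; omega, h⟩)
    · refine mem_union_left _ (mem_union_right _ ?_)
      simp only [nice] at hn
      push Not at hn
      obtain ⟨f, hf, hcf, haf, hbad⟩ := hn
      exact mem_biUnion.2 ⟨f, mem_filter.2 ⟨hf, or_iff_not_imp_left.2 hbad⟩,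
        mem_product.2 ⟨hcf, haf⟩⟩
  have h1 : P₁.card ≤ manyArms t * Fintype.card V := by
    have hsub₁ : P₁ ⊆ univ.biUnion fun c => if (arms t H c).card ≤ manyArms t then
        ({c} : Finset V) ×ˢ arms t H c else ∅ := by
      rintro ⟨c, a⟩ hx
      have hx' := mem_filter.1 hx
      refine mem_biUnion.2 ⟨c, mem_univ _, ?_⟩
      rw [if_pos hx'.2]
      exact mem_product.2 ⟨mem_singleton_self _, (mem_filter.1 hx'.1).2⟩
    rw [mul_comm, ← card_univ]
    refine (card_le_card hsub₁).trans (card_biUnion_le_card_mul _ _ _ fun c _ => ?_)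
    split_ifs with h
    · simpa using h
    · simp
  have h2 : P₂.card ≤ 9 * (H.filter fun e => Ample t H e ∨ Rich t H e).card := by
    rw [mul_comm]
    refine card_biUnion_le_card_mul _ _ _ fun f hf => ?_
    rw [card_product, hH f (mem_filter.1 hf).1]
  have h4 : P₄.card ≤ ∑ c, N c := by
    simp only [P₄, card_filter, Fintype.sum_prod_type]
    refine sum_le_sum fun c _ => ?_
    rw [← card_filter]
    rcases eq_empty_or_nonempty (univ.filter fun a => a ∈ arms t H c ∧ c ∈ arms t H a ∧
      manyArms t < (arms t H a).card ∧ (arms t H c).card ≤ (arms t H a).card) with h | ⟨a, ha⟩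
    · rw [h, card_empty]
      exact Nat.zero_le _
    · have ha' := (mem_filter.1 ha).2
      refine (card_le_card fun x hx => (mem_filter.1 hx).2.1).trans (ha'.2.2.2.trans ?_)
      exact card_arms_le ht hH hF ha'.2.1 (by omega)
  have h3 : P₃.card ≤ ∑ c, N c := by
    refine le_trans ?_ h4
    refine card_le_card_of_injOn Prod.swap (fun x hx => ?_) (Prod.swap_injective.injOn)
    simp only [P₃, P₄, coe_filter, mem_univ, true_and] at hx ⊢
    exact ⟨hx.2.1, hx.1, hx.2.2⟩
  have := card_le_card hsub
  have h5 := card_union_le (P₁ ∪ P₂) (P₃ ∪ P₄)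
  have h6 := card_union_le P₁ P₂
  have h7 := card_union_le P₃ P₄
  rw [hP]
  linarith

theorem card_tight_le (t : ℕ) (H : Finset (Finset V)) [DecidablePred fun e : Finset V =>
    ∃ c a b, e = {c, a, b} ∧ Tight t H c a b] :
    (H.filter fun e => ∃ c a b, e = {c, a, b} ∧ Tight t H c a b).card ≤
      (∑ c : V, (arms t H c).card) * (2 * t) := by
  classical
  rw [← card_sigma]
  refine (card_le_card fun e he => ?_).trans (card_biUnion_le_card_mul
    (univ.sigma fun c => arms t H c) (fun x => (nbr H x.1 x.2).image fun b => {x.1, x.2, b}) _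
    fun x hx => ?_)
  · obtain ⟨-, c, a, b, rfl, h⟩ := mem_filter.1 he
    exact mem_biUnion.2 ⟨⟨c, a⟩, mem_sigma.2 ⟨mem_univ _, mem_arms.2 ⟨b, h⟩⟩,
      mem_image.2 ⟨b, h.mem_left, rfl⟩⟩
  · obtain ⟨b, h⟩ := mem_arms.1 (mem_sigma.1 hx).2
    exact card_image_le.trans h.2.1.le

end Counting

section LowerBound

variable {V : Type*} [DecidableEq V]

/-- If all hyperedges meet a `t`-set in exactly one vertex, there is no `t`-fan expansion. -/
theorem not_containsFanExp_of_card_inter {t : ℕ} (ht : 0 < t) {H : Finset (Finset V)}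
    {S : Finset V} (hS : S.card ≤ t) (hH : ∀ e ∈ H, (e ∩ S).card = 1) : ¬ ContainsFanExp t H := by
  rintro ⟨f, hf, hfH⟩
  have huniq : ∀ e ∈ H, ∀ x ∈ e, ∀ y ∈ e, x ∈ S → y ∈ S → x = y := fun e he x hx y hy hxS hyS =>
    card_le_one.1 (hH e he).le x (mem_inter.2 ⟨hx, hxS⟩) y (mem_inter.2 ⟨hy, hyS⟩)
  have hex : ∀ x y z : V, ({x, y, z} : Finset V) ∈ H → x ∉ S → y ∉ S → z ∈ S := by
    intro x y z he hx hy
    obtain ⟨v, hv⟩ : (({x, y, z} : Finset V) ∩ S).Nonempty := card_pos.1 (by rw [hH _ he]; omega)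
    simp only [mem_inter, mem_insert, mem_singleton] at hv
    rcases hv with ⟨rfl | rfl | rfl, hvS⟩ <;> tauto
  by_cases hc : f (Sum.inl ()) ∈ S
  · have hw : ∀ i, f (Sum.inr (4, i)) ∈ S := fun i => by
      refine hex _ _ _ (hfH i).2.2 (fun h => ?_) fun h => ?_
      · exact Sum.inl_ne_inr (hf (huniq _ (hfH i).1 _ (by simp) _ (by simp) hc h))
      · exact Sum.inl_ne_inr (hf (huniq _ (hfH i).2.1 _ (by simp) _ (by simp) hc h))
    let g : Option (Fin t) → V := fun o => f (o.elim (Sum.inl ()) fun i => Sum.inr (4, i))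
    have hg : Function.Injective g := by
      refine hf.comp ?_
      rintro (_ | i) (_ | j) h <;> simp_all
    have := card_le_card_of_injOn g (s := univ) (t := S) (by rintro (_ | i) - <;> simp [g, hc, hw])
      hg.injOn
    simp at this
    omega
  · let k : Bool × Fin t → Fin 5 × Fin t := fun z =>
      (if f (Sum.inr (if z.1 then 1 else 0, z.2)) ∈ S then (if z.1 then 1 else 0)
        else (if z.1 then 3 else 2), z.2)
    have hk : Function.Injective k := by
      rintro ⟨b, i⟩ ⟨b', i'⟩ h
      obtain ⟨h1, rfl⟩ := Prod.mk.inj h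
      refine Prod.ext ?_ rfl
      cases b <;> cases b' <;> simp only [Bool.false_eq_true, if_true, if_false] at h1 ⊢ <;>
        split_ifs at h1 <;> simp at h1
    have hkS : ∀ z, f (Sum.inr (k z)) ∈ S := by
      rintro ⟨_ | _, i⟩
      · by_cases h : f (Sum.inr (0, i)) ∈ S
        · simp [k, h]
        · simpa [k, h] using hex _ _ _ (hfH i).1 hc h
      · by_cases h : f (Sum.inr (1, i)) ∈ S
        · simp [k, h]
        · simpa [k, h] using hex _ _ _ (hfH i).2.1 hc h
    have := card_le_card_of_injOn (fun z => f (Sum.inr (k z))) (s := univ) (t := S)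
      (fun z _ => hkS z) ((hf.comp (Sum.inr_injective.comp hk)).injOn)
    simp at this
    omega

theorem choose_two_add_le (m t : ℕ) : (m + t).choose 2 ≤ m.choose 2 + t * (m + t) := by
  induction t with
  | zero => simp
  | succ t ih =>
    rw [← add_assoc, Nat.choose_succ_succ' (m + t) 1, Nat.choose_one_right]
    nlinarith

theorem le_exFan3 {t : ℕ} (ht : 0 < t) (n : ℕ) : t * n.choose 2 ≤ exFan3 t n + t * t * n := by
  rcases lt_or_ge n t with hn | hn
  · have h1 := Nat.choose_two_right n
    have h2 : n.choose 2 ≤ n * n := by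
      rw [h1]
      exact (Nat.div_le_self _ _).trans (Nat.mul_le_mul_left _ (Nat.sub_le _ _))
    have h3 : t * n.choose 2 ≤ t * (t * n) :=
      Nat.mul_le_mul_left _ (h2.trans (Nat.mul_le_mul_right _ hn.le))
    rw [mul_assoc]
    omega
  obtain ⟨S, -, hS⟩ := exists_subset_card_eq (s := (univ : Finset (Fin n))) (n := t) (by simpa)
  let H : Finset (Finset (Fin n)) := (S ×ˢ Sᶜ.powersetCard 2).image fun x => insert x.1 x.2
  have hmem : ∀ x ∈ S ×ˢ Sᶜ.powersetCard 2, x.1 ∈ S ∧ Disjoint x.2 S ∧ x.2.card = 2 := by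
    intro x hx
    obtain ⟨h1, h2⟩ := mem_product.1 hx
    obtain ⟨h2, h3⟩ := mem_powersetCard.1 h2
    exact ⟨h1, subset_compl_iff_disjoint_right.1 h2, h3⟩
  have hinter : ∀ x ∈ S ×ˢ Sᶜ.powersetCard 2, insert x.1 x.2 ∩ S = {x.1} := by
    intro x hx
    obtain ⟨h1, h2, -⟩ := hmem x hx
    rw [insert_inter_of_mem h1, disjoint_iff_inter_eq_empty.1 h2]
    rfl
  have hnot : ∀ x ∈ S ×ˢ Sᶜ.powersetCard 2, x.1 ∉ x.2 := fun x hx h =>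
    disjoint_left.1 (hmem x hx).2.1 h (hmem x hx).1
  have hcard : H.card = t * (n - t).choose 2 := by
    rw [card_image_of_injOn, card_product, card_powersetCard, card_compl, hS, Fintype.card_fin]
    intro x hx y hy hxy
    have h1 := hinter x hx
    have h2 : x.1 = y.1 := by
      have h3 := hinter y hy
      dsimp only at hxy
      rw [hxy, h3] at h1
      exact (singleton_inj.1 h1).symm
    refine Prod.ext h2 ?_
    rw [← erase_insert (hnot x hx), ← erase_insert (hnot y hy), ← h2]
    dsimp only at hxy
    rw [hxy, h2]
  have hle : H.card ≤ exFan3 t n := by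
    refine le_csSup ⟨Fintype.card (Finset (Fin n)), ?_⟩ ⟨H, ?_, ?_, rfl⟩
    · rintro _ ⟨H', -, -, rfl⟩
      exact card_le_univ H'
    · intro e he
      obtain ⟨x, hx, rfl⟩ := mem_image.1 he
      rw [card_insert_of_notMem (hnot x hx), (hmem x hx).2.2]
    · refine not_containsFanExp_of_card_inter ht hS.le fun e he => ?_
      obtain ⟨x, hx, rfl⟩ := mem_image.1 he
      rw [hinter x hx, card_singleton]
  have hchoose := choose_two_add_le (n - t) t
  rw [Nat.sub_add_cancel hn] at hchoose
  have := Nat.mul_le_mul_left t hchoose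
  rw [hcard] at hle
  nlinarith

end LowerBound

section Main

variable {V : Type*} [DecidableEq V] [Fintype V] {t : ℕ} {H : Finset (Finset V)}

open Classical in
/-- If `H` has at least `t * (n choose 2) - r` hyperedges, then the number of hyperedges with two
pairs of degree between `t + 1` and `2 * t` is linear in the number of ample hyperedges, in `n`
and in `r`. -/
theorem card_two_medium_pairs_le (ht : 1 < t) (hH : ∀ e ∈ H, e.card = 3)
    (hF : ¬ ContainsFanExp t H) {r : ℕ}
    (hr : t * (Fintype.card V).choose 2 + (H.filter (Ample t H)).card ≤ H.card + r) :
    (H.filter fun e => 2 ≤ ((e.powersetCard 2).filter fun p =>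
      t + 1 ≤ pairDegP H p ∧ pairDegP H p ≤ 2 * t).card).card ≤
      (H.filter (Ample t H)).card + heavyDeg t * r +
        (manyArms t * Fintype.card V + 9 * ((H.filter (Ample t H)).card + heavyDeg t * r) +
          2 * (4 * r + 4 * t * (2 * t + 1) * Fintype.card V)) * (2 * t) := by
  have hrich := card_rich_add_card_uncovered_le (by omega) hH hr
  have hK : 0 < heavyDeg t := by unfold heavyDeg; omega
  have hU : (uncovered H).card ≤ r := Nat.le_of_mul_le_mul_left (by omega) hK
  have hbad : (H.filter fun e => Ample t H e ∨ Rich t H e).card ≤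
      (H.filter (Ample t H)).card + heavyDeg t * r := by
    have hsub : (H.filter fun e => Ample t H e ∨ Rich t H e) ⊆
        H.filter (Ample t H) ∪ H.filter fun e => Rich t H e ∧ ¬ Ample t H e := by
      intro e he
      simp only [mem_union, mem_filter] at he ⊢
      tauto
    have h1 := card_le_card hsub
    have h2 := card_union_le (H.filter (Ample t H)) (H.filter fun e => Rich t H e ∧ ¬ Ample t H e)
    omega
  have harms := sum_card_arms_le ht hH hF
  have htight := card_tight_le t H
  have hsub : (H.filter fun e => 2 ≤ ((e.powersetCard 2).filter fun p =>
      t + 1 ≤ pairDegP H p ∧ pairDegP H p ≤ 2 * t).card) ⊆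
      (H.filter fun e => Ample t H e ∨ Rich t H e) ∪
        H.filter fun e => ∃ c a b, e = {c, a, b} ∧ Tight t H c a b := by
    intro e he
    obtain ⟨he, h2⟩ := mem_filter.1 he
    by_cases hR : Rich t H e
    · exact mem_union_left _ (mem_filter.2 ⟨he, Or.inr hR⟩)
    · exact mem_union_right _ (mem_filter.2 ⟨he, exists_tight_of_not_rich hH he hR h2⟩)
  refine (card_le_card hsub).trans ((card_union_le _ _).trans (add_le_add hbad
    (htight.trans (Nat.mul_le_mul_right _ (harms.trans ?_)))))
  gcongr

end Main

end FanExpansion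

theorem linear_bound_H2 (t : ℕ) (ht : 1 < t) :
    ∃ C : ℕ, ∀ n : ℕ, ∀ H : Finset (Finset (Fin n)),
      (∀ e ∈ H, e.card = 3) → ¬ ContainsFanExp t H → H.card = exFan3 t n →
      (H.filter fun e => 2 ≤ ((e.powersetCard 2).filter fun p =>
        t + 1 ≤ pairDegP H p ∧ pairDegP H p ≤ 2 * t).card).card ≤ C * n := by
  classical
  obtain ⟨A, hA⟩ : ∃ A : ℕ, ∀ (n : ℕ) (H : Finset (Finset (Fin n))), (∀ e ∈ H, e.card = 3) →
      ¬ ContainsFanExp t H → (H.filter (FanExpansion.Ample t H)).card ≤ A * n :=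
    ⟨_, fun n H hH hF => by
      simpa only [Fintype.card_fin, mul_comm n] using FanExpansion.card_ample_le hH hF⟩
  refine ⟨A + FanExpansion.heavyDeg t * (A + t * t) + (FanExpansion.manyArms t +
    9 * (A + FanExpansion.heavyDeg t * (A + t * t)) +
    2 * (4 * (A + t * t) + 4 * t * (2 * t + 1))) * (2 * t), fun n H hH hF hmax => ?_⟩
  have hlow := FanExpansion.le_exFan3 (show 0 < t by omega) n
  have hample := hA n H hH hF
  have h := FanExpansion.card_two_medium_pairs_le ht hH hF (r := (A + t * t) * n) (by
    rw [Fintype.card_fin, hmax, add_mul]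
    omega)
  rw [Fintype.card_fin] at h
  refine le_trans (by convert h) (le_trans (Nat.add_le_add (Nat.add_le_add_right hample _)
    (Nat.mul_le_mul_right _ (Nat.add_le_add_right (Nat.add_le_add_left (Nat.mul_le_mul_left _
      (Nat.add_le_add_right hample _)) _) _))) (le_of_eq ?_))
  ring
end
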